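/- The affine matrix-ball construction κ₀ is a bijection from M̂_{m×n} onto Ω_dom, the set of all dominant triples (P₀, Q₀, ρ) such that P₀ ∈ CSST_[m](λ) and Q₀ ∈ CSST_[n](λ) for some partition λ ∈ 𝒫_m ∩ 𝒫_n and ρ ∈ ℤ^{λ₁}. -/

import Mathlib

open scoped Classical

namespace AffineRSK

/-- `ℤ × ℤ`-matrices with non-negative integer entries. -/
abbrev Mat : Type := ℤ → ℤ → ℕ

abbrev Cell : Type := ℤ × ℤ

/-- Generalized affine permutations of period `(m, n)`:
`a_{i+m, j+n} = a_{ij}` and each column has finite support. -/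
def IsGAP (m n : ℕ) (A : Mat) : Prop :=
  (∀ i j : ℤ, A (i + m) (j + n) = A i j) ∧ ∀ j : ℤ, {i : ℤ | A i j ≠ 0}.Finite

/-- Generalized dual affine permutations: entries in `{0, 1}`. -/
def IsGDAP (m n : ℕ) (A : Mat) : Prop :=
  IsGAP m n A ∧ ∀ i j : ℤ, A i j ≤ 1

def supp (A : Mat) : Set Cell := {c : Cell | A c.1 c.2 ≠ 0}

def tauC (m n : ℕ) (c : Cell) : Cell := (c.1 + (m : ℤ), c.2 + (n : ℤ))

/-- `NW c₁ c₂` means `c₁ >_NW c₂`. -/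
def NW (c₁ c₂ : Cell) : Prop := c₁.1 < c₂.1 ∧ c₁.2 < c₂.2

/-- `nwGe c₁ c₂` means `c₁ ≥_nw c₂`. -/
def nwGe (c₁ c₂ : Cell) : Prop := c₁.1 ≤ c₂.1 ∧ c₁.2 ≤ c₂.2

/-- `neLe c₁ c₂` means `c₁ ≤_ne c₂`. -/
def neLe (c₁ c₂ : Cell) : Prop := c₂.1 ≤ c₁.1 ∧ c₁.2 ≤ c₂.2

/-- `nWgt c₁ c₂` means `c₁ >_nW c₂` (dual order). -/
def nWgt (c₁ c₂ : Cell) : Prop := c₁.1 ≤ c₂.1 ∧ c₁.2 < c₂.2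

/-- `NeLt c₁ c₂` means `c₁ <_Ne c₂` (dual order). -/
def NeLt (c₁ c₂ : Cell) : Prop := c₂.1 < c₁.1 ∧ c₁.2 ≤ c₂.2

/-- A proper numbering on `A`. -/
def IsProper (A : Mat) (d : Cell → ℤ) : Prop :=
  (∀ c₁ ∈ supp A, ∀ c₂ ∈ supp A, NW c₂ c₁ → d c₂ < d c₁) ∧
    ∀ c₁ ∈ supp A, ∃ c₂ ∈ supp A, NW c₂ c₁ ∧ d c₂ = d c₁ - 1

/-- A dual proper numbering on `A`. -/
def IsProper' (A : Mat) (d : Cell → ℤ) : Prop :=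
  (∀ c₁ ∈ supp A, ∀ c₂ ∈ supp A, nWgt c₂ c₁ → d c₂ < d c₁) ∧
    ∀ c₁ ∈ supp A, ∃ c₂ ∈ supp A, nWgt c₂ c₁ ∧ d c₂ = d c₁ - 1

/-- An enumeration of a stream of flow `l`. -/
def IsStreamEnum (m n : ℕ) (e : ℤ → Cell) (l : ℕ) : Prop :=
  0 < l ∧ (∀ i : ℤ, NW (e i) (e (i + 1))) ∧ ∀ i : ℤ, tauC m n (e i) = e (i + l)

def IsStreamEnum' (m n : ℕ) (e : ℤ → Cell) (l : ℕ) : Prop :=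
  0 < l ∧ (∀ i : ℤ, nWgt (e i) (e (i + 1))) ∧ ∀ i : ℤ, tauC m n (e i) = e (i + l)

def IsStream (m n : ℕ) (S : Set Cell) (l : ℕ) : Prop :=
  ∃ e : ℤ → Cell, IsStreamEnum m n e l ∧ Set.range e = S

def IsStream' (m n : ℕ) (S : Set Cell) (l : ℕ) : Prop :=
  ∃ e : ℤ → Cell, IsStreamEnum' m n e l ∧ Set.range e = S

/-- A channel of `A`: a stream contained in `supp A` of maximal flow. -/
def IsChannel (m n : ℕ) (A : Mat) (C : Set Cell) : Prop :=
  ∃ l : ℕ, IsStream m n C l ∧ C ⊆ supp A ∧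
    ∀ (S : Set Cell) (l' : ℕ), IsStream m n S l' → S ⊆ supp A → l' ≤ l

def IsChannel' (m n : ℕ) (A : Mat) (C : Set Cell) : Prop :=
  ∃ l : ℕ, IsStream' m n C l ∧ C ⊆ supp A ∧
    ∀ (S : Set Cell) (l' : ℕ), IsStream' m n S l' → S ⊆ supp A → l' ≤ l

def Csw (A : Mat) (C : Set Cell) : Set Cell :=
  {c ∈ supp A | ∃ c' ∈ C, neLe c c'}

def Csw' (A : Mat) (C : Set Cell) : Set Cell :=
  {c ∈ supp A | c ∈ C ∨ ∃ c' ∈ C, NeLt c c'}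

/-- `swGe A C₁ C₂` means `C₁ ≽_sw C₂`. -/
def swGe (A : Mat) (C₁ C₂ : Set Cell) : Prop := C₁ ⊆ Csw A C₂

def swGe' (A : Mat) (C₁ C₂ : Set Cell) : Prop := C₁ ⊆ Csw' A C₂

/-- The set of values `d₀(c'_k) + k` over `>_NW`-chains from `c` to the channel
enumerated by `e` (where `d₀ (e idx) = idx`). -/
def chainSet (A : Mat) (e : ℤ → Cell) (c : Cell) : Set ℤ :=
  {v : ℤ | ∃ (k : ℕ) (ch : ℕ → Cell),
      ch 0 = c ∧ (∀ i ≤ k, ch i ∈ supp A) ∧ (∀ i < k, NW (ch (i + 1)) (ch i)) ∧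
        ∃ idx : ℤ, e idx = ch k ∧ v = idx + (k : ℤ)}

def chainSet' (A : Mat) (e : ℤ → Cell) (c : Cell) : Set ℤ :=
  {v : ℤ | ∃ (k : ℕ) (ch : ℕ → Cell),
      ch 0 = c ∧ (∀ i ≤ k, ch i ∈ supp A) ∧ (∀ i < k, nWgt (ch (i + 1)) (ch i)) ∧
        ∃ idx : ℤ, e idx = ch k ∧ v = idx + (k : ℤ)}

/-- `d` is the channel numbering `d^C_A` for the channel enumerated by `e`. -/
def IsChannelNumbering (A : Mat) (e : ℤ → Cell) (d : Cell → ℤ) : Prop :=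
  ∀ c ∈ supp A, IsGreatest (chainSet A e c) (d c)

def IsChannelNumbering' (A : Mat) (e : ℤ → Cell) (d : Cell → ℤ) : Prop :=
  ∀ c ∈ supp A, IsGreatest (chainSet' A e c) (d c)

/-- `e` enumerates the southwest channel of `A`. -/
def IsSWChannelEnum (m n : ℕ) (A : Mat) (e : ℤ → Cell) : Prop :=
  (∃ l : ℕ, IsStreamEnum m n e l) ∧ IsChannel m n A (Set.range e) ∧
    ∀ C : Set Cell, IsChannel m n A C → swGe A (Set.range e) C

def IsSWChannelEnum' (m n : ℕ) (A : Mat) (e : ℤ → Cell) : Prop :=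
  (∃ l : ℕ, IsStreamEnum' m n e l) ∧ IsChannel' m n A (Set.range e) ∧
    ∀ C : Set Cell, IsChannel' m n A C → swGe' A (Set.range e) C

/-- `d` is a southwest channel numbering of `A`. -/
def IsSWNumbering (m n : ℕ) (A : Mat) (d : Cell → ℤ) : Prop :=
  ∃ e : ℤ → Cell, IsSWChannelEnum m n A e ∧ IsChannelNumbering A e d

def IsSWNumbering' (m n : ℕ) (A : Mat) (d : Cell → ℤ) : Prop :=
  ∃ e : ℤ → Cell, IsSWChannelEnum' m n A e ∧ IsChannelNumbering' A e d

/-- A zig-zag: bi-infinite east/north lattice path, eventually east on the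
right and coming from the south on the left. -/
def IsZigZag (z : ℤ → Cell) : Prop :=
  (∀ i : ℤ, z (i + 1) = ((z i).1, (z i).2 + 1) ∨ z (i + 1) = ((z i).1 - 1, (z i).2)) ∧
  (∃ N : ℤ, ∀ i : ℤ, N ≤ i → z (i + 1) = ((z i).1, (z i).2 + 1)) ∧
    ∃ N : ℤ, ∀ i : ℤ, i ≤ N → z (i + 1) = ((z i).1 - 1, (z i).2)

def innerCorners (z : ℤ → Cell) : Set Cell :=
  {c : Cell | ∃ i : ℤ, z i = c ∧ z i = ((z (i - 1)).1 - 1, (z (i - 1)).2) ∧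
      z (i + 1) = ((z i).1, (z i).2 + 1)}

def outerCorners (z : ℤ → Cell) : Set Cell :=
  {c : Cell | ∃ i : ℤ, z i = c ∧ z i = ((z (i - 1)).1, (z (i - 1)).2 + 1) ∧
      z (i + 1) = ((z i).1 - 1, (z i).2)}

def levelSet (A : Mat) (d : Cell → ℤ) (k : ℤ) : Set Cell := {c ∈ supp A | d c = k}

/-- `≥_nw`-maximal cells of `S`. -/
def nwMaximal (S : Set Cell) : Set Cell := {c ∈ S | ∀ c' ∈ S, nwGe c' c → c' = c}

/-- `>_nW`-maximal cells of `S` (dual). -/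
def nWMaximal (S : Set Cell) : Set Cell := {c ∈ S | ∀ c' ∈ S, ¬ nWgt c' c}

/-- `z` is the zig-zag at level `k` associated to the numbering `d`. -/
def ZigZagAt (A : Mat) (d : Cell → ℤ) (k : ℤ) (z : ℤ → Cell) : Prop :=
  IsZigZag z ∧ innerCorners z = nwMaximal (levelSet A d k)

def ZigZagAt' (A : Mat) (d : Cell → ℤ) (k : ℤ) (z : ℤ → Cell) : Prop :=
  IsZigZag z ∧ innerCorners z = nWMaximal (levelSet A d k)

def IsInnerOf (A : Mat) (d : Cell → ℤ) (c : Cell) : Prop :=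
  ∃ (k : ℤ) (z : ℤ → Cell), ZigZagAt A d k z ∧ c ∈ innerCorners z

def IsOuterOf (A : Mat) (d : Cell → ℤ) (c : Cell) : Prop :=
  ∃ (k : ℤ) (z : ℤ → Cell), ZigZagAt A d k z ∧ c ∈ outerCorners z

def IsInnerOf' (A : Mat) (d : Cell → ℤ) (c : Cell) : Prop :=
  ∃ (k : ℤ) (z : ℤ → Cell), ZigZagAt' A d k z ∧ c ∈ innerCorners z

def IsOuterOf' (A : Mat) (d : Cell → ℤ) (c : Cell) : Prop :=
  ∃ (k : ℤ) (z : ℤ → Cell), ZigZagAt' A d k z ∧ c ∈ outerCorners z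

/-- `B` is obtained from `A` by subtracting `1` at inner corners and adding `1`
at outer corners. -/
def FlatEntries (A B : Mat) (Inn Out : Cell → Prop) : Prop :=
  ∀ c : Cell,
    (Inn c → B c.1 c.2 + 1 = A c.1 c.2) ∧
    (Out c → B c.1 c.2 = A c.1 c.2 + 1) ∧
    (¬ Inn c → ¬ Out c → B c.1 c.2 = A c.1 c.2)

/-- `B = A^♭`. -/
def FlatRel (m n : ℕ) (A B : Mat) : Prop :=
  ∃ d : Cell → ℤ, IsSWNumbering m n A d ∧
    FlatEntries A B (IsInnerOf A d) (IsOuterOf A d)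

/-- `B = A^{♭'}` (dual). -/
def FlatRel' (m n : ℕ) (A B : Mat) : Prop :=
  ∃ d : Cell → ℤ, IsSWNumbering' m n A d ∧
    FlatEntries A B (IsInnerOf' A d) (IsOuterOf' A d)

/-- `c` is the back-post corner of the zig-zag `z`:
`(row of rightmost inner corner, column of leftmost inner corner)`. -/
def IsBackPost (z : ℤ → Cell) (c : Cell) : Prop :=
  ∃ cr ∈ innerCorners z, ∃ cl ∈ innerCorners z,
    (∀ c' ∈ innerCorners z, c'.2 ≤ cr.2) ∧ (∀ c' ∈ innerCorners z, cl.2 ≤ c'.2) ∧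
      c = (cr.1, cl.2)

def backPostSet (A : Mat) (d : Cell → ℤ) : Set Cell :=
  {c : Cell | ∃ (k : ℤ) (z : ℤ → Cell), ZigZagAt A d k z ∧ IsBackPost z c}

def backPostSet' (A : Mat) (d : Cell → ℤ) : Set Cell :=
  {c : Cell | ∃ (k : ℤ) (z : ℤ → Cell), ZigZagAt' A d k z ∧ IsBackPost z c}

/-- Defining data `(a, b, r)` of the stream enumerated by `e` of flow `l`. -/
def StreamData (m n : ℕ) (e : ℤ → Cell) (l : ℕ) (a b : ℕ → ℤ) (r : ℤ) : Prop :=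
  ∃ r₁ r₂ : ℤ,
    (∀ p : ℕ, p < l → a p = (e (r₁ + 1 + p)).1 ∧ 1 ≤ a p ∧ a p ≤ (m : ℤ)) ∧
    (∀ p : ℕ, p < l → b p = (e (r₂ + 1 + p)).2 ∧ 1 ≤ b p ∧ b p ≤ (n : ℤ)) ∧
      r = r₁ - r₂

/-- The matrix-ball iteration `A = A^(0), A^(t) = (A^(t-1))^♭`, with
`A^(t) ≠ O` for `t < s` and `A^(s) = O`. -/
def MBCseq (m n : ℕ) (A : Mat) (s : ℕ) (Aseq : ℕ → Mat) : Prop :=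
  Aseq 0 = A ∧ (∀ t < s, Aseq t ≠ 0) ∧ Aseq s = 0 ∧
    ∀ t < s, FlatRel m n (Aseq t) (Aseq (t + 1))

def MBCseq' (m n : ℕ) (A : Mat) (s : ℕ) (Aseq : ℕ → Mat) : Prop :=
  Aseq 0 = A ∧ (∀ t < s, Aseq t ≠ 0) ∧ Aseq s = 0 ∧
    ∀ t < s, FlatRel' m n (Aseq t) (Aseq (t + 1))

/-- `κ₀(A) = (P, Q, ρ)`, with shape given by the column lengths `μ`:
the `t`-th columns (from the left, `0`-based) of `P` and `Q` are the defining
data of the stream of back-post corners of the zig-zags of `d^{sw}_{A^(t)}`. -/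
def Kappa0Rel (m n : ℕ) (A : Mat) (s : ℕ) (μ : ℕ → ℕ) (P Q : ℕ → ℕ → ℤ)
    (ρ : ℕ → ℤ) : Prop :=
  ∃ Aseq : ℕ → Mat, MBCseq m n A s Aseq ∧
    ∀ t < s, ∃ (d : Cell → ℤ) (e : ℤ → Cell),
      IsSWNumbering m n (Aseq t) d ∧ IsStreamEnum m n e (μ t) ∧
        Set.range e = backPostSet (Aseq t) d ∧
        StreamData m n e (μ t) (fun x => P x t) (fun x => Q x t) (ρ t)

def Kappa0Rel' (m n : ℕ) (A : Mat) (s : ℕ) (μ : ℕ → ℕ) (P Q : ℕ → ℕ → ℤ)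
    (ρ : ℕ → ℤ) : Prop :=
  ∃ Aseq : ℕ → Mat, MBCseq' m n A s Aseq ∧
    ∀ t < s, ∃ (d : Cell → ℤ) (e : ℤ → Cell),
      IsSWNumbering' m n (Aseq t) d ∧ IsStreamEnum' m n e (μ t) ∧
        Set.range e = backPostSet' (Aseq t) d ∧
        StreamData m n e (μ t) (fun x => P x t) (fun x => Q x t) (ρ t)

/-! ### Columns and the shift `τ` -/

/-- Extension of a column `c` of length `b` to `ℤ`: `c̃(x + bq) = c(x) + nq`. -/
def colExt (n b : ℕ) (c : ℕ → ℤ) (z : ℤ) : ℤ :=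
  c (Int.toNat (Int.emod z (b : ℤ))) + (n : ℤ) * Int.ediv z (b : ℤ)

/-- `τ_n^k` applied to a column of length `b`. -/
def tauPow (n b : ℕ) (k : ℤ) (c : ℕ → ℤ) : ℕ → ℤ :=
  fun x => colExt n b c ((x : ℤ) + k)

/-- The two-column tableau `(column t of T, τ_N^r(column (t+1) of T))`
(both of height `μ t`) is `ℤ`-semistandard. -/
def pairCond (N : ℕ) (μ : ℕ → ℕ) (T : ℕ → ℕ → ℤ) (t : ℕ) (r : ℕ) : Prop :=
  (∀ x : ℕ, x + 1 < μ t → T x t < T (x + 1) t) ∧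
  (∀ x : ℕ, x + 1 < μ t →
    tauPow N (μ t) (r : ℤ) (fun y => T y (t + 1)) x <
      tauPow N (μ t) (r : ℤ) (fun y => T y (t + 1)) (x + 1)) ∧
    ∀ x < μ t, T x t ≤ tauPow N (μ t) (r : ℤ) (fun y => T y (t + 1)) x

/-- The offset `r` for the adjacent pair of columns `(t, t+1)`. -/
noncomputable def rOff (N : ℕ) (μ : ℕ → ℕ) (T : ℕ → ℕ → ℤ) (t : ℕ) : ℕ :=
  sInf {r : ℕ | pairCond N μ T t r}

/-- Dual version: placing row `t` above row `τ_N^r(row (t+1))` (rows of the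
transposed tableau, i.e. columns of `T`) is `ℤ`-semistandard. -/
def dualPairCond (N : ℕ) (μ : ℕ → ℕ) (T : ℕ → ℕ → ℤ) (t : ℕ) (r : ℕ) : Prop :=
  (∀ x : ℕ, x + 1 < μ t → T x t ≤ T (x + 1) t) ∧
  (∀ x : ℕ, x + 1 < μ t →
    tauPow N (μ t) (r : ℤ) (fun y => T y (t + 1)) x ≤
      tauPow N (μ t) (r : ℤ) (fun y => T y (t + 1)) (x + 1)) ∧
    ∀ x < μ t, T x t < tauPow N (μ t) (r : ℤ) (fun y => T y (t + 1)) x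

noncomputable def rOffDual (N : ℕ) (μ : ℕ → ℕ) (T : ℕ → ℕ → ℤ) (t : ℕ) : ℕ :=
  sInf {r : ℕ | dualPairCond N μ T t r}

/-- First column of the rectangle block containing column `t`. -/
noncomputable def blockStart (μ : ℕ → ℕ) (t : ℕ) : ℕ := sInf {t' : ℕ | μ t' = μ t}

/-- The symmetrized offset entry attached to column `t`
(`η_j` where `j` is the position of `t` from the right in its block). -/
noncomputable def etaCol (N : ℕ) (μ : ℕ → ℕ) (T : ℕ → ℕ → ℤ) (t : ℕ) : ℕ :=
  ∑ u ∈ Finset.Ico (blockStart μ t) t, rOff N μ T u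

noncomputable def etaColDual (N : ℕ) (μ : ℕ → ℕ) (T : ℕ → ℕ → ℤ) (t : ℕ) : ℕ :=
  ∑ u ∈ Finset.Ico (blockStart μ t) t, rOffDual N μ T u

/-- Entries outside the shape are normalized to `0`. -/
def PadZeroT (s : ℕ) (μ : ℕ → ℕ) (T : ℕ → ℕ → ℤ) : Prop :=
  ∀ x t : ℕ, s ≤ t ∨ μ t ≤ x → T x t = 0

/-- `μ` encodes (the conjugate of) a partition `λ ∈ 𝒫_m ∩ 𝒫_n` with `s` columns. -/
def ShapeOK (m n s : ℕ) (μ : ℕ → ℕ) : Prop :=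
  (∀ t : ℕ, t + 1 < s → μ (t + 1) ≤ μ t) ∧ (∀ t < s, 0 < μ t ∧ μ t ≤ m ∧ μ t ≤ n) ∧
    ∀ t : ℕ, s ≤ t → μ t = 0

/-- Dual shape condition: `λ ∈ 𝒫_n`. -/
def ShapeOK' (n s : ℕ) (μ : ℕ → ℕ) : Prop :=
  (∀ t : ℕ, t + 1 < s → μ (t + 1) ≤ μ t) ∧ (∀ t < s, 0 < μ t ∧ μ t ≤ n) ∧
    ∀ t : ℕ, s ≤ t → μ t = 0

/-- `κ(A) = (P, Q)` where `Q` is obtained by shifting the `t`-th column of `Q₀`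
by `τ_n^{ρ_t + η_t}` (`η` the symmetrized offset vector of `P₀`). -/
def KappaRel (m n : ℕ) (A : Mat) (s : ℕ) (μ : ℕ → ℕ) (P Q : ℕ → ℕ → ℤ) : Prop :=
  ∃ (P' Q' : ℕ → ℕ → ℤ) (ρ : ℕ → ℤ),
    Kappa0Rel m n A s μ P' Q' ρ ∧
    (∀ t < s, ∀ x < μ t,
      P x t = P' x t ∧
        Q x t = tauPow n (μ t) (ρ t + (etaCol m μ P' t : ℤ)) (fun y => Q' y t) x) ∧
    PadZeroT s μ P ∧ PadZeroT s μ Q ∧ ∀ t : ℕ, s ≤ t → μ t = 0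

def KappaRel' (m n : ℕ) (A : Mat) (s : ℕ) (μ : ℕ → ℕ) (P Q : ℕ → ℕ → ℤ) : Prop :=
  ∃ (P' Q' : ℕ → ℕ → ℤ) (ρ : ℕ → ℤ),
    Kappa0Rel' m n A s μ P' Q' ρ ∧
    (∀ t < s, ∀ x < μ t,
      P x t = P' x t ∧
        Q x t = tauPow n (μ t) (ρ t + (etaColDual m μ P' t : ℤ)) (fun y => Q' y t) x) ∧
    PadZeroT s μ P ∧ PadZeroT s μ Q ∧ ∀ t : ℕ, s ≤ t → μ t = 0

/-- Membership in `⨆_{λ ∈ 𝒫_m ∩ 𝒫_n} CSST_[m](λ) × B_n(λ)`: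
`P` is column semistandard with entries in `{1, …, m}` and `Q` is a
`ℤ`-semistandard filling whose columns span less than `n` and whose rows
weakly increase within each rectangle block. -/
def InTargetRSK (m n s : ℕ) (μ : ℕ → ℕ) (P Q : ℕ → ℕ → ℤ) : Prop :=
  ShapeOK m n s μ ∧ PadZeroT s μ P ∧ PadZeroT s μ Q ∧
  (∀ t < s, ∀ x : ℕ, x + 1 < μ t → P x t < P (x + 1) t) ∧
  (∀ t < s, ∀ x < μ t, 1 ≤ P x t ∧ P x t ≤ (m : ℤ)) ∧
  (∀ t < s, ∀ x : ℕ, x + 1 < μ t → Q x t < Q (x + 1) t) ∧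
  (∀ t < s, Q (μ t - 1) t - Q 0 t < (n : ℤ)) ∧
    ∀ t : ℕ, t + 1 < s → μ t = μ (t + 1) → ∀ x < μ t, Q x t ≤ Q x (t + 1)

/-- Membership in `⨆_{λ ∈ 𝒫_n} RSST_[m](λ') × B_n(λ)`; the first component is
encoded by `P = P₀` (whose columns, weakly increasing with entries in
`{1, …, m}`, are the rows of `P₀ᵗ ∈ RSST_[m](λ')`). -/
def InTargetDual (m n s : ℕ) (μ : ℕ → ℕ) (P Q : ℕ → ℕ → ℤ) : Prop :=
  ShapeOK' n s μ ∧ PadZeroT s μ P ∧ PadZeroT s μ Q ∧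
  (∀ t < s, ∀ x : ℕ, x + 1 < μ t → P x t ≤ P (x + 1) t) ∧
  (∀ t < s, ∀ x < μ t, 1 ≤ P x t ∧ P x t ≤ (m : ℤ)) ∧
  (∀ t < s, ∀ x : ℕ, x + 1 < μ t → Q x t < Q (x + 1) t) ∧
  (∀ t < s, Q (μ t - 1) t - Q 0 t < (n : ℤ)) ∧
    ∀ t : ℕ, t + 1 < s → μ t = μ (t + 1) → ∀ x < μ t, Q x t ≤ Q x (t + 1)

/-- Dominance of a triple `(P, Q, ρ)`: within each rectangle block, the
sequence `ρ - ζ` (read right to left) is weakly decreasing, where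
`ζ = θ - η` with `η`, `θ` the symmetrized offset vectors of `P`, `Q`. -/
def Dominant (m n s : ℕ) (μ : ℕ → ℕ) (P Q : ℕ → ℕ → ℤ) (ρ : ℕ → ℤ) : Prop :=
  ∀ t : ℕ, t + 1 < s → μ t = μ (t + 1) →
    ρ t - ((etaCol n μ Q t : ℤ) - (etaCol m μ P t : ℤ)) ≤
      ρ (t + 1) - ((etaCol n μ Q (t + 1) : ℤ) - (etaCol m μ P (t + 1) : ℤ))

/-- `κ₀(A) = (P, Q, ρ)` with all data normalized outside the shape. -/
def Kappa0RelPad (m n : ℕ) (A : Mat) (s : ℕ) (μ : ℕ → ℕ) (P Q : ℕ → ℕ → ℤ)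
    (ρ : ℕ → ℤ) : Prop :=
  ∃ P' Q' : ℕ → ℕ → ℤ,
    Kappa0Rel m n A s μ P' Q' ρ ∧
    (∀ t < s, ∀ x < μ t, P x t = P' x t ∧ Q x t = Q' x t) ∧
    PadZeroT s μ P ∧ PadZeroT s μ Q ∧ (∀ t : ℕ, s ≤ t → μ t = 0) ∧
      ∀ t : ℕ, s ≤ t → ρ t = 0

/-- Membership in `Ω_dom`. -/
def InOmegaDom (m n s : ℕ) (μ : ℕ → ℕ) (P Q : ℕ → ℕ → ℤ) (ρ : ℕ → ℤ) : Prop :=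
  ShapeOK m n s μ ∧ PadZeroT s μ P ∧ PadZeroT s μ Q ∧ (∀ t : ℕ, s ≤ t → ρ t = 0) ∧
  (∀ t < s, ∀ x : ℕ, x + 1 < μ t → P x t < P (x + 1) t) ∧
  (∀ t < s, ∀ x < μ t, 1 ≤ P x t ∧ P x t ≤ (m : ℤ)) ∧
  (∀ t < s, ∀ x : ℕ, x + 1 < μ t → Q x t < Q (x + 1) t) ∧
  (∀ t < s, ∀ x < μ t, 1 ≤ Q x t ∧ Q x t ≤ (n : ℤ)) ∧
    Dominant m n s μ P Q ρ

/-- `A` has width `l`: some proper numbering has period `l`. -/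
def HasWidth (m n : ℕ) (A : Mat) (l : ℕ) : Prop :=
  ∃ d : Cell → ℤ, IsProper A d ∧ ∀ c ∈ supp A, d (tauC m n c) = d c + (l : ℤ)

/-! ### Crystal operators on matrices -/

/-- The first `+` of column `j` (row `i`) survives the signature reduction of
the sequence `σ` attached to rows `i, i+1`. -/
def SurvPlus (A : Mat) (i j : ℤ) : Prop :=
  0 < A i j ∧ ∀ j' : ℤ, j < j' →
    (∑ t ∈ Finset.Ioc j j', A (i + 1) t) ≤ (A i j - 1) + ∑ t ∈ Finset.Ioo j j', A i t

/-- The last `-` of column `j` (row `i+1`) survives the reduction. -/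
def SurvMinus (A : Mat) (i j : ℤ) : Prop :=
  0 < A (i + 1) j ∧ ∀ j' : ℤ, j' < j →
    (∑ t ∈ Finset.Ico j' j, A i t) ≤ (A (i + 1) j - 1) + ∑ t ∈ Finset.Ioo j' j, A (i + 1) t

/-- `A - Ê_{i₁ j} + Ê_{i₂ j}`. -/
noncomputable def subAddAt (m n : ℕ) (i₁ i₂ j : ℤ) (A : Mat) : Mat :=
  fun x y =>
    if ∃ k : ℤ, x = i₁ + k * m ∧ y = j + k * n then A x y - 1
    else if ∃ k : ℤ, x = i₂ + k * m ∧ y = j + k * n then A x y + 1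
    else A x y

/-- `f̃_i` on `M̂_{m×n}`, `0`-valued results encoded by `none`. -/
noncomputable def fMat (m n : ℕ) (i : ℤ) (A : Mat) : Option Mat :=
  if h : ∃ j : ℤ, SurvPlus A i j ∧ ∀ j' : ℤ, SurvPlus A i j' → j ≤ j' then
    some (subAddAt m n i (i + 1) h.choose A)
  else none

/-- `ẽ_i` on `M̂_{m×n}`. -/
noncomputable def eMat (m n : ℕ) (i : ℤ) (A : Mat) : Option Mat :=
  if h : ∃ j : ℤ, SurvMinus A i j ∧ ∀ j' : ℤ, SurvMinus A i j' → j' ≤ j then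
    some (subAddAt m n (i + 1) i h.choose A)
  else none

def transM (A : Mat) : Mat := fun i j => A j i

/-- `f̃^t_j A = (f̃_j (Aᵗ))ᵗ`. -/
noncomputable def fMatT (m n : ℕ) (j : ℤ) (A : Mat) : Option Mat :=
  (fMat n m j (transM A)).map transM

/-- `ẽ^t_j A = (ẽ_j (Aᵗ))ᵗ`. -/
noncomputable def eMatT (m n : ℕ) (j : ℤ) (A : Mat) : Option Mat :=
  (eMat n m j (transM A)).map transM

/-- Row operator (`f̃_i` if `x = true`, `ẽ_i` if `x = false`) on `M̂ ∪ {0}`. -/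
noncomputable def rowOp (m n : ℕ) (x : Bool) (i : ℤ) (o : Option Mat) : Option Mat :=
  o.bind (if x then fMat m n i else eMat m n i)

/-- Column operator (`f̃^t_j` or `ẽ^t_j`) on `M̂ ∪ {0}`. -/
noncomputable def colOp (m n : ℕ) (y : Bool) (j : ℤ) (o : Option Mat) : Option Mat :=
  o.bind (if y then fMatT m n j else eMatT m n j)

/-- The `+` of row `u`, column `j` survives the signature reduction of the
sequence attached to columns `j, j+1` (read along rows, top to bottom). -/
def ColSurvPlus (A : Mat) (j u : ℤ) : Prop :=
  0 < A u j ∧ ∀ u' : ℤ, u < u' →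
    (∑ i ∈ Finset.Ioc u u', A i (j + 1)) ≤ (A u j - 1) + ∑ i ∈ Finset.Ioo u u', A i j

/-- `A - Ê_{u j} + Ê_{u, j+1}`, the result of `f̃^t_j` acting at row `u`. -/
noncomputable def ftApply (m n : ℕ) (u j : ℤ) (A : Mat) : Mat :=
  fun x y =>
    if ∃ k : ℤ, x = u + k * m ∧ y = j + k * n then A x y - 1
    else if ∃ k : ℤ, x = u + k * m ∧ y = j + 1 + k * n then A x y + 1
    else A x y

/-! ### Crystal operators on tableaux -/

/-- Column `t` of `P` contributes a `+` for the letter `i`. -/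
def PhasPlus (μ : ℕ → ℕ) (P : ℕ → ℕ → ℤ) (i : ℤ) (t : ℕ) : Prop :=
  (∃ x < μ t, P x t = i) ∧ ∀ x < μ t, P x t ≠ i + 1

/-- Column `t` of `P` contributes a `-` for the letter `i`. -/
def PhasMinus (μ : ℕ → ℕ) (P : ℕ → ℕ → ℤ) (i : ℤ) (t : ℕ) : Prop :=
  (∃ x < μ t, P x t = i + 1) ∧ ∀ x < μ t, P x t ≠ i

/-- The `+` of column `t` survives the tensor-product signature reduction
(factors are the columns read from right to left). -/
def PSurvPlus (μ : ℕ → ℕ) (P : ℕ → ℕ → ℤ) (i : ℤ) (t : ℕ) : Prop :=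
  PhasPlus μ P i t ∧ ∀ t' < t,
    ((Finset.Ico t' t).filter (fun u => PhasMinus μ P i u)).card ≤
      ((Finset.Ioo t' t).filter (fun u => PhasPlus μ P i u)).card

def PSurvMinus (μ : ℕ → ℕ) (P : ℕ → ℕ → ℤ) (i : ℤ) (t : ℕ) : Prop :=
  PhasMinus μ P i t ∧ ∀ t'' : ℕ, t < t'' →
    ((Finset.Ioc t t'').filter (fun u => PhasPlus μ P i u)).card ≤
      ((Finset.Ioo t t'').filter (fun u => PhasMinus μ P i u)).card

/-- `f̃_i` on `P` acting on column `t₀` (replace the letter `i` by `i + 1`). -/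
noncomputable def applyPF (μ : ℕ → ℕ) (P : ℕ → ℕ → ℤ) (i : ℤ) (t₀ : ℕ) :
    ℕ → ℕ → ℤ :=
  fun x t => if t = t₀ ∧ x < μ t ∧ P x t = i then i + 1 else P x t

/-- `ẽ_i` on `P` acting on column `t₀`. -/
noncomputable def applyPE (μ : ℕ → ℕ) (P : ℕ → ℕ → ℤ) (i : ℤ) (t₀ : ℕ) :
    ℕ → ℕ → ℤ :=
  fun x t => if t = t₀ ∧ x < μ t ∧ P x t = i + 1 then i else P x t

/-- The entry at position `k` of a column `c` of height `b` can be increased. -/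
def QmovUp (n b : ℕ) (c : ℕ → ℤ) (k : ℕ) : Prop :=
  (k + 1 < b ∧ c k + 1 < c (k + 1)) ∨ (k + 1 = b ∧ c (b - 1) < c 0 + (n : ℤ) - 1)

/-- The entry at position `k` of a column `c` of height `b` can be decreased. -/
def QmovDown (n b : ℕ) (c : ℕ → ℤ) (k : ℕ) : Prop :=
  (0 < k ∧ c (k - 1) < c k - 1) ∨ (k = 0 ∧ c (b - 1) < c 0 + (n : ℤ) - 1)

def QhasPlus (n : ℕ) (μ : ℕ → ℕ) (Q : ℕ → ℕ → ℤ) (j : ℤ) (t : ℕ) : Prop :=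
  ∃ k < μ t, Int.emod (Q k t) (n : ℤ) = j ∧ QmovUp n (μ t) (fun y => Q y t) k

def QhasMinus (n : ℕ) (μ : ℕ → ℕ) (Q : ℕ → ℕ → ℤ) (j : ℤ) (t : ℕ) : Prop :=
  ∃ k < μ t, Int.emod (Q k t) (n : ℤ) = Int.emod (j + 1) (n : ℤ) ∧
    QmovDown n (μ t) (fun y => Q y t) k

def QSurvPlus (n : ℕ) (μ : ℕ → ℕ) (Q : ℕ → ℕ → ℤ) (j : ℤ) (t : ℕ) : Prop :=
  QhasPlus n μ Q j t ∧ ∀ t' < t,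
    ((Finset.Ico t' t).filter (fun u => QhasMinus n μ Q j u)).card ≤
      ((Finset.Ioo t' t).filter (fun u => QhasPlus n μ Q j u)).card

def QSurvMinus (n : ℕ) (μ : ℕ → ℕ) (Q : ℕ → ℕ → ℤ) (j : ℤ) (t : ℕ) : Prop :=
  QhasMinus n μ Q j t ∧ ∀ t'' : ℕ, t < t'' →
    ((Finset.Ioc t t'').filter (fun u => QhasPlus n μ Q j u)).card ≤
      ((Finset.Ioo t t'').filter (fun u => QhasMinus n μ Q j u)).card

/-- `f̃^t_j` on `Q` acting on column `t₀`. -/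
noncomputable def applyQF (n : ℕ) (μ : ℕ → ℕ) (Q : ℕ → ℕ → ℤ) (j : ℤ) (t₀ : ℕ) :
    ℕ → ℕ → ℤ :=
  fun x t =>
    if t = t₀ ∧ x < μ t ∧ Int.emod (Q x t) (n : ℤ) = j ∧
        QmovUp n (μ t) (fun y => Q y t) x
    then Q x t + 1 else Q x t

/-- `ẽ^t_j` on `Q` acting on column `t₀`. -/
noncomputable def applyQE (n : ℕ) (μ : ℕ → ℕ) (Q : ℕ → ℕ → ℤ) (j : ℤ) (t₀ : ℕ) :
    ℕ → ℕ → ℤ :=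
  fun x t =>
    if t = t₀ ∧ x < μ t ∧ Int.emod (Q x t) (n : ℤ) = Int.emod (j + 1) (n : ℤ) ∧
        QmovDown n (μ t) (fun y => Q y t) x
    then Q x t - 1 else Q x t

/-! ### Standardization -/

noncomputable def rowSumA (A : Mat) (i : ℤ) : ℕ := ∑ᶠ j : ℤ, A i j

noncomputable def colSumA (A : Mat) (j : ℤ) : ℕ := ∑ᶠ i : ℤ, A i j

/-- `A ∈ M̂_{m×n}(α, β)`. -/
def InMhatAB (m n : ℕ) (α β : ℕ → ℕ) (A : Mat) : Prop :=
  IsGAP m n A ∧ (∀ i : ℕ, 1 ≤ i → i ≤ m → rowSumA A i = α i) ∧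
    ∀ j : ℕ, 1 ≤ j → j ≤ n → colSumA A j = β j

/-- Extended affine permutations `W̃_K`. -/
def IsEAP (K : ℕ) (B : Mat) : Prop :=
  IsGAP K K B ∧ (∀ i j : ℤ, B i j ≤ 1) ∧ (∀ i : ℤ, ∃! j : ℤ, B i j ≠ 0) ∧
    ∀ j : ℤ, ∃! i : ℤ, B i j ≠ 0

/-- `i` is a descent of the matrix `B`. -/
def IsDescentM (B : Mat) (i : ℤ) : Prop :=
  ∃ j j' : ℤ, B i j ≠ 0 ∧ B (i + 1) j' ≠ 0 ∧ j' < j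

/-- Partial sums `α₁ + ⋯ + α_i`. -/
def psum (α : ℕ → ℕ) (i : ℕ) : ℕ := ∑ u ∈ Finset.Icc 1 i, α u

/-- `B` is `α`-descending. -/
def AlphaDescending (m : ℕ) (α : ℕ → ℕ) (B : Mat) : Prop :=
  ∀ k : ℕ, 1 ≤ k → k ≤ m → ∀ i : ℤ,
    (psum α (k - 1) : ℤ) < i → i < (psum α k : ℤ) → IsDescentM B i

/-- `B` is `(α, β)`-descending. -/
def IsABDescending (m n : ℕ) (α β : ℕ → ℕ) (B : Mat) : Prop :=
  AlphaDescending m α B ∧ AlphaDescending n β (transM B)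

/-- `B` standardizes `A`: blockwise entry sums of `B` over `𝓘_i × 𝓙_j`
equal the entries of `A`. -/
def PermOf (m n K : ℕ) (α β : ℕ → ℕ) (A B : Mat) : Prop :=
  ∀ (i₀ j₀ : ℕ) (q r : ℤ), 1 ≤ i₀ → i₀ ≤ m → 1 ≤ j₀ → j₀ ≤ n →
    A ((i₀ : ℤ) + q * m) ((j₀ : ℤ) + r * n) =
      ∑ k ∈ Finset.Icc ((psum α (i₀ - 1) : ℤ) + q * K + 1) ((psum α i₀ : ℤ) + q * K),
        ∑ l ∈ Finset.Icc ((psum β (j₀ - 1) : ℤ) + r * K + 1) ((psum β j₀ : ℤ) + r * K),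
          B k l

/-- Standardization of a column-semistandard tableau: for each value `v`, its
occurrences, from left to right, are replaced by consecutive integers starting
after the number of strictly smaller entries. -/
noncomputable def stdT (s : ℕ) (μ : ℕ → ℕ) (T : ℕ → ℕ → ℤ) : ℕ → ℕ → ℤ :=
  fun x t =>
    ((∑ t' ∈ Finset.range s,
        ((Finset.range (μ t')).filter (fun x' => T x' t' < T x t)).card : ℕ) : ℤ) +
      (((Finset.range t).filter (fun t' => ∃ x' < μ t', T x' t' = T x t)).card : ℤ) + 1

/-- `i` is a (column) descent of the tableau `T`: the letter `i + 1` occurs in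
a column strictly to the right of the column containing `i`. -/
def IsDescentT (s : ℕ) (μ : ℕ → ℕ) (T : ℕ → ℕ → ℤ) (i : ℤ) : Prop :=
  ∃ t < s, ∃ t' < s, ∃ x < μ t, ∃ x' < μ t', T x t = i ∧ T x' t' = i + 1 ∧ t < t'

/-! ### Rectangles, `B_n(R)` and `B_n(R)₀` (columns indexed from the right) -/

/-- `T ∈ B_n(R)` for the rectangle `R = (a^b)`; `T j x` is the entry at row `x`
of the `(j+1)`-st column from the right, normalized to `0` outside the shape. -/
def InBnR (n a b : ℕ) (T : ℕ → ℕ → ℤ) : Prop :=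
  (∀ j : ℕ, j + 1 < a → ∀ x < b, T (j + 1) x ≤ T j x) ∧
  (∀ j < a, ∀ x : ℕ, x + 1 < b → T j x < T j (x + 1)) ∧
  (∀ j < a, T j (b - 1) - T j 0 < (n : ℤ)) ∧
    ∀ j x : ℕ, a ≤ j ∨ b ≤ x → T j x = 0

/-- `T ∈ B_n(R)₀`: `(T^{j+1}, τ_n^{-1}(T^j))` is not semistandard for any `j`. -/
def InBnR0 (n a b : ℕ) (T : ℕ → ℕ → ℤ) : Prop :=
  InBnR n a b T ∧
    ∀ j : ℕ, j + 1 < a → ¬ ∀ x < b, T (j + 1) x ≤ tauPow n b (-1) (fun y => T j y) x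

/-- `ν ∈ 𝒫_{a-1}`: a partition `ν₁ ≥ ⋯ ≥ ν_{a-1} ≥ 0`, normalized. -/
def IsPartLen (a : ℕ) (ν : ℕ → ℕ) : Prop :=
  ν 0 = 0 ∧ (∀ j : ℕ, 1 ≤ j → j + 2 ≤ a → ν (j + 1) ≤ ν j) ∧ ∀ j : ℕ, a ≤ j → ν j = 0

/-- `(T, ν) ↦ τ_n^{ν_rev}(T)`: the column `j` (from the right, 0-based) is
shifted by `τ_n^{ν_{j+1}}`. -/
noncomputable def PhiMap (n a b : ℕ) (T : ℕ → ℕ → ℤ) (ν : ℕ → ℕ) : ℕ → ℕ → ℤ :=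
  fun j x => if j < a ∧ x < b then tauPow n b ((ν (j + 1) : ℤ)) (fun y => T j y) x else 0

/-- The offset `r_j` of `T` (columns from the right, paper indexing `j ≥ 1`). -/
noncomputable def rOffR (n b : ℕ) (T : ℕ → ℕ → ℤ) (j : ℕ) : ℕ :=
  sInf {r : ℕ | ∀ x < b, T j x ≤ tauPow n b ((r : ℤ)) (fun y => T (j - 1) y) x}

/-- The symmetrized offset `η_j = r_j + ⋯ + r_{a-1}`. -/
noncomputable def etaR (n a b : ℕ) (T : ℕ → ℕ → ℤ) (j : ℕ) : ℕ :=
  ∑ u ∈ Finset.Icc j (a - 1), rOffR n b T u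

/-! ### The two-column setup -/

/-- Row coordinates of the stream with defining data `(a, ·, ρ)`:
`X(p + ρ + ql) = a(p) + qm` for `1 ≤ p ≤ l`. -/
def streamX (m l : ℕ) (a : ℕ → ℤ) (ρ : ℤ) (idx : ℤ) : ℤ := colExt m l a (idx - ρ - 1)

/-- Column coordinates: `Y(p + ql) = b(p) + qn` for `1 ≤ p ≤ l`. -/
def streamY (n l : ℕ) (b : ℕ → ℤ) (idx : ℤ) : ℤ := colExt n l b (idx - 1)

/-- The matrix built from the interleaved streams `t` and `t'`. -/
noncomputable def twoColMat (m n l : ℕ) (a1 a2 b1 b2 : ℕ → ℤ) (ρ₁ ρ₂ k : ℤ) : Mat :=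
  fun x y =>
    (if ∃ i : ℤ, streamX m l a2 ρ₂ (i + k) = x ∧ streamY n l b1 i = y then 1 else 0) +
      (if ∃ i : ℤ, streamX m l a1 ρ₁ i = x ∧ streamY n l b2 (i + k) = y then 1 else 0)

lemma int_max (P : ℤ → Prop) (b : ℤ) (hb : ∀ z, P z → z ≤ b) (h : ∃ z, P z) :
    ∃ z, P z ∧ ∀ z', P z' → z' ≤ z := Int.exists_greatest_of_bdd ⟨b, hb⟩ h

lemma int_min (P : ℤ → Prop) (b : ℤ) (hb : ∀ z, P z → b ≤ z) (h : ∃ z, P z) :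
    ∃ z, P z ∧ ∀ z', P z' → z ≤ z' := Int.exists_least_of_bdd ⟨b, hb⟩ h

lemma step_mono (R : ℤ → ℤ) (hR : ∀ i, R i < R (i + 1)) : StrictMono R :=
  strictMono_int_of_lt_succ hR

lemma step_add (R : ℤ → ℤ) (hR : ∀ i, R i < R (i + 1)) (i : ℤ) (k : ℕ) : R i + k ≤ R (i + k) := by
  induction k with
  | zero => simp
  | succ k ih => have := hR (i + k); push_cast; rw [← add_assoc]; rw [← add_assoc]; omega

lemma step_add' (R : ℤ → ℤ) (hR : ∀ i, R i < R (i + 1)) {i j : ℤ} (h : i ≤ j) :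
    R i + (j - i) ≤ R j := by
  have := step_add R hR i (j - i).toNat
  have e : ((j - i).toNat : ℤ) = j - i := Int.toNat_of_nonneg (by omega)
  rw [e] at this
  simpa using this

lemma step_cut (R : ℤ → ℤ) (hR : ∀ i, R i < R (i + 1)) (v : ℤ) : ∃ j, R j ≤ v ∧ v < R (j + 1) := by
  have h0 : ∃ z, R z ≤ v := by
    refine ⟨min 0 (v - R 0), ?_⟩
    have := step_add' R hR (min_le_left 0 (v - R 0))
    have h2 := min_le_right 0 (v - R 0)
    omega
  obtain ⟨j, h1, h2⟩ := int_max (fun z => R z ≤ v) (max 0 (v - R 0)) (by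
    intro z hz
    by_contra hcon
    have := step_add' R hR (i := 0) (j := z) (by omega)
    omega) h0
  refine ⟨j, h1, ?_⟩
  by_contra h
  have := h2 (j + 1) (by omega)
  omega

/-- numeric crossing lemma -/
lemma crossing_num (R C : ℤ → ℤ) (hR : ∀ i, R i < R (i + 1)) (hC : ∀ i, C i < C (i + 1))
    (N a m n : ℕ) (ha : 2 ≤ a) (hm : 0 < m) (hn : 0 < n)
    (pR : ∀ i, R (i + N) = R i + a * m) (pC : ∀ i, C (i + N) = C i + a * n) :
    ∃ i j : ℤ, i ≤ j ∧ j < i + N ∧ R i + m < R (j + 1) ∧ C i + n < C (j + 1) ∧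
      R j < R (i + 1) + m ∧ C j < C (i + 1) + n := by
  by_contra hno
  push Not at hno
  have mR := step_mono R hR
  have mC := step_mono C hC
  choose φ hφ1 hφ2 using fun i => step_cut R hR (R i + m)
  choose ψ hψ1 hψ2 using fun i => step_cut C hC (C i + n)
  have am : (m : ℤ) < a * m := by
    have : (2 : ℤ) ≤ a := by exact_mod_cast ha
    have : (0 : ℤ) < m := by exact_mod_cast hm
    nlinarith
  have an : (n : ℤ) < a * n := by
    have : (2 : ℤ) ≤ a := by exact_mod_cast ha
    have : (0 : ℤ) < n := by exact_mod_cast hn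
    nlinarith
  have φi : ∀ i, i ≤ φ i := fun i => by
    by_contra h
    have := mR.monotone (show φ i + 1 ≤ i by omega)
    have := hφ2 i; omega
  have ψi : ∀ i, i ≤ ψ i := fun i => by
    by_contra h
    have := mC.monotone (show ψ i + 1 ≤ i by omega)
    have := hψ2 i; omega
  have φN : ∀ i, φ i < i + N := fun i => by
    by_contra h
    have := mR.monotone (show i + N ≤ φ i by omega)
    have := hφ1 i; rw [pR] at *; omega
  have ψN : ∀ i, ψ i < i + N := fun i => by
    by_contra h
    have := mC.monotone (show i + N ≤ ψ i by omega)
    have := hψ1 i; rw [pC] at *; omega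
  have φm : ∀ i, φ i ≤ φ (i + 1) := fun i => by
    by_contra h
    have := mR.monotone (show φ (i + 1) + 1 ≤ φ i by omega)
    have := hφ1 i; have := hφ2 (i + 1); have := hR i; omega
  have ψm : ∀ i, ψ i ≤ ψ (i + 1) := fun i => by
    by_contra h
    have := mC.monotone (show ψ (i + 1) + 1 ≤ ψ i by omega)
    have := hψ1 i; have := hψ2 (i + 1); have := hC i; omega
  have ne : ∀ i, φ i ≠ ψ i := fun i h => by
    have := hno i (φ i) (φi i) (φN i) (hφ2 i) (by rw [h]; exact hψ2 i)
      (by have := hφ1 i; have := hR i; omega)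
    have := hψ1 i; have := hC i; rw [← h] at *; omega
  have prop1 : ∀ i, φ i < ψ i → φ (i + 1) < ψ (i + 1) := fun i h => by
    by_contra h'
    have hne := ne (i + 1)
    have h1 := ψm i
    have := mR (show ψ i < φ (i + 1) by omega)
    have := mR.monotone (show φ i + 1 ≤ ψ i + 1 by omega)
    have := hφ2 i
    have := hφ1 (i + 1)
    have := hψ1 i
    have := hC i
    have := hno i (ψ i) (ψi i) (ψN i) (by omega) (hψ2 i) (by omega)
    omega
  have prop2 : ∀ i, ψ i < φ i → ψ (i + 1) < φ (i + 1) := fun i h => by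
    by_contra h'
    have hne := ne (i + 1)
    have h1 := φm i
    have := mC (show φ i < ψ (i + 1) by omega)
    have := mC.monotone (show ψ i + 1 ≤ φ i + 1 by omega)
    have := hψ2 i
    have := hψ1 (i + 1)
    have := hφ1 i
    have := hR i
    have := hno i (φ i) (φi i) (φN i) (hφ2 i) (by omega) (by omega)
    omega
  rcases lt_or_gt_of_ne (ne 0) with h0 | h0
  · have hall : ∀ i : ℕ, φ i < ψ i := by
      intro i; induction i with
      | zero => simpa using h0
      | succ k ih => push_cast; exact prop1 _ ih
    have it : ∀ t : ℕ, ∃ i : ℤ, 0 ≤ i ∧ C i ≤ C 0 + t * n ∧ (R 0 + t * m ≤ R i) ∧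
        (0 < t → R 0 + t * m < R i) := by
      intro t; induction t with
      | zero => exact ⟨0, le_refl _, by simp, by simp, by simp⟩
      | succ t ih =>
        obtain ⟨i, hi, h1, h2, h3⟩ := ih
        have := hall i.toNat
        rw [Int.toNat_of_nonneg hi] at this
        have hr := mR.monotone (show φ i + 1 ≤ ψ i by omega)
        have h4 := hφ2 i
        have h5 := hψ1 i
        refine ⟨ψ i, by have := ψi i; omega, ?_, ?_, fun _ => ?_⟩
        · push_cast; linarith
        · push_cast; linarith
        · push_cast; linarith
    obtain ⟨i, _, h1, _, h3⟩ := it a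
    have h3 := h3 (by omega)
    have e1 := pR 0
    have e2 := pC 0
    rw [zero_add] at e1 e2
    rw [← e1] at h3
    rw [← e2] at h1
    have h3 := mR.lt_iff_lt.1 h3
    have h1 := mC.le_iff_le.1 h1
    omega
  · have hall : ∀ i : ℕ, ψ i < φ i := by
      intro i; induction i with
      | zero => simpa using h0
      | succ k ih => push_cast; exact prop2 _ ih
    have it : ∀ t : ℕ, ∃ i : ℤ, 0 ≤ i ∧ R i ≤ R 0 + t * m ∧ (C 0 + t * n ≤ C i) ∧
        (0 < t → C 0 + t * n < C i) := by
      intro t; induction t with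
      | zero => exact ⟨0, le_refl _, by simp, by simp, by simp⟩
      | succ t ih =>
        obtain ⟨i, hi, h1, h2, h3⟩ := ih
        have := hall i.toNat
        rw [Int.toNat_of_nonneg hi] at this
        have hr := mC.monotone (show ψ i + 1 ≤ φ i by omega)
        have h4 := hψ2 i
        have h5 := hφ1 i
        refine ⟨φ i, by have := φi i; omega, ?_, ?_, fun _ => ?_⟩
        · push_cast; linarith
        · push_cast; linarith
        · push_cast; linarith
    obtain ⟨i, _, h1, _, h3⟩ := it a
    have h3 := h3 (by omega)
    have e1 := pR 0
    have e2 := pC 0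
    rw [zero_add] at e1 e2
    rw [← e2] at h3
    rw [← e1] at h1
    have h3 := mC.lt_iff_lt.1 h3
    have h1 := mR.le_iff_le.1 h1
    omega

/-- shift of cells -/
def sh (m n : ℕ) (k : ℤ) (c : Cell) : Cell := (c.1 + k * m, c.2 + k * n)

lemma sh_zero (m n : ℕ) (c : Cell) : sh m n 0 c = c := by simp [sh]
lemma sh_sh (m n : ℕ) (a b : ℤ) (c : Cell) : sh m n a (sh m n b c) = sh m n (a + b) c := by
  simp only [sh, Prod.mk.injEq]; constructor <;> ring
lemma tauC_eq (m n : ℕ) (c : Cell) : tauC m n c = sh m n 1 c := by simp [sh, tauC]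
lemma sh_NW {m n : ℕ} {k : ℤ} {c c' : Cell} : NW (sh m n k c) (sh m n k c') ↔ NW c c' := by
  simp [NW, sh]
lemma sh_neLe {m n : ℕ} {k : ℤ} {c c' : Cell} : neLe (sh m n k c) (sh m n k c') ↔ neLe c c' := by
  simp [neLe, sh]

lemma NW.trans {a b c : Cell} (h : NW a b) (h' : NW b c) : NW a c :=
  ⟨h.1.trans h'.1, h.2.trans h'.2⟩

lemma gap_shift {m n : ℕ} {A : Mat} (hA : IsGAP m n A) (k i j : ℤ) :
    A (i + k * m) (j + k * n) = A i j := by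
  induction k using Int.induction_on with
  | zero => simp
  | succ k ih => rw [← ih, ← hA.1 (i + k * m) (j + k * n)]; congr 1 <;> ring
  | pred k ih => rw [← ih, ← hA.1 (i + (-k - 1) * m) (j + (-k - 1) * n)]; congr 1 <;> ring

lemma sh_supp {m n : ℕ} {A : Mat} (hA : IsGAP m n A) {k : ℤ} {c : Cell} :
    sh m n k c ∈ supp A ↔ c ∈ supp A := by
  simp only [supp, sh, Set.mem_ofPred_eq, gap_shift hA]

/-- periodic extension -/
lemma per_ext {m n : ℕ} {S : Set Cell} (hS : ∀ k c, c ∈ S → sh m n k c ∈ S)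
    (N : ℕ) (hN : 0 < N) (a : ℤ) (ch : ℕ → Cell) (h1 : ∀ t < N, ch t ∈ S)
    (h2 : ∀ t < N, NW (ch t) (ch (t + 1))) (h3 : ch N = sh m n a (ch 0)) :
    ∃ γ : ℤ → Cell, (∀ t : ℕ, t < N → γ t = ch t) ∧ (∀ i, γ i ∈ S) ∧ (∀ i, NW (γ i) (γ (i + 1))) ∧
      ∀ i, γ (i + N) = sh m n a (γ i) := by
  have hN' : (0 : ℤ) < N := by exact_mod_cast hN
  let γ : ℤ → Cell := fun z => sh m n (a * (z / N)) (ch (z % N).toNat)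
  have per : ∀ i, γ (i + N) = sh m n a (γ i) := by
    intro i
    simp only [γ]
    rw [Int.add_emod_right, Int.add_ediv_of_dvd_right (dvd_refl _), Int.ediv_self hN'.ne', sh_sh]
    congr 1; ring
  refine ⟨γ, ?_, ?_, ?_, per⟩
  · intro t ht
    have : (t : ℤ) < N := by exact_mod_cast ht
    simp only [γ]
    rw [Int.emod_eq_of_lt (by omega) this, Int.ediv_eq_zero_of_lt (by omega) this]
    simp [sh_zero]
  · intro i
    apply hS
    apply h1
    have := Int.emod_lt_of_pos i hN'
    have := Int.emod_nonneg i hN'.ne'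
    omega
  · intro i
    have b1 := Int.emod_lt_of_pos i hN'
    have b2 := Int.emod_nonneg i hN'.ne'
    have b3 := Int.emod_add_mul_ediv i N
    set q := i / N
    set r := i % N
    by_cases hr : r + 1 < N
    · have e1 : (i + 1) / N = q := by
        rw [← b3, show r + N * q + 1 = (r + 1) + N * q by ring, Int.add_mul_ediv_left _ _ hN'.ne',
          Int.ediv_eq_zero_of_lt (by omega) hr]; simp
      have e2 : (i + 1) % N = r + 1 := by
        rw [← b3, show r + N * q + 1 = (r + 1) + N * q by ring, Int.add_mul_emod_self_left,
          Int.emod_eq_of_lt (by omega) hr]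
      simp only [γ]
      rw [e1, e2, sh_NW]
      have := h2 r.toNat (by omega)
      rw [show (r + 1).toNat = r.toNat + 1 by omega]
      exact this
    · have hr : r + 1 = N := by omega
      have e1 : (i + 1) / N = q + 1 := by
        rw [← b3, show r + N * q + 1 = (r + 1) + N * q by ring, hr,
          Int.add_mul_ediv_left _ _ hN'.ne', Int.ediv_self hN'.ne']; ring
      have e2 : (i + 1) % N = 0 := by
        rw [← b3, show r + N * q + 1 = (r + 1) + N * q by ring, Int.add_mul_emod_self_left, hr]
        simp
      simp only [γ]
      rw [e1, e2]
      have := h2 r.toNat (by omega)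
      rw [show r.toNat + 1 = N by omega, h3] at this
      rw [← sh_NW (k := a * q), sh_sh] at this
      rw [show a * (q + 1) = a * q + a by ring]
      exact this

/-- Cycle lemma -/
lemma cycle_lemma {m n : ℕ} (hm : 0 < m) (hn : 0 < n) {S : Set Cell}
    (hS : ∀ k c, c ∈ S → sh m n k c ∈ S) (l : ℕ)
    (hl : ∀ e l', IsStreamEnum m n e l' → (∀ i, e i ∈ S) → l' ≤ l) :
    ∀ a : ℕ, 0 < a → ∀ (N : ℕ) (ch : ℕ → Cell), (∀ t < N, ch t ∈ S) →
      (∀ t < N, NW (ch t) (ch (t + 1))) → ch N = sh m n a (ch 0) → N ≤ a * l := by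
  intro a
  induction a using Nat.strong_induction_on with
  | _ a ih =>
  intro ha N ch h1 h2 h3
  rcases Nat.eq_zero_or_pos N with hN | hN
  · omega
  obtain ⟨γ, g1, g2, g3, g4⟩ := per_ext hS N hN a ch h1 h2 h3
  rcases Nat.lt_or_ge a 2 with h | h
  · obtain rfl : a = 1 := by omega
    have := hl γ N ⟨hN, g3, fun i => by rw [g4, tauC_eq]; rfl⟩ g2
    omega
  · obtain ⟨i, j, ij, jN, c1, c2, c3, c4⟩ := crossing_num (fun i => (γ i).1) (fun i => (γ i).2)
      (fun i => (g3 i).1) (fun i => (g3 i).2) N a m n h hm hn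
      (fun i => by simp [g4, sh]) (fun i => by simp [g4, sh])
    have key1 : (j - i).toNat ≤ 1 * l := by
      rcases eq_or_lt_of_le ij with e | hij
      · subst e; simp
      let c' : ℕ → Cell := fun t => if t < (j - i).toNat then γ (i + 1 + t) else sh m n 1 (γ (i + 1))
      refine ih 1 (by omega) (by omega) (j - i).toNat c' ?_ ?_ ?_
      · intro t ht; simp only [c', ht, if_true]; exact g2 _
      · intro t ht
        simp only [c', ht, if_true]
        split_ifs with h'
        · have := g3 (i + 1 + t); push_cast; rw [← add_assoc]; exact this
        · have : i + 1 + t = j := by omega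
          rw [this]
          simp only [NW, sh]
          constructor <;> push_cast <;> linarith
      · have : 0 < (j - i).toNat := by omega
        simp only [c', lt_irrefl, if_false, this, if_true]; simp
    have key2 : (i + N - j).toNat ≤ (a - 1) * l := by
      let c' : ℕ → Cell := fun t => if t < (i + N - j).toNat then γ (j + 1 + t)
        else sh m n (a - 1 : ℕ) (γ (j + 1))
      refine ih (a - 1) (by omega) (by omega) _ c' ?_ ?_ ?_
      · intro t ht; simp only [c', ht, if_true]; exact g2 _
      · intro t ht
        simp only [c', ht, if_true]
        split_ifs with h'
        · have := g3 (j + 1 + t); push_cast; rw [← add_assoc]; exact this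
        · have : j + 1 + t = i + N := by omega
          rw [this, g4]
          have e : ((a - 1 : ℕ) : ℤ) = a - 1 := by omega
          simp only [NW, sh, e]
          constructor <;> nlinarith
      · have : 0 < (i + N - j).toNat := by omega
        simp only [c', lt_irrefl, if_false, this, if_true]; simp
    have : N = (j - i).toNat + (i + N - j).toNat := by omega
    have e : a * l = 1 * l + (a - 1) * l := by rw [← add_mul]; congr 1; omega
    omega

lemma supp_slab_finite {m n : ℕ} {A : Mat} (hA : IsGAP m n A) :
    {c : Cell | c ∈ supp A ∧ 0 ≤ c.2 ∧ c.2 < n}.Finite := by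
  have : {c : Cell | c ∈ supp A ∧ 0 ≤ c.2 ∧ c.2 < n} ⊆
      ⋃ j ∈ Set.Ico (0 : ℤ) n, (fun i => ((i, j) : Cell)) '' {i : ℤ | A i j ≠ 0} := by
    rintro ⟨i, j⟩ ⟨h1, h2, h3⟩
    simp only [Set.mem_iUnion]
    exact ⟨j, ⟨h2, h3⟩, i, h1, rfl⟩
  refine Set.Finite.subset ?_ this
  exact Set.Finite.biUnion (Set.finite_Ico _ _) fun j _ => (hA.2 j).image _

lemma slab_rep {m n : ℕ} (hn : 0 < n) (c : Cell) :
    ∃ q : ℤ, 0 ≤ (sh m n q c).2 ∧ (sh m n q c).2 < n := by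
  have hn' : (0 : ℤ) < n := by exact_mod_cast hn
  refine ⟨-(c.2 / n), ?_⟩
  have b1 := Int.emod_lt_of_pos c.2 hn'
  have b2 := Int.emod_nonneg c.2 hn'.ne'
  have b3 := Int.emod_add_mul_ediv c.2 n
  simp only [sh]
  constructor <;> nlinarith

lemma gap_band {m n : ℕ} (hn : 0 < n) {A : Mat} (hA : IsGAP m n A) :
    ∃ K : ℤ, 0 ≤ K ∧ ∀ i j : ℤ, A i j ≠ 0 → (n : ℤ) * i - m * j ≤ K ∧ (m : ℤ) * j - n * i ≤ K := by
  have hf := (supp_slab_finite hA).image (fun c : Cell => |(n : ℤ) * c.1 - m * c.2|)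
  obtain ⟨K, hK⟩ := hf.bddAbove
  refine ⟨max K 0, le_max_right _ _, fun i j hij => ?_⟩
  obtain ⟨q, h1, h2⟩ := slab_rep (m := m) hn (i, j)
  have := hK ⟨sh m n q (i, j), ⟨(sh_supp hA).2 hij, h1, h2⟩, rfl⟩
  simp only [sh] at this
  have e : (n : ℤ) * (i + q * m) - m * (j + q * n) = n * i - m * j := by ring
  rw [e] at this
  have h3 := abs_le.1 (this.trans (le_max_left K 0))
  constructor <;> linarith [h3.1, h3.2]

structure Lev (m n l : ℕ) (W : Set Cell) (D : Cell → ℤ) : Prop where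
  lpos : 0 < l
  inv : ∀ (k : ℤ) (c : Cell), c ∈ W → sh m n k c ∈ W
  per : ∀ (k : ℤ) (c : Cell), c ∈ W → D (sh m n k c) = D c + k * l
  str : ∀ c ∈ W, ∀ c' ∈ W, NW c c' → D c < D c'
  fin : ∀ k : ℤ, {c : Cell | c ∈ W ∧ D c = k}.Finite

lemma lev_fin {m n l : ℕ} (hn : 0 < n) {A : Mat} (hA : IsGAP m n A) {W : Set Cell}
    (hW : W ⊆ supp A) (hl : 0 < l) {D : Cell → ℤ}
    (per : ∀ (k : ℤ) (c : Cell), c ∈ W → D (sh m n k c) = D c + k * l) (k : ℤ) :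
    {c : Cell | c ∈ W ∧ D c = k}.Finite := by
  have hl' : (0 : ℤ) < l := by exact_mod_cast hl
  refine Set.Finite.subset ((supp_slab_finite hA).image (fun c => sh m n ((k - D c) / l) c)) ?_
  rintro c ⟨hc, hk⟩
  obtain ⟨q, h1, h2⟩ := slab_rep (m := m) hn c
  refine ⟨sh m n q c, ⟨(sh_supp hA).2 (hW hc), h1, h2⟩, ?_⟩
  have := per q c hc
  simp only [sh_sh, this]
  rw [show k - (D c + q * l) = -q * l by rw [hk]; ring, Int.mul_ediv_cancel _ hl'.ne']
  simp [sh_zero]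

lemma lev_sub {m n l : ℕ} {W W' : Set Cell} {D : Cell → ℤ} (h : Lev m n l W D) (hW : W' ⊆ W)
    (inv : ∀ (k : ℤ) (c : Cell), c ∈ W' → sh m n k c ∈ W') : Lev m n l W' D :=
  ⟨h.lpos, inv, fun k c hc => h.per k c (hW hc), fun c hc c' hc' => h.str c (hW hc) c' (hW hc'),
    fun k => (h.fin k).subset fun _ hc => ⟨hW hc.1, hc.2⟩⟩

lemma neLe_antisymm {c c' : Cell} (h : neLe c c') (h' : neLe c' c) : c = c' :=
  Prod.ext (le_antisymm h'.1 h.1) (le_antisymm h.2 h'.2)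

lemma neLe.trans {a b c : Cell} (h : neLe a b) (h' : neLe b c) : neLe a c :=
  ⟨h'.1.trans h.1, h.2.trans h'.2⟩

lemma neLe_total_of {c c' : Cell} (h : ¬ NW c c') (h' : ¬ NW c' c) : neLe c c' ∨ neLe c' c := by
  simp only [NW, neLe] at *; omega

lemma Lev.cmp {m n l : ℕ} {W : Set Cell} {D : Cell → ℤ} (h : Lev m n l W D) {c c' : Cell}
    (hc : c ∈ W) (hc' : c' ∈ W) (e : D c = D c') : neLe c c' ∨ neLe c' c :=
  neLe_total_of (fun hh => by have := h.str _ hc _ hc' hh; omega)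
    (fun hh => by have := h.str _ hc' _ hc hh; omega)

lemma exists_ne_most {S : Set Cell} (hf : S.Finite) (hne : S.Nonempty)
    (hc : ∀ c ∈ S, ∀ c' ∈ S, neLe c c' ∨ neLe c' c) : ∃ c ∈ S, ∀ c' ∈ S, neLe c' c := by
  obtain ⟨c, h1, h2⟩ := Set.exists_max_image S (fun c => c.2 - c.1) hf hne
  refine ⟨c, h1, fun c' h' => ?_⟩
  have := h2 c' h'
  rcases hc c h1 c' h' with h | h
  · simp only [neLe] at *; omega
  · exact h

lemma exists_sw_most {S : Set Cell} (hf : S.Finite) (hne : S.Nonempty)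
    (hc : ∀ c ∈ S, ∀ c' ∈ S, neLe c c' ∨ neLe c' c) : ∃ c ∈ S, ∀ c' ∈ S, neLe c c' := by
  obtain ⟨c, h1, h2⟩ := Set.exists_max_image S (fun c => c.1 - c.2) hf hne
  refine ⟨c, h1, fun c' h' => ?_⟩
  have := h2 c' h'
  rcases hc c h1 c' h' with h | h
  · exact h
  · simp only [neLe] at *; omega

lemma levels_nonempty {W : Set Cell} {D : Cell → ℤ} (hne : W.Nonempty)
    (hs : ∀ c ∈ W, ∃ c' ∈ W, NW c c' ∧ D c' = D c + 1)
    (hp : ∀ c ∈ W, ∃ c' ∈ W, NW c' c ∧ D c' = D c - 1) (k : ℤ) : ∃ c ∈ W, D c = k := by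
  obtain ⟨c0, h0⟩ := hne
  have : ∀ t : ℤ, ∃ c ∈ W, D c = D c0 + t := by
    intro t
    induction t using Int.induction_on with
    | zero => exact ⟨c0, h0, by simp⟩
    | succ i ih =>
      obtain ⟨c, hc, e⟩ := ih
      obtain ⟨c', hc', _, e'⟩ := hs c hc
      exact ⟨c', hc', by omega⟩
    | pred i ih =>
      obtain ⟨c, hc, e⟩ := ih
      obtain ⟨c', hc', _, e'⟩ := hp c hc
      exact ⟨c', hc', by omega⟩
  obtain ⟨c, hc, e⟩ := this (k - D c0)
  exact ⟨c, hc, by omega⟩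

lemma stream_ne {m n l : ℕ} {W : Set Cell} {D : Cell → ℤ} (h : Lev m n l W D) (hne : W.Nonempty)
    (hs : ∀ c ∈ W, ∃ c' ∈ W, NW c c' ∧ D c' = D c + 1)
    (hp : ∀ c ∈ W, ∃ c' ∈ W, NW c' c ∧ D c' = D c - 1) :
    ∃ e, IsStreamEnum m n e l ∧ ∀ k, e k ∈ W ∧ D (e k) = k ∧ ∀ c ∈ W, D c = k → neLe c (e k) := by
  have hex : ∀ k, ∃ c ∈ {c : Cell | c ∈ W ∧ D c = k}, ∀ c' ∈ {c : Cell | c ∈ W ∧ D c = k},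
      neLe c' c := fun k => by
    obtain ⟨c, hc, hk⟩ := levels_nonempty hne hs hp k
    exact exists_ne_most (h.fin k) ⟨c, hc, hk⟩ fun c hc c' hc' =>
      h.cmp hc.1 hc'.1 (hc.2.trans hc'.2.symm)
  choose e he1 he2 using hex
  refine ⟨e, ⟨h.lpos, fun k => ?_, fun k => ?_⟩, fun k => ⟨(he1 k).1, (he1 k).2,
    fun c hc hk => he2 k c ⟨hc, hk⟩⟩⟩
  · obtain ⟨p, p1, p2, p3⟩ := hp _ (he1 (k + 1)).1
    obtain ⟨q, q1, q2, q3⟩ := hs _ (he1 k).1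
    have a1 := he2 k p ⟨p1, by have := (he1 (k + 1)).2; omega⟩
    have a2 := he2 (k + 1) q ⟨q1, by have := (he1 k).2; omega⟩
    exact ⟨lt_of_le_of_lt a1.1 p2.1, lt_of_lt_of_le q2.2 a2.2⟩
  · rw [tauC_eq]
    have a1 := he2 (k + l) (sh m n 1 (e k)) ⟨h.inv _ _ (he1 k).1, by
      rw [h.per _ _ (he1 k).1, (he1 k).2]; ring⟩
    have a2 := he2 k (sh m n (-1) (e (k + l))) ⟨h.inv _ _ (he1 _).1, by
      rw [h.per _ _ (he1 _).1, (he1 _).2]; ring⟩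
    rw [← sh_neLe (m := m) (n := n) (k := 1), sh_sh] at a2
    norm_num [sh_zero] at a2
    exact neLe_antisymm a1 a2

lemma stream_sw {m n l : ℕ} {W : Set Cell} {D : Cell → ℤ} (h : Lev m n l W D) (hne : W.Nonempty)
    (hs : ∀ c ∈ W, ∃ c' ∈ W, NW c c' ∧ D c' = D c + 1)
    (hp : ∀ c ∈ W, ∃ c' ∈ W, NW c' c ∧ D c' = D c - 1) :
    ∃ e, IsStreamEnum m n e l ∧ ∀ k, e k ∈ W ∧ D (e k) = k ∧ ∀ c ∈ W, D c = k → neLe (e k) c := by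
  have hex : ∀ k, ∃ c ∈ {c : Cell | c ∈ W ∧ D c = k}, ∀ c' ∈ {c : Cell | c ∈ W ∧ D c = k},
      neLe c c' := fun k => by
    obtain ⟨c, hc, hk⟩ := levels_nonempty hne hs hp k
    exact exists_sw_most (h.fin k) ⟨c, hc, hk⟩ fun c hc c' hc' =>
      h.cmp hc.1 hc'.1 (hc.2.trans hc'.2.symm)
  choose e he1 he2 using hex
  refine ⟨e, ⟨h.lpos, fun k => ?_, fun k => ?_⟩, fun k => ⟨(he1 k).1, (he1 k).2,
    fun c hc hk => he2 k c ⟨hc, hk⟩⟩⟩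
  · obtain ⟨p, p1, p2, p3⟩ := hp _ (he1 (k + 1)).1
    obtain ⟨q, q1, q2, q3⟩ := hs _ (he1 k).1
    have a1 := he2 k p ⟨p1, by have := (he1 (k + 1)).2; omega⟩
    have a2 := he2 (k + 1) q ⟨q1, by have := (he1 k).2; omega⟩
    exact ⟨lt_of_lt_of_le q2.1 a2.1, lt_of_le_of_lt a1.2 p2.2⟩
  · rw [tauC_eq]
    have a1 := he2 (k + l) (sh m n 1 (e k)) ⟨h.inv _ _ (he1 k).1, by
      rw [h.per _ _ (he1 k).1, (he1 k).2]; ring⟩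
    have a2 := he2 k (sh m n (-1) (e (k + l))) ⟨h.inv _ _ (he1 _).1, by
      rw [h.per _ _ (he1 _).1, (he1 _).2]; ring⟩
    rw [← sh_neLe (m := m) (n := n) (k := 1), sh_sh] at a2
    norm_num [sh_zero] at a2
    exact neLe_antisymm a2 a1

def Asc (W : Set Cell) (D : Cell → ℤ) : ℕ → Cell → Prop
  | 0, _ => True
  | N + 1, c => ∃ c' ∈ W, NW c c' ∧ D c' = D c + 1 ∧ Asc W D N c'

lemma asc_succ {W : Set Cell} {D : Cell → ℤ} (N : ℕ) : ∀ c, Asc W D (N + 1) c → Asc W D N c := by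
  induction N with
  | zero => intro c _; trivial
  | succ N ih =>
    rintro c ⟨c', h1, h2, h3, h4⟩
    exact ⟨c', h1, h2, h3, ih c' h4⟩

lemma asc_le {W : Set Cell} {D : Cell → ℤ} {N N' : ℕ} (h : N ≤ N') (c : Cell) :
    Asc W D N' c → Asc W D N c := by
  induction h with
  | refl => exact id
  | step _ ih => exact fun h => ih (asc_succ _ _ h)

lemma asc_sh {m n l : ℕ} {W : Set Cell} {D : Cell → ℤ} (h : Lev m n l W D) (k : ℤ) (N : ℕ) :
    ∀ c ∈ W, Asc W D N c → Asc W D N (sh m n k c) := by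
  induction N with
  | zero => intro c _ _; trivial
  | succ N ih =>
    rintro c hc ⟨c', h1, h2, h3, h4⟩
    refine ⟨sh m n k c', h.inv _ _ h1, sh_NW.2 h2, ?_, ih c' h1 h4⟩
    rw [h.per _ _ h1, h.per _ _ hc, h3]; ring

lemma stream_lemma {m n l : ℕ} {W : Set Cell} {D : Cell → ℤ} (h : Lev m n l W D) (hne : W.Nonempty)
    (hp : ∀ c ∈ W, ∃ c' ∈ W, NW c' c ∧ D c' = D c - 1) :
    ∃ e, IsStreamEnum m n e l ∧ ∀ k, e k ∈ W ∧ D (e k) = k := by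
  have pig : ∀ S : Set Cell, S.Finite → (∀ N, ∃ c ∈ S, Asc W D N c) →
      ∃ c ∈ S, ∀ N, Asc W D N c := by
    intro S hS hN
    by_contra hcon
    push Not at hcon
    choose! F hF using hcon
    obtain ⟨B, hB⟩ := (hS.image F).bddAbove
    obtain ⟨c, hc, hc'⟩ := hN B
    exact hF c hc (asc_le (hB ⟨c, hc, rfl⟩) c hc')
  let M : Set Cell := {c | c ∈ W ∧ ∀ N, Asc W D N c}
  have hM : Lev m n l M D := lev_sub h (fun c hc => hc.1)
    fun k c hc => ⟨h.inv _ _ hc.1, fun N => asc_sh h k N c hc.1 (hc.2 N)⟩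
  have down : ∀ (N : ℕ) (c : Cell), c ∈ W → ∃ c' ∈ W, D c' = D c - N ∧ Asc W D N c' := by
    intro N
    induction N with
    | zero => intro c hc; exact ⟨c, hc, by simp, trivial⟩
    | succ N ih =>
      intro c hc
      obtain ⟨c', h1, h2, h3⟩ := ih c hc
      obtain ⟨p, p1, p2, p3⟩ := hp c' h1
      exact ⟨p, p1, by push_cast; omega, c', h1, p2, by omega, h3⟩
  have Mne : M.Nonempty := by
    obtain ⟨c0, h0⟩ := hne
    obtain ⟨c, hc, hc'⟩ := pig {c | c ∈ W ∧ D c = D c0} (h.fin _) (fun N => by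
      obtain ⟨c', h1, h2, h3⟩ := down (N * l) (sh m n N c0) (h.inv _ _ h0)
      refine ⟨c', ⟨h1, ?_⟩, asc_le (Nat.le_mul_of_pos_right N h.lpos) c' h3⟩
      rw [h2, h.per _ _ h0]; push_cast; ring)
    exact ⟨c, hc.1, hc'⟩
  obtain ⟨e, he1, he2⟩ := stream_ne hM Mne (fun c hc => by
      obtain ⟨c', h1, h2⟩ := pig {c' | c' ∈ W ∧ NW c c' ∧ D c' = D c + 1}
        ((h.fin (D c + 1)).subset fun x hx => ⟨hx.1, hx.2.2⟩) (fun N => by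
          obtain ⟨c', h1, h2, h3, h4⟩ := hc.2 (N + 1)
          exact ⟨c', ⟨h1, h2, h3⟩, h4⟩)
      exact ⟨c', ⟨h1.1, h2⟩, h1.2⟩) (fun c hc => by
      obtain ⟨p, p1, p2, p3⟩ := hp c hc.1
      refine ⟨p, ⟨p1, fun N => asc_succ _ _ ⟨c, hc.1, p2, by omega, hc.2 N⟩⟩, p2, p3⟩)
  exact ⟨e, he1, fun k => ⟨(he2 k).1.1, (he2 k).2.1⟩⟩

/-- streams -/
lemma st_mono {m n l : ℕ} {e : ℤ → Cell} (he : IsStreamEnum m n e l) {i j : ℤ} (h : i < j) :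
    NW (e i) (e j) :=
  ⟨step_mono (fun i => (e i).1) (fun i => (he.2.1 i).1) h,
    step_mono (fun i => (e i).2) (fun i => (he.2.1 i).2) h⟩

lemma st_inj {m n l : ℕ} {e : ℤ → Cell} (he : IsStreamEnum m n e l) {i j : ℤ} (h : e i = e j) :
    i = j := by
  rcases lt_trichotomy i j with h' | h' | h'
  · have := (st_mono he h').1; rw [h] at this; omega
  · exact h'
  · have := (st_mono he h').1; rw [h] at this; omega

lemma st_per {m n l : ℕ} {e : ℤ → Cell} (he : IsStreamEnum m n e l) (k i : ℤ) :
    e (i + k * l) = sh m n k (e i) := by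
  induction k using Int.induction_on generalizing i with
  | zero => simp [sh_zero]
  | succ k ih =>
    have := he.2.2 (i + k * l)
    rw [tauC_eq, ih, sh_sh] at this
    rw [show i + (k + 1 : ℤ) * l = i + k * l + l by ring, ← this]
    congr 1; ring
  | pred k ih =>
    have := he.2.2 (i + (-k - 1) * l)
    rw [tauC_eq, show i + (-k - 1 : ℤ) * l + l = i + -k * l by ring, ih] at this
    have h2 := congrArg (sh m n (-1)) this
    rw [sh_sh, sh_sh] at h2
    norm_num [sh_zero] at h2
    rw [h2]
    congr 1; ring

lemma st_shift {m n l : ℕ} {e : ℤ → Cell} (he : IsStreamEnum m n e l) (t : ℤ) :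
    IsStreamEnum m n (fun i => e (i + t)) l :=
  ⟨he.1, fun i => by
    have := he.2.1 (i + t)
    rw [show i + t + 1 = i + 1 + t by ring] at this; exact this, fun i => by
    have := he.2.2 (i + t)
    rw [show i + t + l = i + l + t by ring] at this; exact this⟩

lemma range_shift (e : ℤ → Cell) (t : ℤ) : Set.range (fun i => e (i + t)) = Set.range e := by
  ext c; constructor
  · rintro ⟨i, rfl⟩; exact ⟨i + t, rfl⟩
  · rintro ⟨i, rfl⟩; exact ⟨i - t, by simp⟩

lemma st_flow_le {m n l l' : ℕ} {W : Set Cell} {D : Cell → ℤ} (h : Lev m n l W D) {e : ℤ → Cell}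
    (he : IsStreamEnum m n e l') (hW : ∀ i, e i ∈ W) : l' ≤ l := by
  have h1 := step_add (fun i => D (e i)) (fun i => h.str _ (hW _) _ (hW _) (he.2.1 i)) 0 l'
  have h2 := st_per he 1 0
  rw [one_mul] at h2
  simp only [h2, h.per _ _ (hW _)] at h1
  omega

lemma st_levels {m n l : ℕ} {W : Set Cell} {D : Cell → ℤ} (h : Lev m n l W D) {e : ℤ → Cell}
    (he : IsStreamEnum m n e l) (hW : ∀ i, e i ∈ W) (i : ℤ) : D (e i) = i + D (e 0) := by
  have hs : ∀ i, D (e i) < D (e (i + 1)) := fun i => h.str _ (hW _) _ (hW _) (he.2.1 i)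
  have step : ∀ i, D (e (i + 1)) = D (e i) + 1 := by
    intro i
    have h1 := step_add' (fun i => D (e i)) hs (i := i + 1) (j := i + l)
      (by have := h.lpos; omega)
    have h2 := st_per he 1 i
    rw [one_mul] at h2
    simp only [h2, h.per _ _ (hW _)] at h1
    have := hs i
    omega
  induction i using Int.induction_on with
  | zero => simp
  | succ k ih => rw [step, ih]; ring
  | pred k ih =>
    have := step (-k - 1)
    rw [show (-k - 1 + 1 : ℤ) = -k by ring, ih] at this
    omega

lemma st_far_nw {m n l : ℕ} {e : ℤ → Cell} (he : IsStreamEnum m n e l) (c : Cell) :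
    ∃ i, NW (e i) c := by
  refine ⟨min 0 (min (c.1 - (e 0).1 - 1) (c.2 - (e 0).2 - 1)), ?_, ?_⟩
  · have := step_add' (fun i => (e i).1) (fun i => (he.2.1 i).1)
      (min_le_left 0 (min (c.1 - (e 0).1 - 1) (c.2 - (e 0).2 - 1)))
    omega
  · have := step_add' (fun i => (e i).2) (fun i => (he.2.1 i).2)
      (min_le_left 0 (min (c.1 - (e 0).1 - 1) (c.2 - (e 0).2 - 1)))
    omega

lemma st_far_se {m n l : ℕ} {e : ℤ → Cell} (he : IsStreamEnum m n e l) (c : Cell) :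
    ∃ i, NW c (e i) := by
  refine ⟨max 0 (max (c.1 - (e 0).1 + 1) (c.2 - (e 0).2 + 1)), ?_, ?_⟩
  · have := step_add' (fun i => (e i).1) (fun i => (he.2.1 i).1)
      (le_max_left 0 (max (c.1 - (e 0).1 + 1) (c.2 - (e 0).2 + 1)))
    omega
  · have := step_add' (fun i => (e i).2) (fun i => (he.2.1 i).2)
      (le_max_left 0 (max (c.1 - (e 0).1 + 1) (c.2 - (e 0).2 + 1)))
    omega

/-- level comparison -/
lemma st_cmp {m n l' : ℕ} {e' : ℤ → Cell} (he' : IsStreamEnum m n e' l')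
    {c : Cell} {k : ℤ} (hc : neLe c (e' k) ∨ neLe (e' k) c) (h : ∃ k', neLe c (e' k')) :
    neLe c (e' k) := by
  obtain ⟨k', h'⟩ := h
  rcases hc with hc | hc
  · exact hc
  rcases lt_trichotomy k k' with hk | hk | hk
  · have := st_mono he' hk; simp only [neLe, NW] at *; omega
  · rw [hk]; exact h'
  · have := st_mono he' hk; simp only [neLe, NW] at *; omega

inductive Conn (A : Mat) (d : Cell → ℤ) (E : Set Cell) : Cell → Prop
  | base (c : Cell) : c ∈ E → Conn A d E c
  | step (c c' : Cell) : c ∈ supp A → c' ∈ supp A → NW c' c → d c' = d c - 1 →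
      Conn A d E c' → Conn A d E c

structure SWE (m n l : ℕ) (A : Mat) (d : Cell → ℤ) (e : ℤ → Cell) : Prop where
  lev : Lev m n l (supp A) d
  st : IsStreamEnum m n e l
  mem : ∀ i, e i ∈ supp A
  num : ∀ i, d (e i) = i
  conn : ∀ c ∈ supp A, Conn A d (Set.range e) c
  best : ∀ e', IsStreamEnum m n e' l → (∀ i, e' i ∈ supp A) → (∀ i, d (e' i) = i) →
    ∀ k, neLe (e k) (e' k)

def MaxFlow (m n : ℕ) (A : Mat) (l : ℕ) : Prop :=
  ∀ e l', IsStreamEnum m n e l' → (∀ i, e i ∈ supp A) → l' ≤ l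

def consF (c : Cell) (ch : ℕ → Cell) : ℕ → Cell
  | 0 => c
  | t + 1 => ch t

lemma consF_mem {S : Set Cell} {c : Cell} {ch : ℕ → Cell} {k : ℕ} (hc : c ∈ S)
    (h : ∀ i ≤ k, ch i ∈ S) : ∀ i ≤ k + 1, consF c ch i ∈ S := by
  intro i hi
  cases i with
  | zero => exact hc
  | succ i => exact h i (by omega)

lemma consF_NW {c : Cell} {ch : ℕ → Cell} {k : ℕ} (hc : NW (ch 0) c)
    (h : ∀ i < k, NW (ch (i + 1)) (ch i)) :
    ∀ i < k + 1, NW (consF c ch (i + 1)) (consF c ch i) := by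
  intro i hi
  cases i with
  | zero => exact hc
  | succ i => exact h i (by omega)

lemma chan_bound {m n l : ℕ} (hm : 0 < m) (hn : 0 < n) {A : Mat} (hA : IsGAP m n A)
    (hl : MaxFlow m n A l) {e : ℤ → Cell} (he : IsStreamEnum m n e l) (hs : ∀ i, e i ∈ supp A)
    (k : ℕ) (ch : ℕ → Cell) (M idx : ℤ) (h0 : ch 0 = e M) (h1 : ∀ i ≤ k, ch i ∈ supp A)
    (h2 : ∀ i < k, NW (ch (i + 1)) (ch i)) (h3 : ch k = e idx) : idx + k ≤ M := by
  obtain ⟨a, ha, haM⟩ : ∃ a : ℕ, 0 < a ∧ M ≤ idx + a * l := by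
    refine ⟨(M - idx).toNat + 1, by omega, ?_⟩
    have : (1 : ℤ) ≤ l := by exact_mod_cast he.1
    push_cast
    have h4 := Int.self_le_toNat (M - idx)
    nlinarith
  obtain ⟨r, hr⟩ : ∃ r : ℕ, idx + a * l - M = r := ⟨(idx + a * l - M).toNat, by omega⟩
  let c' : ℕ → Cell := fun t => if t < k then ch (k - t) else e (M + ((t : ℤ) - k))
  have := cycle_lemma hm hn (S := supp A) (fun k c hc => (sh_supp hA).2 hc) l hl a ha (k + r) c' ?_ ?_ ?_
  · zify at this; linarith
  · intro t ht
    simp only [c']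
    split_ifs
    · exact h1 _ (by omega)
    · exact hs _
  · intro t ht
    simp only [c']
    rcases lt_trichotomy (t + 1) k with h | h | h
    · rw [if_pos (by omega), if_pos h]
      have := h2 (k - (t + 1)) (by omega)
      rwa [show k - (t + 1) + 1 = k - t by omega] at this
    · rw [if_pos (by omega), if_neg (by omega)]
      have := h2 0 (by omega)
      rw [h0] at this
      rw [show k - t = 0 + 1 by omega]
      convert this using 2
      push_cast; omega
    · rw [if_neg (by omega), if_neg (by omega)]
      have := he.2.1 (M + (t - k))
      convert this using 2
      push_cast; ring
  · have e1 : c' (k + r) = e (idx + a * l) := by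
      simp only [c']
      rw [if_neg (by omega)]
      congr 1; push_cast; omega
    have e2 : c' 0 = e idx := by
      simp only [c']
      split_ifs with h
      · simpa using h3
      · have : k = 0 := by omega
        subst this
        rw [← h3, h0]; simp
    rw [e1, e2, ← st_per he]

lemma num_exists {m n l : ℕ} (hm : 0 < m) (hn : 0 < n) {A : Mat} (hA : IsGAP m n A)
    (hl : MaxFlow m n A l) {e : ℤ → Cell} (he : IsStreamEnum m n e l) (hs : ∀ i, e i ∈ supp A) :
    ∃ d, IsChannelNumbering A e d := by
  have : ∀ c, ∃ v, c ∈ supp A → IsGreatest (chainSet A e c) v := by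
    intro c
    by_cases hc : c ∈ supp A
    swap
    · exact ⟨0, fun h => absurd h hc⟩
    obtain ⟨M, hM⟩ := st_far_se he c
    obtain ⟨i0, hi0⟩ := st_far_nw he c
    obtain ⟨v, hv1, hv2⟩ := int_max (fun v => v ∈ chainSet A e c) M (by
      rintro v ⟨k, ch, c0, c1, c2, idx, c3, rfl⟩
      have := chan_bound hm hn hA hl he hs (k + 1) (consF (e M) ch) M idx rfl
        (consF_mem (hs _) c1) (consF_NW (by rwa [c0]) c2) c3.symm
      push_cast at this
      omega)
      ⟨i0 + 1, 1, consF c fun _ => e i0, rfl, consF_mem (k := 0) hc fun _ _ => hs _,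
        consF_NW (k := 0) hi0 (by simp), i0, rfl, by simp⟩
    exact ⟨v, fun _ => ⟨hv1, hv2⟩⟩
  choose d hd using this
  exact ⟨d, fun c hc => hd c hc⟩

lemma chainSet_cons {A : Mat} {e : ℤ → Cell} {c c' : Cell} (hc : c' ∈ supp A) (h : NW c c') {v : ℤ}
    (hv : v ∈ chainSet A e c) : v + 1 ∈ chainSet A e c' := by
  obtain ⟨k, ch, c0, c1, c2, idx, c3, rfl⟩ := hv
  exact ⟨k + 1, consF c' ch, rfl, consF_mem hc c1, consF_NW (by rwa [c0]) c2,
    idx, c3, by push_cast; ring⟩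

lemma chainSet_sh {m n l : ℕ} {A : Mat} (hA : IsGAP m n A) {e : ℤ → Cell} (he : IsStreamEnum m n e l)
    {c : Cell} (a : ℤ) {v : ℤ} (hv : v ∈ chainSet A e c) :
    v + a * l ∈ chainSet A e (sh m n a c) := by
  obtain ⟨k, ch, c0, c1, c2, idx, c3, rfl⟩ := hv
  exact ⟨k, fun t => sh m n a (ch t), by simp [c0], fun i hi => (sh_supp hA).2 (c1 i hi),
    fun i hi => sh_NW.2 (c2 i hi), idx + a * l, by rw [st_per he, c3], by ring⟩

lemma num_facts {m n l : ℕ} (hm : 0 < m) (hn : 0 < n) {A : Mat} (hA : IsGAP m n A)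
    (hl : MaxFlow m n A l) {e : ℤ → Cell} (he : IsStreamEnum m n e l) (hs : ∀ i, e i ∈ supp A)
    {d : Cell → ℤ} (hd : IsChannelNumbering A e d) :
    Lev m n l (supp A) d ∧ (∀ i, d (e i) = i) ∧ ∀ c ∈ supp A, Conn A d (Set.range e) c := by
  have per : ∀ (k : ℤ) (c : Cell), c ∈ supp A → d (sh m n k c) = d c + k * l := by
    intro k c hc
    have h1 := hd c hc
    have h2 := hd (sh m n k c) ((sh_supp hA).2 hc)
    apply le_antisymm
    · have := h1.2 (by have := chainSet_sh hA he (-k) h2.1; rwa [sh_sh, neg_add_cancel, sh_zero] at this)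
      linarith
    · exact h2.2 (chainSet_sh hA he k h1.1)
  have str : ∀ c ∈ supp A, ∀ c' ∈ supp A, NW c c' → d c < d c' := by
    intro c hc c' hc' h
    have := (hd c' hc').2 (chainSet_cons hc' h (hd c hc).1)
    omega
  have num : ∀ i, d (e i) = i := by
    intro i
    apply le_antisymm
    · obtain ⟨k, ch, c0, c1, c2, idx, c3, h⟩ := (hd _ (hs i)).1
      rw [h]
      exact chan_bound hm hn hA hl he hs k ch i idx c0 c1 c2 c3.symm
    · exact (hd _ (hs i)).2 ⟨0, fun _ => e i, rfl, fun _ _ => hs i, by simp, i, rfl, by simp⟩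
  refine ⟨⟨he.1, fun k c hc => (sh_supp hA).2 hc, per, str,
    lev_fin hn hA (le_refl _) he.1 per⟩, num, ?_⟩
  have key : ∀ (k : ℕ) (c : Cell) (idx : ℤ) (ch : ℕ → Cell), ch 0 = c → (∀ i ≤ k, ch i ∈ supp A) →
      (∀ i < k, NW (ch (i + 1)) (ch i)) → e idx = ch k → d c = idx + k →
      Conn A d (Set.range e) c := by
    intro k
    induction k with
    | zero =>
      intro c idx ch c0 c1 c2 c3 h
      exact Conn.base _ ⟨idx, by rw [c3, c0]⟩
    | succ k ih =>
      intro c idx ch c0 c1 c2 c3 h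
      have hc : c ∈ supp A := c0 ▸ c1 0 (by omega)
      have a1 := c2 0 (by omega)
      have a2 : ch 1 ∈ supp A := c1 1 (by omega)
      rw [c0] at a1
      have a3 : idx + k ≤ d (ch 1) := (hd _ a2).2 ⟨k, fun t => ch (t + 1), rfl,
        fun i hi => c1 _ (by omega), fun i hi => c2 _ (by omega), idx, c3, rfl⟩
      have a4 := str _ a2 _ hc a1
      push_cast at h
      refine Conn.step c (ch 1) hc a2 a1 (by omega) ?_
      exact ih (ch 1) idx (fun t => ch (t + 1)) rfl (fun i hi => c1 _ (by omega))
        (fun i hi => c2 _ (by omega)) c3 (by omega)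
  intro c hc
  obtain ⟨k, ch, c0, c1, c2, idx, c3, h⟩ := (hd c hc).1
  exact key k c idx ch c0 c1 c2 c3 h

lemma num_of_conn {m n l : ℕ} {A : Mat} {e : ℤ → Cell} {d : Cell → ℤ}
    (lev : Lev m n l (supp A) d) (num : ∀ i, d (e i) = i) (mem : ∀ i, e i ∈ supp A)
    (conn : ∀ c ∈ supp A, Conn A d (Set.range e) c) : IsChannelNumbering A e d := by
  intro c hc
  constructor
  · have := conn c hc
    clear hc
    induction this with
    | base c h =>
      obtain ⟨i, rfl⟩ := h
      exact ⟨0, fun _ => e i, rfl, fun _ _ => mem i, by simp, i, rfl, by simp [num]⟩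
    | step c c' h1 h2 h3 h4 _ ih =>
      have := chainSet_cons h1 h3 ih
      rwa [h4, sub_add_cancel] at this
  · rintro v ⟨k, ch, c0, c1, c2, idx, c3, rfl⟩
    have : ∀ t : ℕ, t ≤ k → d (ch t) + t ≤ d c := by
      intro t
      induction t with
      | zero => intro _; simp [c0]
      | succ t ih =>
        intro h
        have := ih (by omega)
        have := lev.str _ (c1 _ h) _ (c1 t (by omega)) (c2 t (by omega))
        push_cast; omega
    have := this k le_rfl
    rw [← c3, num] at this
    exact this

lemma conn_pred {m n l : ℕ} {A : Mat} {e : ℤ → Cell} {d : Cell → ℤ}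
    (st : IsStreamEnum m n e l) (num : ∀ i, d (e i) = i) (mem : ∀ i, e i ∈ supp A)
    {c : Cell} (h : Conn A d (Set.range e) c) :
    ∃ c' ∈ supp A, NW c' c ∧ d c' = d c - 1 ∧ Conn A d (Set.range e) c' := by
  cases h with
  | base _ h =>
    obtain ⟨i, rfl⟩ := h
    refine ⟨e (i - 1), mem _, st_mono st (by omega), by simp [num], Conn.base _ ⟨_, rfl⟩⟩
  | step _ c' h1 h2 h3 h4 h5 => exact ⟨c', h2, h3, h4, h5⟩

lemma maxflow_chan {m n l : ℕ} {A : Mat} (hl : MaxFlow m n A l) {e : ℤ → Cell}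
    (he : IsStreamEnum m n e l) (hs : ∀ i, e i ∈ supp A) : IsChannel m n A (Set.range e) := by
  refine ⟨l, ⟨e, he, rfl⟩, ?_, ?_⟩
  · rintro _ ⟨i, rfl⟩; exact hs i
  · rintro S l' ⟨e', he', rfl⟩ h
    exact hl e' l' he' fun i => h ⟨i, rfl⟩

lemma chan_maxflow {m n l : ℕ} {A : Mat} {C : Set Cell} (hl : MaxFlow m n A l) {e0 : ℤ → Cell}
    (he0 : IsStreamEnum m n e0 l) (hs0 : ∀ i, e0 i ∈ supp A) (hC : IsChannel m n A C) :
    ∃ e, IsStreamEnum m n e l ∧ Set.range e = C ∧ ∀ i, e i ∈ supp A := by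
  obtain ⟨l', ⟨e, he, rfl⟩, h1, h2⟩ := hC
  have hm : ∀ i, e i ∈ supp A := fun i => h1 ⟨i, rfl⟩
  have a := hl e l' he hm
  have b := h2 (Set.range e0) l ⟨e0, he0, rfl⟩ (by rintro _ ⟨i, rfl⟩; exact hs0 i)
  obtain rfl : l' = l := by omega
  exact ⟨e, he, rfl, hm⟩

lemma lev_maxflow {m n l : ℕ} {A : Mat} {d : Cell → ℤ} (lev : Lev m n l (supp A) d) :
    MaxFlow m n A l := fun _ _ he hs => st_flow_le lev he hs

lemma swe_to {m n l : ℕ} {A : Mat} {d : Cell → ℤ} {e : ℤ → Cell} (h : SWE m n l A d e) :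
    IsSWNumbering m n A d := by
  refine ⟨e, ⟨⟨l, h.st⟩, maxflow_chan (lev_maxflow h.lev) h.st h.mem, ?_⟩,
    num_of_conn h.lev h.num h.mem h.conn⟩
  intro C hC
  obtain ⟨e', he', rfl, hs'⟩ := chan_maxflow (lev_maxflow h.lev) h.st h.mem hC
  rintro _ ⟨i, rfl⟩
  have := h.best _ (st_shift he' (- d (e' 0))) (fun i => hs' _) (fun i => by
    rw [st_levels h.lev he' hs']; ring) i
  exact ⟨h.mem i, _, ⟨_, rfl⟩, this⟩

lemma swe_best_of {m n l : ℕ} {A : Mat} {d : Cell → ℤ} {e e' : ℤ → Cell}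
    (lev : Lev m n l (supp A) d) (mem : ∀ i, e i ∈ supp A) (num : ∀ i, d (e i) = i)
    (he' : IsStreamEnum m n e' l) (hs' : ∀ i, e' i ∈ supp A) (num' : ∀ i, d (e' i) = i)
    (hg : swGe A (Set.range e) (Set.range e')) (k : ℤ) : neLe (e k) (e' k) := by
  obtain ⟨_, _, ⟨k', rfl⟩, h⟩ := hg ⟨k, rfl⟩
  exact st_cmp he' (lev.cmp (mem k) (hs' k) (by rw [num, num'])) ⟨k', h⟩

lemma swe_of {m n : ℕ} (hm : 0 < m) (hn : 0 < n) {A : Mat} (hA : IsGAP m n A) {d : Cell → ℤ}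
    (h : IsSWNumbering m n A d) : ∃ l e, SWE m n l A d e := by
  obtain ⟨e, ⟨⟨l, he⟩, hc, hb⟩, hd⟩ := h
  have hs : ∀ i, e i ∈ supp A := by
    obtain ⟨_, _, h, _⟩ := hc
    exact fun i => h ⟨i, rfl⟩
  have hl : MaxFlow m n A l := by
    obtain ⟨l', ⟨e', he', hr⟩, h1, h2⟩ := hc
    obtain rfl : l = l' := by
      have hs' : ∀ i, e' i ∈ supp A := fun i => by
        have : e' i ∈ Set.range e := hr ▸ ⟨i, rfl⟩
        exact h1 this
      have hl' : MaxFlow m n A l' := fun e'' l'' he'' hs'' =>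
        h2 _ l'' ⟨e'', he'', rfl⟩ (by rintro _ ⟨i, rfl⟩; exact hs'' i)
      apply le_antisymm (hl' e l he hs)
      obtain ⟨d', hd'⟩ := num_exists hm hn hA hl' he' hs'
      obtain ⟨lev, num, _⟩ := num_facts hm hn hA hl' he' hs' hd'
      obtain ⟨i0, hi0⟩ : ∃ i, e i = e' 0 := by
        have : e' 0 ∈ Set.range e := hr ▸ ⟨0, rfl⟩
        exact this
      have e1 : e (i0 + l) = e' (0 + l') := by
        rw [← he.2.2, ← he'.2.2, hi0]
      have key : ∀ t : ℕ, ∃ i : ℤ, i0 + t ≤ i ∧ e i = e' t := by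
        intro t
        have hsurj : ∀ i, ∃ j, e j = e' i := fun i => by
          have : e' i ∈ Set.range e := hr ▸ ⟨i, rfl⟩
          exact this
        induction t with
        | zero => exact ⟨i0, by simp, hi0⟩
        | succ t ih =>
          obtain ⟨i, h3, h4⟩ := ih
          obtain ⟨j, hj⟩ := hsurj (t + 1)
          refine ⟨j, ?_, by push_cast; exact hj⟩
          by_contra hcon
          push_cast at hcon
          have m1 := (he'.2.1 t).1
          rw [← h4, ← hj] at m1
          rcases eq_or_lt_of_le (show j ≤ i by omega) with hh | hh
          · rw [hh] at m1; exact lt_irrefl _ m1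
          · have := (st_mono he hh).1; omega
      obtain ⟨i, h3, h4⟩ := key l'
      rw [zero_add] at e1
      have := st_inj he (h4.trans e1.symm)
      omega
    exact fun e'' l'' he'' hs'' => h2 _ l'' ⟨e'', he'', rfl⟩ (by rintro _ ⟨i, rfl⟩; exact hs'' i)
  obtain ⟨lev, num, conn⟩ := num_facts hm hn hA hl he hs hd
  exact ⟨l, e, lev, he, hs, num, conn, fun e' he' hs' num' =>
    swe_best_of lev hs num he' hs' num' (hb _ (maxflow_chan hl he' hs'))⟩

lemma supp_nonempty {A : Mat} (h : A ≠ 0) : ∃ c, c ∈ supp A := by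
  by_contra hcon
  push Not at hcon
  apply h
  funext i j
  have := hcon (i, j)
  simpa [supp] using this

/-- sw channel w.r.t. a numbering -/
lemma sw_chan_exists {m n l : ℕ} {A : Mat} {d : Cell → ℤ}
    (lev : Lev m n l (supp A) d) {e0 : ℤ → Cell} (he0 : IsStreamEnum m n e0 l)
    (hs0 : ∀ i, e0 i ∈ supp A) :
    ∃ e, IsStreamEnum m n e l ∧ (∀ i, e i ∈ supp A) ∧ (∀ i, d (e i) = i) ∧
      ∀ e', IsStreamEnum m n e' l → (∀ i, e' i ∈ supp A) → (∀ i, d (e' i) = i) →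
        ∀ k, neLe (e k) (e' k) := by
  let W : Set Cell := {c | ∃ e', IsStreamEnum m n e' l ∧ (∀ i, e' i ∈ supp A) ∧ ∃ i, e' i = c}
  have hW : W ⊆ supp A := by rintro _ ⟨e', _, h, i, rfl⟩; exact h i
  have levW : Lev m n l W d := lev_sub lev hW (by
    rintro k _ ⟨e', h1, h2, i, rfl⟩
    exact ⟨e', h1, h2, _, st_per h1 k i⟩)
  obtain ⟨e, he, h⟩ := stream_sw levW ⟨_, e0, he0, hs0, 0, rfl⟩ (by
    rintro _ ⟨e', h1, h2, i, rfl⟩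
    exact ⟨_, ⟨e', h1, h2, i + 1, rfl⟩, h1.2.1 i, by
      rw [st_levels lev h1 h2 (i + 1), st_levels lev h1 h2 i]; ring⟩) (by
    rintro _ ⟨e', h1, h2, i, rfl⟩
    exact ⟨_, ⟨e', h1, h2, i - 1, rfl⟩, st_mono h1 (by omega), by
      rw [st_levels lev h1 h2 (i - 1), st_levels lev h1 h2 i]; ring⟩)
  exact ⟨e, he, fun i => hW (h i).1, fun i => (h i).2.1, fun e' he' hs' num' k =>
    (h k).2.2 _ ⟨e', he', hs', k, rfl⟩ (num' k)⟩

lemma swe_exists {m n : ℕ} (hm : 0 < m) (hn : 0 < n) {A : Mat} (hA : IsGAP m n A) (hne : A ≠ 0) :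
    ∃ l d e, SWE m n l A d e := by
  obtain ⟨c, hc⟩ := supp_nonempty hne
  have hm' : (0 : ℤ) < m := by exact_mod_cast hm
  have hn' : (0 : ℤ) < n := by exact_mod_cast hn
  obtain ⟨l, ⟨e0, he0, hs0⟩, hmax⟩ : ∃ l : ℕ, (∃ e, IsStreamEnum m n e l ∧ ∀ i, e i ∈ supp A) ∧
      MaxFlow m n A l := by
    have hb : ∀ e l, IsStreamEnum m n e l → l ≤ m := fun e l he => by
      have h1 := step_add (fun i => (e i).1) (fun i => (he.2.1 i).1) 0 l
      have h2 := st_per he 1 0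
      simp only [one_mul] at h2
      simp only [h2, sh] at h1
      omega
    let P : ℕ → Prop := fun l => ∃ e, IsStreamEnum m n e l ∧ ∀ i, e i ∈ supp A
    have h1 : P 1 := ⟨fun i => sh m n i c, ⟨one_pos, fun i => by
      simp only [NW, sh]; constructor <;> nlinarith, fun i => by
      rw [tauC_eq, sh_sh]; congr 1; push_cast; ring⟩, fun i => (sh_supp hA).2 hc⟩
    refine ⟨Nat.findGreatest P m, Nat.findGreatest_spec (m := 1) (by omega) h1, ?_⟩
    intro e l he hs
    exact Nat.le_findGreatest (hb e l he) ⟨e, he, hs⟩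
  obtain ⟨d0, hd0⟩ := num_exists hm hn hA hmax he0 hs0
  obtain ⟨lev0, _, _⟩ := num_facts hm hn hA hmax he0 hs0 hd0
  obtain ⟨e, he, hs, num, best⟩ := sw_chan_exists lev0 he0 hs0
  obtain ⟨d, hd⟩ := num_exists hm hn hA hmax he hs
  obtain ⟨lev, num1, conn⟩ := num_facts hm hn hA hmax he hs hd
  refine ⟨l, d, e, lev, he, hs, num1, conn, fun e' he' hs' num' k => ?_⟩
  refine swe_best_of lev hs num1 he' hs' num' ?_ k
  rintro _ ⟨i, rfl⟩
  have := best _ (st_shift he' (- d0 (e' 0))) (fun i => hs' _) (fun i => by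
    rw [st_levels lev0 he' hs']; ring) i
  exact ⟨hs i, _, ⟨_, rfl⟩, this⟩

lemma swe_unique {m n l l' : ℕ} {A : Mat} {d d' : Cell → ℤ} {e e' : ℤ → Cell}
    (h : SWE m n l A d e) (h' : SWE m n l' A d' e') :
    l = l' ∧ ∃ t : ℤ, (∀ i, e' i = e (i + t)) ∧ ∀ c ∈ supp A, d' c = d c - t := by
  obtain rfl : l = l' := le_antisymm (st_flow_le h'.lev h.st h.mem) (st_flow_le h.lev h'.st h'.mem)
  refine ⟨rfl, d (e' 0), ?_, ?_⟩
  all_goals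
    have E : ∀ i, e' i = e (i + d (e' 0)) := by
      intro i
      have a := h.best _ (st_shift h'.st (- d (e' 0))) (fun i => h'.mem _) (fun i => by
        rw [st_levels h.lev h'.st h'.mem]; ring) (i + d (e' 0))
      have b := h'.best _ (st_shift h.st (- d' (e 0))) (fun i => h.mem _) (fun i => by
        rw [st_levels h'.lev h.st h.mem]; ring) i
      simp only [add_neg_cancel_right] at a
      apply neLe_antisymm ?_ a
      refine st_cmp h.st ?_ ⟨_, b⟩
      apply h.lev.cmp (h'.mem _) (h.mem _)
      rw [st_levels h.lev h'.st h'.mem, h.num]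
  · exact E
  · intro c hc
    have n1 := num_of_conn h.lev h.num h.mem h.conn
    have n2 := num_of_conn h'.lev h'.num h'.mem h'.conn
    have sub1 : ∀ v ∈ chainSet A e c, v - d (e' 0) ∈ chainSet A e' c := by
      rintro v ⟨k, ch, c0, c1, c2, idx, c3, rfl⟩
      exact ⟨k, ch, c0, c1, c2, idx - d (e' 0), by rw [E, sub_add_cancel, c3], by ring⟩
    have sub2 : ∀ v ∈ chainSet A e' c, v + d (e' 0) ∈ chainSet A e c := by
      rintro v ⟨k, ch, c0, c1, c2, idx, c3, rfl⟩
      exact ⟨k, ch, c0, c1, c2, idx + d (e' 0), by rw [← E, c3], by ring⟩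
    have a := (n2 c hc).2 (sub1 _ (n1 c hc).1)
    have b := (n1 c hc).2 (sub2 _ (n2 c hc).1)
    omega

lemma swe_congr {m n l : ℕ} {A : Mat} {d d' : Cell → ℤ} {e : ℤ → Cell}
    (h : SWE m n l A d e) (hd : ∀ c ∈ supp A, d' c = d c) : SWE m n l A d' e := by
  have lev : Lev m n l (supp A) d' := by
    refine ⟨h.lev.lpos, h.lev.inv, fun k c hc => ?_, fun c hc c' hc' hh => ?_, fun k => ?_⟩
    · rw [hd _ (h.lev.inv k c hc), hd c hc, h.lev.per k c hc]
    · rw [hd _ hc, hd _ hc']; exact h.lev.str c hc c' hc' hh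
    · exact (h.lev.fin k).subset fun c hc => ⟨hc.1, by rw [← hd c hc.1]; exact hc.2⟩
  refine ⟨lev, h.st, h.mem, fun i => by rw [hd _ (h.mem i), h.num], fun c hc => ?_,
    fun e' he' hs' num' k => h.best e' he' hs' (fun i => by rw [← hd _ (hs' i)]; exact num' i) k⟩
  have := h.conn c hc
  induction this with
  | base c h => exact Conn.base _ h
  | step c c' h1 h2 h3 h4 _ ih =>
    exact Conn.step c c' h1 h2 h3 (by rw [hd _ h1, hd _ h2, h4]) (ih h2)

def Loc (A B : Mat) (H : ℤ → ℤ → ℤ) (i j : ℤ) : Prop :=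
  (H (i - 1) j = H (i - 1) (j - 1) ∧ H i (j - 1) = H (i - 1) (j - 1) ∧
    H i j = H (i - 1) (j - 1) ∧ A i j = 0 ∧ B i j = 0) ∨
  (H (i - 1) j = H (i - 1) (j - 1) ∧ H i (j - 1) = H (i - 1) (j - 1) ∧
    H i j = H (i - 1) (j - 1) + 1 ∧ A i j = B i j + 1) ∨
  (H (i - 1) j = H (i - 1) (j - 1) + 1 ∧ H i (j - 1) = H (i - 1) (j - 1) ∧
    H i j = H (i - 1) (j - 1) + 1 ∧ A i j = B i j) ∨
  (H (i - 1) j = H (i - 1) (j - 1) ∧ H i (j - 1) = H (i - 1) (j - 1) + 1 ∧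
    H i j = H (i - 1) (j - 1) + 1 ∧ A i j = B i j) ∨
  (H (i - 1) j = H (i - 1) (j - 1) + 1 ∧ H i (j - 1) = H (i - 1) (j - 1) + 1 ∧
    H i j = H (i - 1) (j - 1) + 1 ∧ B i j = A i j + 1)

structure Core (m n l : ℕ) (A B : Mat) (H : ℤ → ℤ → ℤ) (f g : ℤ → ℤ) : Prop where
  mpos : 0 < m
  npos : 0 < n
  lpos : 0 < l
  gap : IsGAP m n A
  loc : ∀ i j, Loc A B H i j
  per : ∀ i j, H (i + m) (j + n) = H i j + l
  bd : ∃ K : ℤ, ∀ i j : ℤ, (n * i + K ≤ m * j → H i j = f i) ∧ (m * j + K ≤ n * i → H i j = g j)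

def trH (H : ℤ → ℤ → ℤ) : ℤ → ℤ → ℤ := fun i j => H j i

lemma gap_of_band {m n : ℕ} (hn : 0 < n) {A : Mat} (hper : ∀ i j : ℤ, A (i + m) (j + n) = A i j)
    (hb : ∃ K : ℤ, ∀ i j : ℤ, A i j ≠ 0 → (n : ℤ) * i - m * j ≤ K ∧ (m : ℤ) * j - n * i ≤ K) :
    IsGAP m n A := by
  refine ⟨hper, fun j => ?_⟩
  obtain ⟨K, hK⟩ := hb
  have hn' : (0 : ℤ) < n := by exact_mod_cast hn
  refine Set.Finite.subset (Set.finite_Icc (-|m * j - K|) |m * j + K|) ?_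
  intro i hi
  obtain ⟨h1, h2⟩ := hK i j hi
  have a1 := le_abs_self (m * j + K : ℤ)
  have a2 := neg_abs_le (m * j - K : ℤ)
  have a3 := abs_nonneg (m * j + K : ℤ)
  have a4 := abs_nonneg (m * j - K : ℤ)
  constructor
  · by_contra h; push Not at h; nlinarith
  · by_contra h; push Not at h; nlinarith

lemma gap_tr {m n : ℕ} (hm : 0 < m) (hn : 0 < n) {A : Mat} (hA : IsGAP m n A) :
    IsGAP n m (transM A) := by
  obtain ⟨K, _, hK⟩ := gap_band hn hA
  exact gap_of_band hm (fun i j => hA.1 j i) ⟨K, fun i j h => (hK j i h).symm⟩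

namespace Core
variable {m n l : ℕ} {A B : Mat} {H : ℤ → ℤ → ℤ} {f g : ℤ → ℤ}

lemma tr (h : Core m n l A B H f g) : Core n m l (transM A) (transM B) (trH H) g f := by
  obtain ⟨K, hK⟩ := h.bd
  refine ⟨h.npos, h.mpos, h.lpos, gap_tr h.mpos h.npos h.gap, fun i j => ?_, fun i j => h.per j i,
    K, fun i j => (hK j i).symm⟩
  have := h.loc j i
  simp only [Loc, trH, transM] at this ⊢
  tauto

lemma perk (h : Core m n l A B H f g) (k i j : ℤ) : H (i + k * m) (j + k * n) = H i j + k * l := by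
  induction k using Int.induction_on with
  | zero => simp
  | succ k ih =>
    have := h.per (i + k * m) (j + k * n)
    rw [show i + (k + 1 : ℤ) * m = i + k * m + m by ring,
      show j + (k + 1 : ℤ) * n = j + k * n + n by ring, this, ih]; ring
  | pred k ih =>
    have := h.per (i + (-k - 1) * m) (j + (-k - 1) * n)
    rw [show i + (-k - 1 : ℤ) * m + m = i + -k * m by ring,
      show j + (-k - 1 : ℤ) * n + n = j + -k * n by ring, ih] at this
    linarith

lemma stepr (h : Core m n l A B H f g) (i j : ℤ) : H (i - 1) j ≤ H i j ∧ H i j ≤ H (i - 1) j + 1 := by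
  have := h.loc i j; simp only [Loc] at this; omega

lemma stepc (h : Core m n l A B H f g) (i j : ℤ) : H i (j - 1) ≤ H i j ∧ H i j ≤ H i (j - 1) + 1 := by
  have := h.loc i j; simp only [Loc] at this; omega

lemma stepd (h : Core m n l A B H f g) (i j : ℤ) :
    H (i - 1) (j - 1) ≤ H i j ∧ H i j ≤ H (i - 1) (j - 1) + 1 := by
  have := h.loc i j; simp only [Loc] at this; omega

lemma monor (h : Core m n l A B H f g) (j : ℤ) : Monotone fun i => H i j :=
  monotone_int_of_le_succ fun i => by have := (h.stepr (i + 1) j).1; simpa using this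

lemma monoc (h : Core m n l A B H f g) (i : ℤ) : Monotone fun j => H i j :=
  monotone_int_of_le_succ fun j => by have := (h.stepc i (j + 1)).1; simpa using this

lemma mono (h : Core m n l A B H f g) {i i' j j' : ℤ} (hi : i ≤ i') (hj : j ≤ j') :
    H i j ≤ H i' j' := (h.monor j hi).trans (h.monoc i' hj)

lemma le_f (h : Core m n l A B H f g) (i j : ℤ) : H i j ≤ f i := by
  obtain ⟨K, hK⟩ := h.bd
  have hm : (1 : ℤ) ≤ m := by exact_mod_cast h.mpos
  have a1 := le_abs_self (n * i + K : ℤ)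
  have a2 := abs_nonneg (n * i + K : ℤ)
  have : H i (max j |n * i + K|) = f i := (hK i _).1 (by
    have := le_max_right j |n * i + K|
    nlinarith)
  rw [← this]
  exact h.monoc i (le_max_left _ _)

lemma f_att (h : Core m n l A B H f g) (i : ℤ) : ∃ J, ∀ j, J ≤ j → H i j = f i := by
  obtain ⟨K, hK⟩ := h.bd
  have hm : (1 : ℤ) ≤ m := by exact_mod_cast h.mpos
  have a1 := le_abs_self (n * i + K : ℤ)
  have a2 := abs_nonneg (n * i + K : ℤ)
  exact ⟨|n * i + K|, fun j hj => (hK i j).1 (by nlinarith)⟩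

lemma le_g (h : Core m n l A B H f g) (i j : ℤ) : H i j ≤ g j := h.tr.le_f j i

lemma g_att (h : Core m n l A B H f g) (j : ℤ) : ∃ I, ∀ i, I ≤ i → H i j = g j := h.tr.f_att j

lemma f_per (h : Core m n l A B H f g) (k i : ℤ) : f (i + k * m) = f i + k * l := by
  obtain ⟨J, hJ⟩ := h.f_att i
  obtain ⟨J', hJ'⟩ := h.f_att (i + k * m)
  rw [← hJ (max J (J' - k * n)) (le_max_left _ _), ← h.perk, hJ']
  have := le_max_right J (J' - k * n); linarith

lemma g_per (h : Core m n l A B H f g) (k j : ℤ) : g (j + k * n) = g j + k * l := h.tr.f_per k j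

lemma f_step (h : Core m n l A B H f g) (i : ℤ) : f (i - 1) ≤ f i ∧ f i ≤ f (i - 1) + 1 := by
  obtain ⟨J, hJ⟩ := h.f_att i
  obtain ⟨J', hJ'⟩ := h.f_att (i - 1)
  rw [← hJ (max J J') (le_max_left _ _), ← hJ' (max J J') (le_max_right _ _)]
  exact h.stepr _ _

lemma g_step (h : Core m n l A B H f g) (i : ℤ) : g (i - 1) ≤ g i ∧ g i ≤ g (i - 1) + 1 :=
  h.tr.f_step i

lemma f_mono (h : Core m n l A B H f g) : Monotone f :=
  monotone_int_of_le_succ fun i => by have := (h.f_step (i + 1)).1; simpa using this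

lemma g_mono (h : Core m n l A B H f g) : Monotone g := h.tr.f_mono

lemma f_low (h : Core m n l A B H f g) (k : ℤ) : ∃ r, f r < k := by
  have hl : (1 : ℤ) ≤ l := by exact_mod_cast h.lpos
  refine ⟨0 + (-(|f 0 - k| + 1)) * m, ?_⟩
  rw [h.f_per]
  have := le_abs_self (f 0 - k)
  have := abs_nonneg (f 0 - k)
  nlinarith

lemma f_high (h : Core m n l A B H f g) (k : ℤ) : ∃ r, k ≤ f r := by
  have hl : (1 : ℤ) ≤ l := by exact_mod_cast h.lpos
  refine ⟨0 + |f 0 - k| * m, ?_⟩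
  rw [h.f_per]
  have := neg_abs_le (f 0 - k)
  have := abs_nonneg (f 0 - k)
  nlinarith

/-- lowest position where f reaches k -/
lemma f_cut (h : Core m n l A B H f g) (k : ℤ) : ∃ r, k ≤ f r ∧ f (r - 1) < k := by
  obtain ⟨r0, h0⟩ := h.f_low k
  obtain ⟨r, h1, h2⟩ := int_min (fun r => k ≤ f r) r0 (fun z hz => by
    by_contra hh
    have := h.f_mono (show z ≤ r0 by omega)
    omega) (h.f_high k)
  refine ⟨r, h1, ?_⟩
  by_contra hh
  have := h2 (r - 1) (by omega)
  omega

lemma g_cut (h : Core m n l A B H f g) (k : ℤ) : ∃ r, k ≤ g r ∧ g (r - 1) < k := h.tr.f_cut k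

/-- westmost point -/
lemma west (h : Core m n l A B H f g) {i j k : ℤ} (hk : k ≤ H i j) :
    ∃ q ≤ j, H i q = k ∧ H i (q - 1) < k := by
  obtain ⟨q0, _, h0⟩ := h.g_cut k
  obtain ⟨q, h1, h2⟩ := int_min (fun q => k ≤ H i q) q0 (fun z hz => by
    by_contra hh
    have := h.le_g i z
    have := h.g_mono (show z ≤ q0 - 1 by omega)
    omega) ⟨j, hk⟩
  have h3 : H i (q - 1) < k := by
    by_contra hh
    have := h2 (q - 1) (by omega)
    omega
  exact ⟨q, h2 j hk, by have := h.stepc i q; omega, h3⟩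

lemma north (h : Core m n l A B H f g) {i j k : ℤ} (hk : k ≤ H i j) :
    ∃ p ≤ i, H p j = k ∧ H (p - 1) j < k := h.tr.west hk

/-- if north is smaller then the westmost point is an inner corner -/
lemma west_inner (h : Core m n l A B H f g) {i j k : ℤ} (hk : k ≤ H i j) (hk' : H (i - 1) j < k) :
    ∃ q ≤ j, H i q = k ∧ H (i - 1) q = k - 1 ∧ H i (q - 1) = k - 1 ∧ H (i - 1) (q - 1) = k - 1 ∧
      A i q = B i q + 1 := by
  obtain ⟨q, h1, h2, h3⟩ := h.west hk
  have h4 := h.monor q (show i - 1 ≤ i by omega)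
  have h5 := h.monoc (i - 1) h1
  simp only at h5
  refine ⟨q, h1, h2, ?_⟩
  have := h.loc i q
  simp only [Loc] at this
  omega

lemma north_inner (h : Core m n l A B H f g) {i j k : ℤ} (hk : k ≤ H i j) (hk' : H i (j - 1) < k) :
    ∃ p ≤ i, H p j = k ∧ H p (j - 1) = k - 1 ∧ H (p - 1) j = k - 1 ∧ H (p - 1) (j - 1) = k - 1 ∧
      A p j = B p j + 1 := h.tr.west_inner hk hk'

lemma att (h : Core m n l A B H f g) {i j k : ℤ} (hk : k ≤ H i j) :
    ∃ p ≤ i, ∃ q ≤ j, H p q = k ∧ H (p - 1) q = k - 1 ∧ H p (q - 1) = k - 1 ∧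
      H (p - 1) (q - 1) = k - 1 ∧ A p q = B p q + 1 := by
  obtain ⟨p, h1, h2, h3⟩ := h.north hk
  obtain ⟨q, h4, h5⟩ := h.west_inner h2.ge h3
  exact ⟨p, h1, q, h4, h5⟩

lemma onz (h : Core m n l A B H f g) {i j : ℤ} (hA : A i j ≠ 0 ∨ B i j ≠ 0) :
    H i j = H (i - 1) (j - 1) + 1 := by
  have := h.loc i j; simp only [Loc] at this; omega

lemma strict (h : Core m n l A B H f g) {i j i' j' : ℤ} (hA : H i' j' = H (i' - 1) (j' - 1) + 1)
    (hi : i < i') (hj : j < j') : H i j < H i' j' := by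
  have := h.mono (show i ≤ i' - 1 by omega) (show j ≤ j' - 1 by omega)
  omega

lemma locB (h : Core m n l A B H f g) (i j : ℤ) :
    (B i j : ℤ) = A i j - (H i j - H (i - 1) j - H i (j - 1) + H (i - 1) (j - 1)) := by
  have := h.loc i j; simp only [Loc] at this; omega

lemma bper (h : Core m n l A B H f g) (i j : ℤ) : B (i + m) (j + n) = B i j := by
  have h1 := h.locB i j
  have h2 := h.locB (i + m) (j + n)
  rw [h.gap.1, show i + (m : ℤ) - 1 = i - 1 + m by ring, show j + (n : ℤ) - 1 = j - 1 + n by ring,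
    h.per, h.per, h.per, h.per] at h2
  omega

lemma gapB (h : Core m n l A B H f g) : IsGAP m n B := by
  refine gap_of_band h.npos h.bper ?_
  obtain ⟨K, hK⟩ := h.bd
  obtain ⟨K', hK0, hK'⟩ := gap_band h.npos h.gap
  have hm : (0 : ℤ) < m := by exact_mod_cast h.mpos
  have hn : (0 : ℤ) < n := by exact_mod_cast h.npos
  refine ⟨max K' (K + n + m), fun i j hB => ?_⟩
  have m1 := le_max_left K' (K + n + m)
  have m2 := le_max_right K' (K + n + m)
  by_cases hA : A i j ≠ 0
  · obtain ⟨a, b⟩ := hK' i j hA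
    constructor <;> linarith
  push Not at hA
  have e := h.locB i j
  constructor
  · by_contra hcon
    push Not at hcon
    rw [(hK i j).2 (by linarith), (hK (i - 1) j).2 (by linarith), (hK i (j - 1)).2 (by linarith),
      (hK (i - 1) (j - 1)).2 (by linarith)] at e
    omega
  · by_contra hcon
    push Not at hcon
    rw [(hK i j).1 (by linarith), (hK (i - 1) j).1 (by linarith), (hK i (j - 1)).1 (by linarith),
      (hK (i - 1) (j - 1)).1 (by linarith)] at e
    omega

lemma lev (h : Core m n l A B H f g) : Lev m n l (supp A) fun c => H c.1 c.2 := by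
  refine ⟨h.lpos, fun k c hc => (sh_supp h.gap).2 hc, fun k c _ => h.perk k _ _,
    fun c hc c' hc' hh => h.strict (h.onz (Or.inl hc')) hh.1 hh.2, ?_⟩
  exact lev_fin h.npos h.gap (le_refl _) h.lpos fun k c _ => h.perk k _ _

lemma levB (h : Core m n l A B H f g) : Lev m n l (supp B) fun c => H c.1 c.2 := by
  refine ⟨h.lpos, fun k c hc => (sh_supp h.gapB).2 hc, fun k c _ => h.perk k _ _,
    fun c hc c' hc' hh => h.strict (h.onz (Or.inr hc')) hh.1 hh.2, ?_⟩
  exact lev_fin h.npos h.gapB (le_refl _) h.lpos fun k c _ => h.perk k _ _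

end Core

lemma core_of_proper {m n l : ℕ} (hm : 0 < m) (hn : 0 < n) {A : Mat} (hA : IsGAP m n A)
    {d : Cell → ℤ} (lev : Lev m n l (supp A) d) (hne : ∃ c, c ∈ supp A)
    (pred : ∀ c ∈ supp A, ∃ c' ∈ supp A, NW c' c ∧ d c' = d c - 1) :
    ∃ B H f g, Core m n l A B H f g ∧ ∀ c ∈ supp A, H c.1 c.2 = d c := by
  obtain ⟨c0, hc0⟩ := hne
  have hm' : (1 : ℤ) ≤ m := by exact_mod_cast hm
  have hn' : (1 : ℤ) ≤ n := by exact_mod_cast hn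
  have hex : ∀ i j : ℤ, ∃ v, (∃ c ∈ supp A, nwGe c (i, j) ∧ d c = v) ∧
      ∀ c ∈ supp A, nwGe c (i, j) → d c ≤ v := by
    intro i j
    have big : ∀ x y : ℤ, ∃ k : ℤ, x ≤ y + k * m ∧ x ≤ y + k * n := fun x y =>
      ⟨|x - y|, by
        have := le_abs_self (x - y); have := abs_nonneg (x - y)
        constructor <;> nlinarith⟩
    obtain ⟨k1, k2, k3⟩ := big (max i j + 1) (min c0.1 c0.2)
    obtain ⟨k1', k2', k3'⟩ := big (max c0.1 c0.2) (min i j)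
    have hx : nwGe (sh m n (-k1') c0) (i, j) := by
      have := le_max_left c0.1 c0.2
      have := le_max_right c0.1 c0.2
      have := min_le_left i j
      have := min_le_right i j
      simp only [nwGe, sh]
      constructor <;> linarith
    obtain ⟨v, ⟨c, h1, h2, h3⟩, h4⟩ := int_max (fun v => ∃ c ∈ supp A, nwGe c (i, j) ∧ d c = v)
      (d (sh m n k1 c0)) (by
        rintro v ⟨c, h1, h2, rfl⟩
        refine le_of_lt (lev.str c h1 _ (lev.inv k1 _ hc0) ⟨?_, ?_⟩) <;>
        simp only [nwGe, sh] at * <;> omega)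
      ⟨_, sh m n (-k1') c0, lev.inv _ _ hc0, hx, rfl⟩
    exact ⟨v, ⟨c, h1, h2, h3⟩, fun c' h5 h6 => h4 _ ⟨c', h5, h6, rfl⟩⟩
  choose H hH1 hH2 using hex
  have mono : ∀ {i j i' j' : ℤ}, i ≤ i' → j ≤ j' → H i j ≤ H i' j' := by
    intro i j i' j' hi hj
    obtain ⟨c, h1, h2, h3⟩ := hH1 i j
    rw [← h3]
    exact hH2 i' j' c h1 ⟨h2.1.trans hi, h2.2.trans hj⟩
  have diag : ∀ i j, H i j ≤ H (i - 1) (j - 1) + 1 := by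
    intro i j
    obtain ⟨c, h1, h2, h3⟩ := hH1 i j
    obtain ⟨c', p1, p2, p3⟩ := pred c h1
    have := hH2 (i - 1) (j - 1) c' p1 (by simp only [nwGe, NW] at *; omega)
    omega
  have cell : ∀ i j, A i j ≠ 0 → H i j = d (i, j) ∧ H (i - 1) (j - 1) + 1 ≤ H i j := by
    intro i j hij
    have hm : ((i, j) : Cell) ∈ supp A := hij
    obtain ⟨c, h1, h2, h3⟩ := hH1 (i - 1) (j - 1)
    have a1 := lev.str c h1 _ hm (by simp only [nwGe, NW] at *; omega)
    have a2 := hH2 i j _ hm ⟨le_rfl, le_rfl⟩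
    have a3 := diag i j
    omega
  let B : Mat := fun i j =>
    ((A i j : ℤ) - (H i j - H (i - 1) j - H i (j - 1) + H (i - 1) (j - 1))).toNat
  obtain ⟨K, hK0, hK⟩ := gap_band hn hA
  have f_ind : ∀ i j j' : ℤ, n * i + K ≤ m * j → H i j' ≤ H i j := by
    intro i j j' hj
    obtain ⟨c, h1, h2, h3⟩ := hH1 i j'
    rw [← h3]
    refine hH2 i j c h1 ⟨h2.1, ?_⟩
    obtain ⟨b1, b2⟩ := hK c.1 c.2 h1
    have : c.1 ≤ i := h2.1
    simp only
    by_contra hcon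
    push Not at hcon
    nlinarith
  have g_ind : ∀ i i' j : ℤ, m * j + K ≤ n * i → H i' j ≤ H i j := by
    intro i i' j hj
    obtain ⟨c, h1, h2, h3⟩ := hH1 i' j
    rw [← h3]
    refine hH2 i j c h1 ⟨?_, h2.2⟩
    obtain ⟨b1, b2⟩ := hK c.1 c.2 h1
    have : c.2 ≤ j := h2.2
    simp only
    by_contra hcon
    push Not at hcon
    nlinarith
  have habs : ∀ a b x : ℤ, 1 ≤ a → b * x + K ≤ a * (|b * x| + K) := by
    intro a b x ha
    have := le_abs_self (b * x); have := abs_nonneg (b * x)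
    nlinarith
  refine ⟨B, H, fun i => H i (|n * i| + K), fun j => H (|m * j| + K) j,
    ⟨hm, hn, lev.lpos, hA, ?_, ?_, K, ?_⟩, fun c hc => (cell c.1 c.2 hc).1⟩
  · intro i j
    have e1 := mono (show i - 1 ≤ i - 1 by omega) (show j - 1 ≤ j by omega)
    have e2 := mono (show i - 1 ≤ i by omega) (show j - 1 ≤ j - 1 by omega)
    have e3 := mono (show i - 1 ≤ i by omega) (show j ≤ j by omega)
    have e4 := mono (show i ≤ i by omega) (show j - 1 ≤ j by omega)
    have e5 := diag i j
    have a1 : A i j ≠ 0 → H (i - 1) (j - 1) + 1 ≤ H i j := fun h => (cell i j h).2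
    have a2 : H (i - 1) j < H i j → H i (j - 1) < H i j → A i j ≠ 0 := by
      intro b1 b2
      obtain ⟨c, h1, h2, h3⟩ := hH1 i j
      have c1 : c.1 = i := by
        by_contra hh
        have := hH2 (i - 1) j c h1 (by simp only [nwGe] at *; omega)
        omega
      have c2 : c.2 = j := by
        by_contra hh
        have := hH2 i (j - 1) c h1 (by simp only [nwGe] at *; omega)
        omega
      subst c1 c2
      exact h1
    simp only [Loc, B]
    by_cases hz : A i j = 0
    · have a3 : ¬ (H (i - 1) j < H i j ∧ H i (j - 1) < H i j) := fun hh => a2 hh.1 hh.2 hz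
      clear a1 a2
      generalize H (i - 1) (j - 1) = w at *
      generalize H (i - 1) j = x at *
      generalize H i (j - 1) = y at *
      generalize H i j = z at *
      generalize A i j = a at *
      have hx : x = w ∨ x = w + 1 := by omega
      have hy : y = w ∨ y = w + 1 := by omega
      have hzz : z = w ∨ z = w + 1 := by omega
      rcases hx with rfl | rfl <;> rcases hy with rfl | rfl <;> rcases hzz with rfl | rfl <;> omega
    · have := a1 hz
      clear a1 a2
      generalize H (i - 1) (j - 1) = w at *
      generalize H (i - 1) j = x at *
      generalize H i (j - 1) = y at *
      generalize H i j = z at *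
      generalize A i j = a at *
      have hx : x = w ∨ x = w + 1 := by omega
      have hy : y = w ∨ y = w + 1 := by omega
      have hzz : z = w + 1 := by omega
      subst hzz
      rcases hx with rfl | rfl <;> rcases hy with rfl | rfl <;> omega
  · intro i j
    apply le_antisymm
    · obtain ⟨c, h1, h2, h3⟩ := hH1 (i + m) (j + n)
      have := hH2 i j (sh m n (-1) c) (lev.inv _ _ h1) (by simp only [nwGe, sh] at *; omega)
      rw [lev.per _ _ h1] at this
      omega
    · obtain ⟨c, h1, h2, h3⟩ := hH1 i j
      have := hH2 (i + m) (j + n) (sh m n 1 c) (lev.inv _ _ h1) (by simp only [nwGe, sh] at *; omega)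
      rw [lev.per _ _ h1] at this
      omega
  · intro i j
    exact ⟨fun h => le_antisymm (f_ind _ _ _ (habs m n i hm')) (f_ind _ _ _ h),
      fun h => le_antisymm (g_ind _ _ _ (habs n m j hn')) (g_ind _ _ _ h)⟩

def LX (f : ℤ → ℤ) (k x : ℤ) : Prop := k ≤ f x ∧ f (x - 1) < k

def IC (H : ℤ → ℤ → ℤ) (k : ℤ) (c : Cell) : Prop :=
  H c.1 c.2 = k ∧ H (c.1 - 1) c.2 = k - 1 ∧ H c.1 (c.2 - 1) = k - 1 ∧ H (c.1 - 1) (c.2 - 1) = k - 1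

def OC (H : ℤ → ℤ → ℤ) (k : ℤ) (c : Cell) : Prop :=
  H c.1 c.2 = k ∧ H (c.1 - 1) c.2 = k ∧ H c.1 (c.2 - 1) = k ∧ H (c.1 - 1) (c.2 - 1) = k - 1

def OnZ (H : ℤ → ℤ → ℤ) (k : ℤ) (c : Cell) : Prop := k ≤ H c.1 c.2 ∧ H (c.1 - 1) (c.2 - 1) < k

lemma zz_step (z : ℤ → Cell)
    (h : ∀ i : ℤ, z (i + 1) = ((z i).1, (z i).2 + 1) ∨ z (i + 1) = ((z i).1 - 1, (z i).2))
    {i j : ℤ} (hij : i ≤ j) : (z j).1 ≤ (z i).1 ∧ (z i).2 ≤ (z j).2 ∧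
      (z j).2 - (z j).1 = (z i).2 - (z i).1 + (j - i) := by
  induction j, hij using Int.leInduction with
  | base => simp
  | succ j _ ih =>
    rcases h j with h | h <;> rw [h] <;> simp only <;> omega

namespace Core
variable {m n l : ℕ} {A B : Mat} {H : ℤ → ℤ → ℤ} {f g : ℤ → ℤ}

lemma corners (h : Core m n l A B H f g) {k s : ℤ} {z : ℤ → Cell}
    (hz : ∀ i, (z i).2 - (z i).1 = i + s ∧ OnZ H k (z i)) :
    innerCorners z = {c | IC H k c} ∧ outerCorners z = {c | OC H k c} := by
  -- uniqueness of position on a diagonal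
  have uq : ∀ i x, x.2 - x.1 = i + s → OnZ H k x → z i = x := by
    intro i x hx ho
    obtain ⟨h1, h2⟩ := hz i
    rcases lt_trichotomy (z i).1 x.1 with hlt | heq | hgt
    · have := h.mono (show (z i).1 ≤ x.1 - 1 by omega) (show (z i).2 ≤ x.2 - 1 by omega)
      have := h2.1; have := ho.2; omega
    · exact Prod.ext heq (by omega)
    · have := h.mono (show x.1 ≤ (z i).1 - 1 by omega) (show x.2 ≤ (z i).2 - 1 by omega)
      have := h2.2; have := ho.1; omega
  have key : ∀ i, (z i = ((z (i - 1)).1 - 1, (z (i - 1)).2) ↔ H (z i).1 ((z i).2 - 1) < k) ∧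
      (z i = ((z (i - 1)).1, (z (i - 1)).2 + 1) ↔ k ≤ H (z i).1 ((z i).2 - 1)) ∧
      (z (i + 1) = ((z i).1, (z i).2 + 1) ↔ H ((z i).1 - 1) (z i).2 < k) ∧
      (z (i + 1) = ((z i).1 - 1, (z i).2) ↔ k ≤ H ((z i).1 - 1) (z i).2) := by
    intro i
    obtain ⟨h1, h2, h3⟩ := hz i
    have a1 : k ≤ H (z i).1 ((z i).2 - 1) → z (i - 1) = ((z i).1, (z i).2 - 1) := by
      intro hh
      refine uq _ _ (by simp only; omega) ⟨hh, ?_⟩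
      have := h.mono (le_refl ((z i).1 - 1)) (show (z i).2 - 1 - 1 ≤ (z i).2 - 1 by omega)
      simp only; omega
    have a2 : H (z i).1 ((z i).2 - 1) < k → z (i - 1) = ((z i).1 + 1, (z i).2) := by
      intro hh
      refine uq _ _ (by simp only; omega) ⟨?_, ?_⟩
      · have := h.mono (show (z i).1 ≤ (z i).1 + 1 by omega) (le_refl (z i).2)
        simp only; omega
      · simp only [add_sub_cancel_right]; exact hh
    have a3 : k ≤ H ((z i).1 - 1) (z i).2 → z (i + 1) = ((z i).1 - 1, (z i).2) := by
      intro hh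
      refine uq _ _ (by simp only; omega) ⟨hh, ?_⟩
      have := h.mono (show (z i).1 - 1 - 1 ≤ (z i).1 - 1 by omega) (le_refl ((z i).2 - 1))
      simp only; omega
    have a4 : H ((z i).1 - 1) (z i).2 < k → z (i + 1) = ((z i).1, (z i).2 + 1) := by
      intro hh
      refine uq _ _ (by simp only; omega) ⟨?_, ?_⟩
      · have := h.mono (le_refl (z i).1) (show (z i).2 ≤ (z i).2 + 1 by omega)
        simp only; omega
      · simp only [add_sub_cancel_right]; exact hh
    refine ⟨⟨fun e => ?_, fun e => ?_⟩, ⟨fun e => ?_, fun e => ?_⟩, ⟨fun e => ?_, a4⟩, fun e => ?_, a3⟩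
    · by_contra hh
      have := a1 (not_lt.1 hh)
      have e1 := congrArg Prod.fst e
      rw [this] at e1; simp only at e1; omega
    · rw [a2 e]; simp
    · by_contra hh
      have := a2 (not_le.1 hh)
      have e1 := congrArg Prod.fst e
      rw [this] at e1; simp only at e1; omega
    · rw [a1 e]; simp
    · by_contra hh
      have := a3 (not_lt.1 hh)
      have e1 := congrArg Prod.fst e
      rw [this] at e1; simp only at e1; omega
    · by_contra hh
      have := a4 (not_le.1 hh)
      have e1 := congrArg Prod.fst e
      rw [this] at e1; simp only at e1; omega
  constructor
  · ext c
    simp only [innerCorners, Set.mem_ofPred_eq, IC]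
    constructor
    · rintro ⟨i, rfl, h1, h2⟩
      have h1 := (key i).1.1 h1
      have h2 := (key i).2.2.1.1 h2
      have := (hz i).2.1
      have := h.stepr (z i).1 (z i).2
      have := h.stepc (z i).1 (z i).2
      have := h.stepd (z i).1 (z i).2
      have := h.stepc ((z i).1 - 1) (z i).2
      omega
    · rintro ⟨h1, h2, h3, h4⟩
      have e := uq (c.2 - c.1 - s) c (by omega) ⟨by omega, by omega⟩
      refine ⟨_, e, (key _).1.2 ?_, (key _).2.2.1.2 ?_⟩ <;> rw [e] <;> omega
  · ext c
    simp only [outerCorners, Set.mem_ofPred_eq, OC]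
    constructor
    · rintro ⟨i, rfl, h1, h2⟩
      have h1 := (key i).2.1.1 h1
      have h2 := (key i).2.2.2.1 h2
      have := (hz i).2.2
      have := h.stepr (z i).1 (z i).2
      have := h.stepc (z i).1 (z i).2
      have := h.stepd (z i).1 (z i).2
      have := h.stepc ((z i).1 - 1) (z i).2
      omega
    · rintro ⟨h1, h2, h3, h4⟩
      have e := uq (c.2 - c.1 - s) c (by omega) ⟨by omega, by omega⟩
      refine ⟨_, e, (key _).2.1.2 ?_, (key _).2.2.2.2 ?_⟩ <;> rw [e] <;> omega

lemma ic_supp (h : Core m n l A B H f g) {k : ℤ} {c : Cell} (hc : IC H k c) : c ∈ supp A := by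
  have := h.loc c.1 c.2
  obtain ⟨h1, h2, h3, h4⟩ := hc
  simp only [Loc] at this
  simp only [supp, Set.mem_ofPred_eq]
  omega

lemma ic_anti (h : Core m n l A B H f g) {k : ℤ} {c c' : Cell} (hc : IC H k c) (hc' : k ≤ H c'.1 c'.2)
    (h1 : c'.1 ≤ c.1) (h2 : c'.2 ≤ c.2) : c' = c := by
  obtain ⟨p1, p2, p3, p4⟩ := hc
  have e1 : c'.1 = c.1 := by
    by_contra hh
    have := h.mono (show c'.1 ≤ c.1 - 1 by omega) h2
    omega
  have e2 : c'.2 = c.2 := by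
    by_contra hh
    have := h.mono h1 (show c'.2 ≤ c.2 - 1 by omega)
    omega
  exact Prod.ext e1 e2

lemma nwMax (h : Core m n l A B H f g) {d : Cell → ℤ} (hd : ∀ c ∈ supp A, H c.1 c.2 = d c) (k : ℤ) :
    nwMaximal (levelSet A d k) = {c | IC H k c} := by
  ext c
  simp only [nwMaximal, levelSet, Set.mem_ofPred_eq]
  constructor
  · rintro ⟨⟨h1, h2⟩, h3⟩
    rw [← hd c h1] at h2
    obtain ⟨p, hp, q, hq, e⟩ := h.att h2.ge
    have hic : IC H k (p, q) := ⟨e.1, e.2.1, e.2.2.1, e.2.2.2.1⟩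
    have := h3 (p, q) ⟨h.ic_supp hic, by rw [← hd _ (h.ic_supp hic)]; exact e.1⟩ ⟨hp, hq⟩
    rwa [← this]
  · intro hc
    refine ⟨⟨h.ic_supp hc, by rw [← hd _ (h.ic_supp hc)]; exact hc.1⟩, ?_⟩
    rintro c' ⟨h1, h2⟩ h3
    rw [← hd c' h1] at h2
    exact h.ic_anti hc h2.ge h3.1 h3.2

lemma zz_canon (h : Core m n l A B H f g) {k : ℤ} {z : ℤ → Cell} (hz : IsZigZag z)
    (hi : innerCorners z = {c | IC H k c}) :
    ∀ i, (z i).2 - (z i).1 = i + ((z 0).2 - (z 0).1) ∧ OnZ H k (z i) := by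
  obtain ⟨h1, ⟨N, hN⟩, ⟨N', hN'⟩⟩ := hz
  intro i
  refine ⟨?_, ?_, ?_⟩
  · rcases le_total 0 i with h0 | h0
    · have := (zz_step z h1 h0).2.2; omega
    · have := (zz_step z h1 h0).2.2; omega
  · obtain ⟨a, ⟨ha1, ha2⟩, ha3⟩ := int_min (fun a => i ≤ a ∧ z (a + 1) = ((z a).1, (z a).2 + 1)) i
      (fun _ hz => hz.1) ⟨max i N, le_max_left _ _, hN _ (le_max_right _ _)⟩
    obtain ⟨b, ⟨hb1, hb2⟩, hb3⟩ := int_max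
      (fun b => b ≤ a ∧ z b = ((z (b - 1)).1 - 1, (z (b - 1)).2)) a
      (fun _ hz => hz.1) ⟨min a (N' + 1), min_le_left _ _, by
        have := hN' (min a (N' + 1) - 1) (by have := min_le_right a (N' + 1); omega)
        simpa using this⟩
    have hin : z b ∈ innerCorners z := by
      refine ⟨b, rfl, hb2, ?_⟩
      by_cases hab : b = a
      · rw [hab]; exact ha2
      · rcases h1 b with hh | hh
        · exact hh
        · have := hb3 (b + 1) ⟨by omega, by simpa using hh⟩
          omega
    rw [hi] at hin
    have c1 : ∀ j, i ≤ j → j ≤ a → (z j).2 = (z i).2 := by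
      intro j hj
      induction j, hj using Int.leInduction with
      | base => simp
      | succ j hj ih =>
        intro hja
        rcases h1 j with hh | hh
        · have := ha3 j ⟨hj, hh⟩; omega
        · rw [hh]; exact ih (by omega)
    have c2 : ∀ j, b ≤ j → j ≤ a → (z j).1 = (z b).1 := by
      intro j hj
      induction j, hj using Int.leInduction with
      | base => simp
      | succ j hj ih =>
        intro hja
        rcases h1 j with hh | hh
        · rw [hh]; exact ih (by omega)
        · have := hb3 (j + 1) ⟨by omega, by simpa using hh⟩; omega
    have e1 := c1 a ha1 le_rfl
    have e2 := c2 a hb1 le_rfl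
    have e3 := (zz_step z h1 ha1).1
    have e4 := (zz_step z h1 hb1).2.1
    rw [← hin.1]
    exact h.mono (by omega) (by omega)
  · by_contra hh
    push Not at hh
    obtain ⟨p, hp, q, hq, e⟩ := h.att hh
    have hic : ((p, q) : Cell) ∈ innerCorners z := by
      rw [hi]; exact ⟨e.1, e.2.1, e.2.2.1, e.2.2.2.1⟩
    obtain ⟨j, hj, _⟩ := hic
    have j1 : (z j).1 = p := by rw [hj]
    have j2 : (z j).2 = q := by rw [hj]
    rcases le_total i j with h0 | h0
    · have := zz_step z h1 h0; omega
    · have := zz_step z h1 h0; omega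

lemma zz_exists (h : Core m n l A B H f g) (k : ℤ) : ∃ z : ℤ → Cell, IsZigZag z ∧
    ∀ i, (z i).2 - (z i).1 = i + 0 ∧ OnZ H k (z i) := by
  obtain ⟨X, hX1, hX2⟩ := h.f_cut k
  obtain ⟨Y, hY1, hY2⟩ := h.g_cut k
  obtain ⟨J, hJ⟩ := h.f_att X
  obtain ⟨I, hI⟩ := h.g_att Y
  have lowf : ∀ p q, k ≤ H p q → X ≤ p := by
    intro p q hp
    by_contra hh
    have := h.le_f p q
    have := h.f_mono (show p ≤ X - 1 by omega)
    omega
  have lowg : ∀ p q, k ≤ H p q → Y ≤ q := by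
    intro p q hp
    by_contra hh
    have := h.le_g p q
    have := h.g_mono (show q ≤ Y - 1 by omega)
    omega
  have ex : ∀ t : ℤ, ∃ p, k ≤ H p (p + t) ∧ ∀ p', k ≤ H p' (p' + t) → p ≤ p' := by
    intro t
    refine int_min (fun p => k ≤ H p (p + t)) X (fun p hp => lowf _ _ hp) ⟨max X (J - t), ?_⟩
    have := h.mono (le_max_left X (J - t)) (show J ≤ max X (J - t) + t by omega)
    have := hJ J le_rfl
    omega
  choose p hp1 hp2 using ex
  have on : ∀ t, H (p t - 1) (p t + t - 1) < k := by
    intro t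
    by_contra hh
    have := hp2 t (p t - 1) (by rw [show p t - 1 + t = p t + t - 1 by ring]; omega)
    omega
  refine ⟨fun t => (p t, p t + t), ⟨fun t => ?_, ⟨J - X, fun t ht => ?_⟩, ⟨Y - I - 1, fun t ht => ?_⟩⟩,
    fun t => ⟨by simp only; ring, hp1 t, on t⟩⟩
  · have a1 := hp2 (t + 1) (p t) ((hp1 t).trans (h.mono le_rfl (by omega)))
    have a2 := hp2 t (p (t + 1) + 1) ((hp1 (t + 1)).trans (h.mono (by omega) (by omega)))
    rcases (show p (t + 1) = p t ∨ p (t + 1) = p t - 1 by omega) with e | e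
    · left; simp only [e, Prod.mk.injEq, true_and]; ring
    · right; simp only [e, Prod.mk.injEq, true_and]; ring
  · have E : ∀ t, J - X ≤ t → p t = X := fun t ht =>
      le_antisymm (hp2 t X (by rw [hJ _ (by omega)]; exact hX1)) (lowf _ _ (hp1 t))
    simp only [E t ht, E (t + 1) (by omega), Prod.mk.injEq, true_and]; ring
  · have E : ∀ t, t ≤ Y - I → p t = Y - t := fun t ht =>
      le_antisymm (hp2 t (Y - t) (by rw [show Y - t + t = Y by ring, hI _ (by omega)]; exact hY1))
        (by have := lowg _ _ (hp1 t); omega)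
    simp only [E t (by omega), E (t + 1) (by omega), Prod.mk.injEq]; omega

section
variable {d : Cell → ℤ}

lemma zigAt (h : Core m n l A B H f g) (hd : ∀ c ∈ supp A, H c.1 c.2 = d c) {k : ℤ} {z : ℤ → Cell}
    (hz : ZigZagAt A d k z) : innerCorners z = {c | IC H k c} ∧ outerCorners z = {c | OC H k c} := by
  obtain ⟨h1, h2⟩ := hz
  rw [h.nwMax hd] at h2
  exact h.corners (h.zz_canon h1 h2)

lemma zigEx (h : Core m n l A B H f g) (hd : ∀ c ∈ supp A, H c.1 c.2 = d c) (k : ℤ) :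
    ∃ z, ZigZagAt A d k z := by
  obtain ⟨z, h1, h2⟩ := h.zz_exists k
  exact ⟨z, h1, by rw [h.nwMax hd]; exact (h.corners h2).1⟩

lemma inner_iff (h : Core m n l A B H f g) (hd : ∀ c ∈ supp A, H c.1 c.2 = d c) (c : Cell) :
    IsInnerOf A d c ↔ IC H (H c.1 c.2) c := by
  constructor
  · rintro ⟨k, z, hz, hc⟩
    rw [(h.zigAt hd hz).1] at hc
    have := hc.1
    rw [this]; exact hc
  · intro hc
    obtain ⟨z, hz⟩ := h.zigEx hd (H c.1 c.2)
    exact ⟨_, z, hz, by rw [(h.zigAt hd hz).1]; exact hc⟩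

lemma outer_iff (h : Core m n l A B H f g) (hd : ∀ c ∈ supp A, H c.1 c.2 = d c) (c : Cell) :
    IsOuterOf A d c ↔ OC H (H c.1 c.2) c := by
  constructor
  · rintro ⟨k, z, hz, hc⟩
    rw [(h.zigAt hd hz).2] at hc
    have := hc.1
    rw [this]; exact hc
  · intro hc
    obtain ⟨z, hz⟩ := h.zigEx hd (H c.1 c.2)
    exact ⟨_, z, hz, by rw [(h.zigAt hd hz).2]; exact hc⟩

lemma flat_iff (h : Core m n l A B H f g) (hd : ∀ c ∈ supp A, H c.1 c.2 = d c) {B' : Mat} :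
    FlatEntries A B' (IsInnerOf A d) (IsOuterOf A d) ↔ B' = B := by
  constructor
  · intro hF
    funext i j
    obtain ⟨h1, h2, h3⟩ := hF (i, j)
    rw [h.inner_iff hd, h.outer_iff hd] at *
    simp only [IC, OC, true_and] at h1 h2 h3
    have := h.loc i j
    simp only [Loc] at this
    rcases this with this | this | this | this | this
    · have := h3 (by omega) (by omega); omega
    · have := h1 (by omega); omega
    · have := h3 (by omega) (by omega); omega
    · have := h3 (by omega) (by omega); omega
    · have := h2 (by omega); omega
  · rintro rfl ⟨i, j⟩
    rw [h.inner_iff hd, h.outer_iff hd]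
    simp only [IC, OC, true_and]
    have := h.loc i j
    simp only [Loc] at this
    refine ⟨fun _ => ?_, fun _ => ?_, fun _ _ => ?_⟩ <;> omega

lemma bp_iff (h : Core m n l A B H f g) (hd : ∀ c ∈ supp A, H c.1 c.2 = d c) :
    backPostSet A d = {c | ∃ k, LX f k c.1 ∧ LX g k c.2} := by
  have lowf : ∀ {k X p q}, LX f k X → k ≤ H p q → X ≤ p := by
    intro k X p q hX hp
    by_contra hh
    have := h.le_f p q
    have := h.f_mono (show p ≤ X - 1 by omega)
    have := hX.2
    omega
  have lowg : ∀ {k Y p q}, LX g k Y → k ≤ H p q → Y ≤ q := by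
    intro k X p q hX hp
    by_contra hh
    have := h.le_g p q
    have := h.g_mono (show q ≤ X - 1 by omega)
    have := hX.2
    omega
  have exf : ∀ {k X}, LX f k X → ∃ q, IC H k (X, q) := by
    intro k X hX
    obtain ⟨J, hJ⟩ := h.f_att X
    obtain ⟨q, hq, e⟩ := h.west_inner (i := X) (j := J) (k := k) (by rw [hJ J le_rfl]; exact hX.1)
      (lt_of_le_of_lt (h.le_f _ _) hX.2)
    exact ⟨q, e.1, e.2.1, e.2.2.1, e.2.2.2.1⟩
  have exg : ∀ {k Y}, LX g k Y → ∃ p, IC H k (p, Y) := by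
    intro k Y hY
    obtain ⟨I, hI⟩ := h.g_att Y
    obtain ⟨q, hq, e⟩ := h.north_inner (i := I) (j := Y) (k := k) (by rw [hI I le_rfl]; exact hY.1)
      (lt_of_le_of_lt (h.le_g _ _) hY.2)
    exact ⟨q, e.1, e.2.2.1, e.2.1, e.2.2.2.1⟩
  ext c
  simp only [backPostSet, Set.mem_ofPred_eq]
  constructor
  · rintro ⟨k, z, hz, cr, h1, cl, h2, h3, h4, rfl⟩
    rw [(h.zigAt hd hz).1] at *
    refine ⟨k, ?_, ?_⟩
    · obtain ⟨X, hX⟩ := h.f_cut k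
      obtain ⟨q, hq⟩ := exf hX
      have := h.ic_anti h1 hq.1.ge (lowf hX h1.1.ge) (h3 _ hq)
      rw [← this]; exact hX
    · obtain ⟨Y, hY⟩ := h.g_cut k
      obtain ⟨p, hp⟩ := exg hY
      have e1 := h4 _ hp
      have e2 := lowg hY h2.1.ge
      simp only at e1 ⊢
      rw [le_antisymm e1 e2]; exact hY
  · rintro ⟨k, hX, hY⟩
    obtain ⟨z, hz⟩ := h.zigEx hd k
    refine ⟨k, z, hz, ?_⟩
    simp only [IsBackPost]
    rw [(h.zigAt hd hz).1]
    obtain ⟨q, hq⟩ := exf hX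
    obtain ⟨p, hp⟩ := exg hY
    refine ⟨_, hq, _, hp, ?_, fun c' hc' => lowg hY hc'.1.ge, rfl⟩
    intro c' hc'
    by_contra hh
    push Not at hh
    have := h.ic_anti hc' hq.1.ge (lowf hX hc'.1.ge) hh.le
    rw [← this] at hh; simp only at hh; omega
end
end Core

noncomputable def sz (n : ℕ) (A : Mat) : ℕ := ∑ j ∈ Finset.range n, ∑ᶠ i : ℤ, A i (j : ℤ)

lemma tele (F : ℤ → ℤ) (a : ℤ) (k : ℕ) :
    ∑ i ∈ Finset.Ioc a (a + k), (F i - F (i - 1)) = F (a + k) - F a := by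
  induction k with
  | zero => simp
  | succ k ih =>
    have : Finset.Ioc a (a + (k + 1 : ℕ)) = insert (a + k + 1) (Finset.Ioc a (a + k)) := by
      ext x; simp only [Finset.mem_Ioc, Finset.mem_insert]; push_cast; omega
    rw [this, Finset.sum_insert (by simp), ih, add_sub_cancel_right]
    push_cast
    rw [← add_assoc]; ring

lemma tele_range (F : ℤ → ℤ) (k : ℕ) :
    ∑ i ∈ Finset.range k, (F i - F ((i : ℤ) - 1)) = F ((k : ℤ) - 1) - F (-1) := by
  induction k with
  | zero => simp
  | succ k ih => rw [Finset.sum_range_succ, ih]; push_cast; rw [add_sub_cancel_right]; ring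

lemma band_col {m n : ℕ} (hn : 0 < n) {A : Mat} (hA : IsGAP m n A) (j : ℤ) :
    ∃ N : ℤ, ∀ i, A i j ≠ 0 → -N < i ∧ i ≤ N := by
  obtain ⟨K, hK, h⟩ := gap_band hn hA
  have hn' : (1 : ℤ) ≤ n := by exact_mod_cast hn
  refine ⟨|m * j| + K + 1, fun i hi => ?_⟩
  obtain ⟨h1, h2⟩ := h i j hi
  have := le_abs_self (m * j : ℤ)
  have := neg_abs_le (m * j : ℤ)
  have := abs_nonneg (m * j : ℤ)
  constructor <;> by_contra hh <;> push Not at hh <;> nlinarith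

lemma Core.size_lt {m n l : ℕ} {A B : Mat} {H : ℤ → ℤ → ℤ} {f g : ℤ → ℤ}
    (h : Core m n l A B H f g) : sz n B < sz n A := by
  have key : ∀ j : ℤ, ((∑ᶠ i : ℤ, A i j : ℕ) : ℤ) - (∑ᶠ i : ℤ, B i j : ℕ) = g j - g (j - 1) := by
    intro j
    obtain ⟨N1, h1⟩ := band_col h.npos h.gap j
    obtain ⟨N2, h2⟩ := band_col h.npos h.gapB j
    obtain ⟨K, hK⟩ := h.bd
    have hn' : (1 : ℤ) ≤ n := by exact_mod_cast h.npos
    have hm' : (1 : ℤ) ≤ m := by exact_mod_cast h.mpos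
    obtain ⟨N, e1, e2, e3⟩ : ∃ N : ℕ, N1 ≤ N ∧ N2 ≤ N ∧ |m * j| + |K| + m ≤ (N : ℤ) := by
      refine ⟨(max (max N1 N2) (|m * j| + |K| + m)).toNat, ?_, ?_, ?_⟩ <;>
      have := le_max_left (max N1 N2) (|m * j| + |K| + m) <;>
      have := le_max_right (max N1 N2) (|m * j| + |K| + m) <;>
      have := le_max_left N1 N2 <;> have := le_max_right N1 N2 <;> omega
    have a1 := le_abs_self (m * j : ℤ)
    have a2 := neg_abs_le (m * j : ℤ)
    have a3 := le_abs_self K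
    have a4 := abs_nonneg (m * j : ℤ)
    have a5 := abs_nonneg K
    have s1 : ∑ᶠ i : ℤ, A i j = ∑ i ∈ Finset.Ioc (-N : ℤ) (-N + (2 * N : ℕ)), A i j := by
      apply finsum_eq_sum_of_support_subset
      intro i hi
      have := h1 i hi
      simp only [Finset.coe_Ioc, Set.mem_Ioc]; push_cast; omega
    have s2 : ∑ᶠ i : ℤ, B i j = ∑ i ∈ Finset.Ioc (-N : ℤ) (-N + (2 * N : ℕ)), B i j := by
      apply finsum_eq_sum_of_support_subset
      intro i hi
      have := h2 i hi
      simp only [Finset.coe_Ioc, Set.mem_Ioc]; push_cast; omega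
    rw [s1, s2]
    push_cast
    rw [← Finset.sum_sub_distrib]
    have := tele (fun i => H i j - H i (j - 1)) (-N) (2 * N)
    beta_reduce at this
    rw [show (-(N : ℤ) + (2 * N : ℕ)) = N by push_cast; ring] at this
    rw [(hK N j).2 (by nlinarith), (hK N (j - 1)).2 (by nlinarith), (hK (-N) j).1 (by nlinarith),
      (hK (-N) (j - 1)).1 (by nlinarith)] at this
    rw [show (-(N : ℤ) + 2 * N) = N by ring]
    rw [show g j - g (j - 1) = g j - g (j - 1) - (f (-(N : ℤ)) - f (-N)) by ring, ← this]
    refine Finset.sum_congr rfl fun i _ => ?_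
    have := h.locB i j
    omega
  have : ((sz n A : ℕ) : ℤ) - sz n B = l := by
    unfold sz
    push_cast
    rw [← Finset.sum_sub_distrib]
    have e : ∀ j ∈ Finset.range n, ((∑ᶠ i : ℤ, A i (j : ℤ) : ℕ) : ℤ) - (∑ᶠ i : ℤ, B i (j : ℤ) : ℕ)
        = g j - g ((j : ℤ) - 1) := fun j _ => key j
    rw [Finset.sum_congr rfl e, tele_range]
    have := h.g_per 1 (-1)
    rw [show (-1 : ℤ) + 1 * n = n - 1 by ring] at this
    omega
  have := h.lpos
  omega

structure Stp (m n l : ℕ) (A B : Mat) (H : ℤ → ℤ → ℤ) (f g : ℤ → ℤ) (c e : ℤ → Cell) : Prop where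
  core : Core m n l A B H f g
  sw : SWE m n l A (fun x => H x.1 x.2) c
  ex : ∀ k, LX f k (e k).1
  ey : ∀ k, LX g k (e k).2

def Step (m n l : ℕ) (A B : Mat) (e : ℤ → Cell) : Prop := ∃ H f g c, Stp m n l A B H f g c e

lemma LX.unique {f : ℤ → ℤ} (hf : Monotone f) {k x y : ℤ} (h : LX f k x) (h' : LX f k y) : x = y := by
  obtain ⟨a, b⟩ := h
  obtain ⟨c, d⟩ := h'
  rcases lt_trichotomy x y with hh | hh | hh
  · have := hf (show x ≤ y - 1 by omega); omega
  · exact hh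
  · have := hf (show y ≤ x - 1 by omega); omega

lemma LX.le_iff {f : ℤ → ℤ} (hf : Monotone f) {k x : ℤ} (h : LX f k x) (y : ℤ) : k ≤ f y ↔ x ≤ y := by
  obtain ⟨a, b⟩ := h
  constructor
  · intro hh
    by_contra hc
    have := hf (show y ≤ x - 1 by omega); omega
  · intro hh
    exact a.trans (hf hh)

lemma LX.lt {f : ℤ → ℤ} (hs : ∀ i, f i ≤ f (i - 1) + 1) {k x y : ℤ} (hf : Monotone f)
    (h : LX f k x) (h' : LX f (k + 1) y) : x < y := by
  by_contra hc
  have := (LX.le_iff hf h' x).2 (by omega)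
  have := hs x
  have := h.2
  omega

section
variable {m n l l' : ℕ} {A B B' : Mat} {H H' : ℤ → ℤ → ℤ} {f f' g g' : ℤ → ℤ} {c c' e e' : ℤ → Cell}

lemma Core.shift (h : Core m n l A B H f g) (t : ℤ) :
    Core m n l A B (fun i j => H i j - t) (fun i => f i - t) (fun j => g j - t) := by
  obtain ⟨K, hK⟩ := h.bd
  refine ⟨h.mpos, h.npos, h.lpos, h.gap, fun i j => ?_, fun i j => by rw [h.per]; ring, K, ?_⟩
  · have := h.loc i j
    simp only [Loc] at *
    generalize H i j = a at *
    generalize H (i - 1) j = b at *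
    generalize H i (j - 1) = c at *
    generalize H (i - 1) (j - 1) = d at *
    clear hK h
    rcases this with h | h | h | h | h
    · left; omega
    · right; left; omega
    · right; right; left; omega
    · right; right; right; left; omega
    · right; right; right; right; omega
  · exact fun i j => ⟨fun hh => by rw [(hK i j).1 hh], fun hh => by rw [(hK i j).2 hh]⟩

lemma Conn.shift {A : Mat} {d : Cell → ℤ} {E : Set Cell} {x : Cell} (t : ℤ) (h : Conn A d E x) :
    Conn A (fun x => d x - t) E x := by
  induction h with
  | base c hc => exact Conn.base c hc
  | step a b h1 h2 h3 h4 _ ih => exact Conn.step a b h1 h2 h3 (show d b - t = d a - t - 1 by omega) ih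

lemma SWE.shift {d : Cell → ℤ} (h : SWE m n l A d c) (t : ℤ) :
    SWE m n l A (fun x => d x - t) (fun i => c (i + t)) := by
  refine ⟨⟨h.lev.lpos, h.lev.inv, fun k x hx => by rw [h.lev.per k x hx]; ring, fun x hx x' hx' hh => ?_,
    fun k => ?_⟩, st_shift h.st t, fun i => h.mem _, fun i => by rw [h.num]; ring, fun x hx => ?_, ?_⟩
  · have := h.lev.str x hx x' hx' hh; omega
  · exact (h.lev.fin (k + t)).subset fun x hx => ⟨hx.1, by have := hx.2; omega⟩
  · rw [range_shift]; exact (h.conn x hx).shift t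
  · intro e' he' hm hd k
    have := h.best (fun i => e' (i + -t)) (st_shift he' _) (fun i => hm _)
      (fun i => by have := hd (i + -t); omega) (k + t)
    simpa using this

lemma Stp.shift (h : Stp m n l A B H f g c e) (t : ℤ) :
    Stp m n l A B (fun i j => H i j - t) (fun i => f i - t) (fun j => g j - t)
      (fun i => c (i + t)) (fun i => e (i + t)) := by
  refine ⟨h.core.shift t, h.sw.shift t, fun k => ?_, fun k => ?_⟩
  · have := h.ex (k + t); simp only [LX] at *; omega
  · have := h.ey (k + t); simp only [LX] at *; omega

lemma Step.shift (h : Step m n l A B e) (t : ℤ) : Step m n l A B (fun i => e (i + t)) := by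
  obtain ⟨H, f, g, c, h⟩ := h
  exact ⟨_, _, _, _, h.shift t⟩

lemma Stp.stream (h : Stp m n l A B H f g c e) : IsStreamEnum m n e l := by
  refine ⟨h.core.lpos, fun i => ⟨?_, ?_⟩, fun i => ?_⟩
  · exact LX.lt (fun i => (h.core.f_step i).2) h.core.f_mono (h.ex i) (h.ex (i + 1))
  · exact LX.lt (fun i => (h.core.g_step i).2) h.core.g_mono (h.ey i) (h.ey (i + 1))
  · refine Prod.ext (LX.unique h.core.f_mono ?_ (h.ex (i + l))) (LX.unique h.core.g_mono ?_ (h.ey (i + l)))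
    · have h1 := h.core.f_per 1 (e i).1
      have h2 := h.core.f_per 1 ((e i).1 - 1)
      have := h.ex i
      simp only [LX, tauC] at *
      rw [show (e i).1 + (m : ℤ) - 1 = (e i).1 - 1 + 1 * m by ring, h2,
        show (e i).1 + (m : ℤ) = (e i).1 + 1 * m by ring, h1]
      omega
    · have h1 := h.core.g_per 1 (e i).2
      have h2 := h.core.g_per 1 ((e i).2 - 1)
      have := h.ey i
      simp only [LX, tauC] at *
      rw [show (e i).2 + (n : ℤ) - 1 = (e i).2 - 1 + 1 * n by ring, h2,
        show (e i).2 + (n : ℤ) = (e i).2 + 1 * n by ring, h1]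
      omega

lemma Stp.range (h : Stp m n l A B H f g c e) :
    Set.range e = backPostSet A (fun x => H x.1 x.2) := by
  rw [h.core.bp_iff (fun _ _ => rfl)]
  ext x
  constructor
  · rintro ⟨k, rfl⟩; exact ⟨k, h.ex k, h.ey k⟩
  · rintro ⟨k, h1, h2⟩
    exact ⟨k, Prod.ext (LX.unique h.core.f_mono (h.ex k) h1) (LX.unique h.core.g_mono (h.ey k) h2)⟩

lemma Core.ext (h : Core m n l A B H f g) (h' : Core m n l A B' H' f' g') (t : ℤ)
    (hd : ∀ x ∈ supp A, H' x.1 x.2 = H x.1 x.2 - t) :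
    B' = B ∧ (∀ i j, H' i j = H i j - t) ∧ (∀ i, f' i = f i - t) ∧ ∀ j, g' j = g j - t := by
  have E : ∀ i j, H' i j = H i j - t := by
    intro i j
    apply le_antisymm
    · obtain ⟨p, hp, q, hq, e⟩ := h'.att (le_refl (H' i j))
      have h1 := hd (p, q) (h'.ic_supp (k := H' i j) ⟨e.1, e.2.1, e.2.2.1, e.2.2.2.1⟩)
      have := h.mono hp hq
      simp only at h1
      omega
    · obtain ⟨p, hp, q, hq, e⟩ := h.att (le_refl (H i j))
      have h1 := hd (p, q) (h.ic_supp (k := H i j) ⟨e.1, e.2.1, e.2.2.1, e.2.2.2.1⟩)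
      have := h'.mono hp hq
      simp only at h1
      omega
  refine ⟨?_, E, fun i => ?_, fun j => ?_⟩
  · funext i j
    have h1 := h.locB i j
    have h2 := h'.locB i j
    rw [E, E, E, E] at h2
    omega
  · obtain ⟨J, hJ⟩ := h.f_att i
    obtain ⟨J', hJ'⟩ := h'.f_att i
    rw [← hJ _ (le_max_left J J'), ← hJ' _ (le_max_right J J'), E]
  · obtain ⟨J, hJ⟩ := h.g_att j
    obtain ⟨J', hJ'⟩ := h'.g_att j
    rw [← hJ _ (le_max_left J J'), ← hJ' _ (le_max_right J J'), E]

lemma Stp.unique (h : Stp m n l A B H f g c e) (h' : Stp m n l' A B' H' f' g' c' e') :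
    l = l' ∧ B' = B ∧ ∃ t, ∀ i, e' i = e (i + t) := by
  obtain ⟨rfl, t, _, hd⟩ := swe_unique h.sw h'.sw
  obtain ⟨hB, _, hf, hg⟩ := h.core.ext h'.core t hd
  refine ⟨rfl, hB, t, fun i => Prod.ext ?_ ?_⟩
  · refine LX.unique h'.core.f_mono (h'.ex i) ?_
    have := h.ex (i + t)
    simp only [LX] at *
    rw [hf, hf]; omega
  · refine LX.unique h'.core.g_mono (h'.ey i) ?_
    have := h.ey (i + t)
    simp only [LX] at *
    rw [hg, hg]; omega

lemma st_range (he : IsStreamEnum m n e l) (he' : IsStreamEnum m n e' l')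
    (hr : Set.range e = Set.range e') : l = l' ∧ ∃ t, ∀ i, e' i = e (i + t) := by
  have h1 : ∀ i, ∃ j, e j = e' i := fun i => by
    have : e' i ∈ Set.range e := by rw [hr]; exact ⟨i, rfl⟩
    exact this
  have h2 : ∀ i, ∃ j, e' j = e i := fun i => by
    have : e i ∈ Set.range e' := by rw [← hr]; exact ⟨i, rfl⟩
    exact this
  choose φ hφ using h1
  choose ψ hψ using h2
  have lt_iff : ∀ {l : ℕ} {e : ℤ → Cell}, IsStreamEnum m n e l → ∀ i j, NW (e i) (e j) ↔ i < j := by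
    intro l e he i j
    refine ⟨fun hh => ?_, st_mono he⟩
    by_contra hc
    rcases (not_lt.1 hc).lt_or_eq with h | h
    · have := st_mono he h; simp only [NW] at *; omega
    · rw [h] at hh; simp only [NW] at hh; omega
  have φm : ∀ i j, φ i < φ j ↔ i < j := fun i j => by
    rw [← lt_iff he, hφ, hφ, lt_iff he']
  have φψ : ∀ i, φ (ψ i) = i := fun i => st_inj he (by rw [hφ, hψ])
  have step : ∀ i, φ (i + 1) = φ i + 1 := by
    intro i
    have a := (φm i (i + 1)).2 (by omega)
    by_contra hc
    have b1 := (φm i (ψ (φ i + 1))).1 (by rw [φψ]; omega)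
    have b2 := (φm (ψ (φ i + 1)) (i + 1)).1 (by rw [φψ]; omega)
    omega
  have lin : ∀ i, φ i = i + φ 0 := by
    intro i
    induction i using Int.induction_on with
    | zero => simp
    | succ k ih => rw [step, ih]; ring
    | pred k ih => have := step (-k - 1); rw [sub_add_cancel] at this; omega
  have E : ∀ i, e' i = e (i + φ 0) := fun i => by rw [← lin, hφ]
  refine ⟨?_, φ 0, E⟩
  have a := he'.2.2 0
  rw [E, E, he.2.2] at a
  have := st_inj he a
  omega

/-- bridge: from the frozen relations -/
lemma step_of (hm : 0 < m) (hn : 0 < n) (hA : IsGAP m n A) (hF : FlatRel m n A B) {d : Cell → ℤ}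
    (hd : IsSWNumbering m n A d) (he : IsStreamEnum m n e l) (hr : Set.range e = backPostSet A d) :
    Step m n l A B e := by
  have mk : ∀ d, IsSWNumbering m n A d → ∃ l B H f g c e, Stp m n l A B H f g c e ∧
      (∀ x ∈ supp A, H x.1 x.2 = d x) := by
    intro d hd
    obtain ⟨l, c, hs⟩ := swe_of hm hn hA hd
    obtain ⟨B, H, f, g, hc, hH⟩ := core_of_proper hm hn hA hs.lev ⟨c 0, hs.mem 0⟩ (fun x hx => by
      obtain ⟨c', h1, h2, h3, _⟩ := conn_pred hs.st hs.num hs.mem (hs.conn x hx)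
      exact ⟨c', h1, h2, h3⟩)
    choose X hX using hc.f_cut
    choose Y hY using hc.g_cut
    exact ⟨l, B, H, f, g, c, fun k => (X k, Y k), ⟨hc, swe_congr hs hH, hX, hY⟩, hH⟩
  obtain ⟨l1, B1, H1, f1, g1, c1, e1, h1, hd1⟩ := mk d hd
  obtain ⟨d2, hd2, hF⟩ := hF
  obtain ⟨l2, B2, H2, f2, g2, c2, e2, h2, hd2'⟩ := mk d2 hd2
  obtain rfl := (h2.core.flat_iff hd2').1 hF
  obtain ⟨_, rfl, _⟩ := h1.unique h2
  have hr' : Set.range e1 = Set.range e := by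
    rw [hr, h1.range, h1.core.bp_iff (fun _ _ => rfl), h1.core.bp_iff hd1]
  obtain ⟨rfl, t, ht⟩ := st_range h1.stream he hr'
  have := h1.shift t
  rw [show (fun i => e1 (i + t)) = e from (funext ht).symm] at this
  exact ⟨_, _, _, _, this⟩

lemma Stp.to (h : Stp m n l A B H f g c e) : FlatRel m n A B ∧ ∃ d, IsSWNumbering m n A d ∧
    IsStreamEnum m n e l ∧ Set.range e = backPostSet A d :=
  ⟨⟨_, swe_to h.sw, (h.core.flat_iff (fun _ _ => rfl)).2 rfl⟩, _, swe_to h.sw, h.stream, h.range⟩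

lemma step_exists (hm : 0 < m) (hn : 0 < n) (hA : IsGAP m n A) (hne : A ≠ 0) :
    ∃ l B e, Step m n l A B e := by
  obtain ⟨l, d, c, hs⟩ := swe_exists hm hn hA hne
  obtain ⟨B, H, f, g, hc, hH⟩ := core_of_proper hm hn hA hs.lev ⟨c 0, hs.mem 0⟩ (fun x hx => by
    obtain ⟨c', h1, h2, h3, _⟩ := conn_pred hs.st hs.num hs.mem (hs.conn x hx)
    exact ⟨c', h1, h2, h3⟩)
  choose X hX using hc.f_cut
  choose Y hY using hc.g_cut
  exact ⟨l, B, fun k => (X k, Y k), H, f, g, c, hc, swe_congr hs hH, hX, hY⟩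
end

/-- closed sets -/
structure TSet (m n : ℕ) (B : Mat) (H : ℤ → ℤ → ℤ) (f : ℤ → ℤ) (T : ℤ → ℤ → Prop) : Prop where
  up : ∀ i j i' j', T i j → i ≤ i' → j ≤ j' → H i' j' = H i j → T i' j'
  se : ∀ i j i' j', T i j → i < i' → j < j' → B i' j' ≠ 0 → H i' j' = H i j + 1 → T i' j'
  lt : ∀ i j, T i j → H i j < f i
  per : ∀ k i j, T i j → T (i + k * m) (j + k * n)

def WS (A : Mat) (H : ℤ → ℤ → ℤ) (T : ℤ → ℤ → Prop) : Set Cell :=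
  {c | c ∈ supp A ∧ ∃ i j, T i j ∧ H i j = H c.1 c.2 ∧ neLe c (i, j)}

section
variable {m n l : ℕ} {A B : Mat} {H : ℤ → ℤ → ℤ} {f g : ℤ → ℤ} {T : ℤ → ℤ → Prop}

lemma Core.east_max (h : Core m n l A B H f g) {i j : ℤ} (hlt : H i j < f i) :
    ∃ q, j ≤ q ∧ H i q = H i j ∧ H i (q + 1) = H i j + 1 := by
  obtain ⟨J, hJ⟩ := h.f_att i
  obtain ⟨q, h1, h2⟩ := int_max (fun q => j ≤ q ∧ H i q = H i j) J (fun z hz => by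
    by_contra hc
    have := hJ z (by omega)
    omega) ⟨j, le_refl _, rfl⟩
  refine ⟨q, h1.1, h1.2, ?_⟩
  have := h.stepc i (q + 1)
  rw [add_sub_cancel_right] at this
  by_contra hc
  have := h2 (q + 1) ⟨by omega, by omega⟩
  omega

lemma Core.south_max (h : Core m n l A B H f g) {i j p : ℤ} (hlt : H i j < H p j) :
    ∃ r, i ≤ r ∧ r < p ∧ H r j = H i j ∧ H (r + 1) j = H i j + 1 := by
  obtain ⟨r, h1, h2⟩ := int_max (fun q => i ≤ q ∧ H q j = H i j) p (fun z hz => by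
    by_contra hc
    have := h.mono (show p ≤ z by omega) (le_refl j)
    omega) ⟨i, le_refl _, rfl⟩
  refine ⟨r, h1.1, ?_, h1.2, ?_⟩
  · by_contra hc
    have := h.mono (show p ≤ r by omega) (le_refl j)
    omega
  have := h.stepr (r + 1) j
  rw [add_sub_cancel_right] at this
  by_contra hc
  have := h2 (r + 1) ⟨by omega, by omega⟩
  omega

/-- outer corner -/
lemma Core.corner (h : Core m n l A B H f g) {i q r k : ℤ} (hir : i ≤ r)
    (h1 : H i (q + 1) = k + 1) (h2 : H r q = k) (h3 : H (r + 1) q = k + 1) :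
    B (r + 1) (q + 1) ≠ 0 ∧ H (r + 1) (q + 1) = k + 1 := by
  have hl := h.loc (r + 1) (q + 1)
  have hm := h.mono hir (le_refl (q + 1))
  simp only [Loc, add_sub_cancel_right] at hl
  omega

lemma Core.corner_T (h : Core m n l A B H f g) (hT : TSet m n B H f T) {i j q p : ℤ} (ht : T i j)
    (hjq : j ≤ q) (h1 : H i q = H i j) (h2 : H i (q + 1) = H i j + 1) (h3 : H i j < H p q) :
    ∃ r, r < p ∧ T (r + 1) (q + 1) ∧ B (r + 1) (q + 1) ≠ 0 ∧ H (r + 1) (q + 1) = H i j + 1 := by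
  obtain ⟨r, r1, r2, r3, r4⟩ := h.south_max (i := i) (j := q) (p := p) (by omega)
  obtain ⟨b1, b2⟩ := h.corner (k := H i j) r1 h2 (by omega) (by omega)
  exact ⟨r, r2, hT.se i j _ _ ht (by omega) (by omega) b1 b2, b1, b2⟩

lemma Core.ne_step (h : Core m n l A B H f g) (hT : TSet m n B H f T) {c c' : Cell}
    (hc : c ∈ WS A H T) (hc' : c' ∈ supp A) (hh : NW c c') (hd : H c'.1 c'.2 = H c.1 c.2 + 1) :
    c' ∈ WS A H T := by
  obtain ⟨_, i, j, ht, hk, hn⟩ := hc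
  obtain ⟨p, q⟩ := c'
  have hz : H p q = H (p - 1) (q - 1) + 1 := h.onz (Or.inl hc')
  simp only [neLe, NW] at hn hh hd
  obtain ⟨q2, e1, e2, e3⟩ := h.east_max (hT.lt i j ht)
  refine ⟨hc', ?_⟩
  rcases lt_trichotomy q (q2 + 1) with hq | hq | hq
  · have := h.mono (le_refl p) (show q ≤ q2 by omega)
    obtain ⟨r, r1, r2, r3, r4⟩ := h.corner_T hT ht e1 e2 e3 (p := p) (by omega)
    exact ⟨_, _, r2, by simp only; omega, by simp only [neLe]; omega⟩
  · subst hq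
    rw [add_sub_cancel_right] at hz
    have hl := h.loc p (q2 + 1)
    have := h.mono (show i ≤ p - 1 by omega) (le_refl (q2 + 1))
    have hA : A p (q2 + 1) ≠ 0 := hc'
    simp only [Loc, add_sub_cancel_right] at hl
    refine ⟨p, q2 + 1, hT.se i j _ _ ht (by omega) (by omega) (by omega) (by omega), rfl, ?_⟩
    simp only [neLe]; omega
  · have := h.mono (show i ≤ p - 1 by omega) (show q2 + 1 ≤ q - 1 by omega)
    omega

lemma WS_inv (h : Core m n l A B H f g) (hT : TSet m n B H f T) (k : ℤ) (c : Cell)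
    (hc : c ∈ WS A H T) : sh m n k c ∈ WS A H T := by
  obtain ⟨h1, i, j, h2, h3, h4⟩ := hc
  refine ⟨(sh_supp h.gap).2 h1, _, _, hT.per k i j h2, ?_, (sh_neLe (k := k)).2 h4⟩
  simp only [sh]
  rw [h.perk, h.perk, h3]

lemma Core.ne_disj (h : Core m n l A B H f g) (hT : TSet m n B H f T) {c : ℤ → Cell}
    (st : IsStreamEnum m n c l) (mem : ∀ i, c i ∈ supp A) (num : ∀ i, H (c i).1 (c i).2 = i)
    (conn : ∀ x ∈ supp A, Conn A (fun x => H x.1 x.2) (Set.range c) x) (i : ℤ) : c i ∉ WS A H T := by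
  intro hi
  have up : ∀ j, i ≤ j → c j ∈ WS A H T := by
    intro j hj
    induction j, hj using Int.leInduction with
    | base => exact hi
    | succ j _ ih => exact h.ne_step hT ih (mem _) (st.2.1 j) (by rw [num, num])
  have all : ∀ j, c j ∈ WS A H T := by
    intro j
    have hl : (1 : ℤ) ≤ l := by exact_mod_cast h.lpos
    have h1 := up (j + |i - j| * l) (by
      have := le_abs_self (i - j); have := abs_nonneg (i - j); nlinarith)
    rw [st_per st] at h1
    have := WS_inv h hT (-|i - j|) _ h1
    rwa [sh_sh, neg_add_cancel, sh_zero] at this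
  have every : ∀ x ∈ supp A, x ∈ WS A H T := by
    intro x hx
    have := conn x hx
    clear hx
    induction this with
    | base x hx => obtain ⟨j, rfl⟩ := hx; exact all j
    | step a b h1 h2 h3 h4 _ ih => exact h.ne_step hT ih h1 h3 (by omega)
  obtain ⟨r, h1, h2⟩ := h.f_cut 0
  obtain ⟨J, hJ⟩ := h.f_att r
  have h3 := h.f_step r
  have h4 := h.le_f (r - 1) J
  have h5 := hJ J (le_refl _)
  obtain ⟨q, _, e1, e2, e3, e4, e5⟩ := h.west_inner (i := r) (j := J) (k := 0) (by omega) (by omega)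
  obtain ⟨_, i', j', t1, t2, t3⟩ := every (r, q) (show A r q ≠ 0 by omega)
  simp only [neLe] at t2 t3
  have h6 := hT.lt _ _ t1
  have h7 := h.f_mono t3.1
  have h8 : f i' ≤ 0 := by omega
  omega

lemma neLe_swap {a b : Cell} : neLe a.swap b.swap ↔ neLe b a := by
  simp only [neLe, Prod.fst_swap, Prod.snd_swap]; omega

lemma stream_tr {c : ℤ → Cell} (h : IsStreamEnum m n c l) :
    IsStreamEnum n m (fun i => (c i).swap) l := by
  refine ⟨h.1, fun i => ⟨(h.2.1 i).2, (h.2.1 i).1⟩, fun i => ?_⟩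
  show tauC n m (c i).swap = (c (i + l)).swap
  rw [← h.2.2 i]; rfl

lemma conn_tr {c : ℤ → Cell} {x : Cell} (h : Conn A (fun x => H x.1 x.2) (Set.range c) x) :
    Conn (transM A) (fun x => trH H x.1 x.2) (Set.range fun i => (c i).swap) x.swap := by
  induction h with
  | base x hx => obtain ⟨j, rfl⟩ := hx; exact Conn.base _ ⟨j, rfl⟩
  | step a b h1 h2 h3 h4 _ ih => exact Conn.step a.swap b.swap h1 h2 ⟨h3.2, h3.1⟩ h4 ih

/-- comparison -/
lemma onz_cmp (h : Core m n l A B H f g) {a b : Cell}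
    (ha : H a.1 a.2 = H (a.1 - 1) (a.2 - 1) + 1) (hb : H b.1 b.2 = H (b.1 - 1) (b.2 - 1) + 1)
    (e : H a.1 a.2 = H b.1 b.2) : neLe a b ∨ neLe b a :=
  neLe_total_of (fun hh => by have := h.strict hb hh.1 hh.2; omega)
    (fun hh => by have := h.strict ha hh.1 hh.2; omega)

/-- the two-sided obstruction -/
lemma Core.two_sided (h : Core m n l A B H f g) (hT : TSet m n B H f T)
    (hT' : TSet n m (transM B) (trH H) g (fun i j => T j i)) {c : ℤ → Cell}
    (st : IsStreamEnum m n c l) (mem : ∀ i, c i ∈ supp A) (num : ∀ i, H (c i).1 (c i).2 = i)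
    (conn : ∀ x ∈ supp A, Conn A (fun x => H x.1 x.2) (Set.range c) x) {i j : ℤ} (ht : T i j) :
    False := by
  obtain ⟨q, e1, e2, e3⟩ := h.east_max (hT.lt i j ht)
  have hq := hT.up _ _ _ _ ht (le_refl i) e1 e2
  have hg : H i q < g q := hT'.lt q i hq
  obtain ⟨I, hI⟩ := h.g_att q
  obtain ⟨r, _, r2, r3, r4⟩ := h.corner_T hT ht e1 e2 e3 (p := I) (by
    have := hI I (le_refl _); omega)
  set k := H i j + 1 with hk
  have hc := mem k
  rcases onz_cmp h (a := c k) (b := (r + 1, q + 1)) (h.onz (Or.inl hc)) (h.onz (Or.inr r3))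
    (by rw [num]; exact r4.symm) with hh | hh
  · exact h.ne_disj hT st mem num conn k ⟨hc, _, _, r2, by rw [num, r4], hh⟩
  · refine h.tr.ne_disj hT' (stream_tr st) mem num (fun x hx => ?_) k
      ⟨hc, q + 1, r + 1, r2, ?_, neLe_swap (a := c k) (b := (r + 1, q + 1)) |>.2 hh⟩
    · exact conn_tr (conn x.swap hx)
    · show H (r + 1) (q + 1) = H (c k).1 (c k).2
      rw [num, r4]

lemma per_bound (hm : 0 < m) {F : ℤ → ℤ → ℤ} (hp : ∀ k i j : ℤ, F (i + k * m) (j + k * n) = F i j)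
    (hb : ∃ K : ℤ, ∀ i j : ℤ, (n * i + K ≤ m * j ∨ m * j + K ≤ n * i) → F i j ≤ 0) :
    ∃ M, ∀ i j, F i j ≤ M := by
  obtain ⟨K, hK⟩ := hb
  have hm' : (1 : ℤ) ≤ m := by exact_mod_cast hm
  set N : ℤ := n * m + |K| with hN
  have a1 := le_abs_self K
  have a2 := abs_nonneg K
  obtain ⟨M, hM⟩ := Finset.exists_le (((Finset.Ico 0 (m : ℤ)) ×ˢ (Finset.Icc (-N) N)).image
    fun x => F x.1 x.2)
  refine ⟨max M 0, fun i j => ?_⟩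
  rw [← hp (-(i / m)) i j]
  set i' := i + -(i / m) * m with hi
  set j' := j + -(i / m) * n
  have h1 : 0 ≤ i' ∧ i' < m := by
    have h1 := Int.emod_nonneg i (show (m : ℤ) ≠ 0 by omega)
    have h2 := Int.emod_lt_of_pos i (show (0 : ℤ) < m by omega)
    have h3 := Int.emod_add_mul_ediv i m
    have h4 : i' = i % m := by rw [hi]; linarith
    omega
  have hn0 : (0 : ℤ) ≤ n := by positivity
  by_cases hj : -N ≤ j' ∧ j' ≤ N
  · refine le_max_of_le_left (hM _ ?_)
    simp only [Finset.mem_image, Finset.mem_product, Finset.mem_Ico, Finset.mem_Icc]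
    exact ⟨(i', j'), ⟨h1, hj⟩, rfl⟩
  · refine le_max_of_le_right (hK _ _ ?_)
    have nm : 0 ≤ (n : ℤ) * m := by positivity
    rcases not_and_or.1 hj with hj | hj
    · right
      have x1 : (m : ℤ) * j' ≤ j' := by nlinarith
      have x2 : 0 ≤ (n : ℤ) * i' := mul_nonneg hn0 h1.1
      nlinarith
    · left
      have x1 : j' ≤ (m : ℤ) * j' := by nlinarith
      have x2 : (n : ℤ) * i' ≤ n * m := mul_le_mul_of_nonneg_left h1.2.le hn0
      linarith

end

section
variable {m n l l' : ℕ} {A A' B C : Mat} {H H' : ℤ → ℤ → ℤ} {f f' g g' : ℤ → ℤ} {c c' e e' : ℤ → Cell}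

lemma LX.fun_eq (hf : Monotone f) (hf' : Monotone f') {X : ℤ → ℤ} (h : ∀ k, LX f k (X k))
    (h' : ∀ k, LX f' k (X k)) : f = f' := by
  funext i
  apply le_antisymm
  · exact ((h' _).le_iff hf' i).2 (((h (f i)).le_iff hf i).1 (le_refl _))
  · exact ((h _).le_iff hf i).2 (((h' (f' i)).le_iff hf' i).1 (le_refl _))

lemma inj_le (h : Stp m n l A B H f g c e) (h' : Core m n l A' B H' f g) (i j : ℤ) :
    H' i j ≤ H i j := by
  have perD : ∀ k i j : ℤ, H' (i + k * m) (j + k * n) - H (i + k * m) (j + k * n)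
      = H' i j - H i j := fun k i j => by
    rw [h'.perk, h.core.perk]; ring
  obtain ⟨M, hM⟩ := per_bound (F := fun i j => H' i j - H i j) h.core.mpos perD (by
    obtain ⟨K, hK⟩ := h.core.bd
    refine ⟨K, fun i j hh => ?_⟩
    rcases hh with hh | hh
    · have := (hK i j).1 hh; have := h'.le_f i j; omega
    · have := (hK i j).2 hh; have := h'.le_g i j; omega)
  obtain ⟨u, ⟨i0, j0, h0⟩, hu⟩ := int_max (fun u => ∃ i j, H' i j - H i j = u) M (by
    rintro z ⟨i, j, rfl⟩; exact hM i j) ⟨_, i, j, rfl⟩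
  have hu' : ∀ i j, H' i j - H i j ≤ u := fun i j => hu _ ⟨i, j, rfl⟩
  by_contra hc
  have up : 0 < u := by have := hu' i j; omega
  have hse : ∀ i j i' j' : ℤ, i < i' → j < j' → B i' j' ≠ 0 → H' i j + 1 ≤ H' i' j' :=
    fun i j i' j' h1 h2 h3 => h'.strict (h'.onz (Or.inr h3)) h1 h2
  refine h.core.two_sided (T := fun i j => H' i j - H i j = u) ⟨?_, ?_, ?_, ?_⟩ ⟨?_, ?_, ?_, ?_⟩ h.sw.st
    h.sw.mem h.sw.num h.sw.conn h0
  · intro i j i' j' h1 h2 h3 h4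
    have := h'.mono h2 h3; have := hu' i' j'; omega
  · intro i j i' j' h1 h2 h3 h4 h5
    have := hse _ _ _ _ h2 h3 h4; have := hu' i' j'; omega
  · intro i j h1
    have := h'.le_f i j; omega
  · intro k i j h1
    have := perD k i j; omega
  · intro j i j' i' h1 h2 h3 h4
    have := h'.mono h3 h2; have := hu' i' j'; simp only [trH] at *; omega
  · intro j i j' i' h1 h2 h3 h4 h5
    have := hse _ _ _ _ h3 h2 h4; have := hu' i' j'; simp only [trH] at *; omega
  · intro j i h1
    have := h'.le_g i j; simp only [trH]; omega
  · intro k j i h1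
    have := perD k i j; omega

lemma step_inj (h : Step m n l A B e) (h' : Step m n l A' B e) : A = A' := by
  obtain ⟨H, f, g, c, h⟩ := h
  obtain ⟨H', f', g', c', h'⟩ := h'
  obtain rfl := LX.fun_eq h.core.f_mono h'.core.f_mono h.ex h'.ex
  obtain rfl := LX.fun_eq h.core.g_mono h'.core.g_mono h.ey h'.ey
  have E : H = H' := by
    funext i j
    exact le_antisymm (inj_le h' h.core i j) (inj_le h h'.core i j)
  subst E
  funext i j
  have h1 := h.core.locB i j
  have h2 := h'.core.locB i j
  omega

def Dom (e e' : ℤ → Cell) : Prop :=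
  ∀ t : ℤ, (∀ k, (e (k + t)).1 ≤ (e' k).1) → ∀ k, (e (k + t)).2 ≤ (e' k).2

lemma Core.west_cell (h : Core m n l A B H f g) {b : Cell} (hb : b ∈ supp B) :
    ∃ q ≤ b.2, A b.1 q ≠ 0 ∧ H b.1 q = H b.1 b.2 := by
  by_cases hA : A b.1 b.2 = 0
  · have hB : B b.1 b.2 ≠ 0 := hb
    have hl := h.loc b.1 b.2
    simp only [Loc] at hl
    obtain ⟨q, h1, h2, h3, h4, h5, h6⟩ := h.west_inner (i := b.1) (j := b.2 - 1) (k := H b.1 b.2)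
      (by omega) (by omega)
    exact ⟨q, by omega, by omega, by omega⟩
  · exact ⟨b.2, le_refl _, hA, rfl⟩

/-- the sw channel numbering of `B` is below `H` once normalised -/
lemma norm_le (h : Core m n l A B H f g) (h' : Stp m n l' B C H' f' g' c' e')
    (hn : ∀ i, H (c' i).1 (c' i).2 = i) (i j : ℤ) : H' i j ≤ H i j := by
  have hB : ∀ x ∈ supp B, H' x.1 x.2 ≤ H x.1 x.2 := by
    intro x hx
    have := h'.sw.conn x hx
    clear hx
    induction this with
    | base x hx =>
      obtain ⟨i, rfl⟩ := hx
      have := h'.sw.num i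
      rw [hn, this]
    | step a b h1 h2 h3 h4 _ ih =>
      have := h.levB.str _ h2 _ h1 h3
      omega
  obtain ⟨p, hp, q, hq, e⟩ := h'.core.att (le_refl (H' i j))
  have h1 := hB (p, q) (h'.core.ic_supp (k := H' i j) ⟨e.1, e.2.1, e.2.2.1, e.2.2.2.1⟩)
  have := h.mono hp hq
  simp only at h1
  omega

lemma norm_touch (h : Stp m n l A B H f g c e) (h' : Stp m n l B C H' f' g' c' e')
    (hn : ∀ i, H (c' i).1 (c' i).2 = i) : ∃ r, f r ≤ f' r := by
  by_contra hc
  push Not at hc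
  have hle := norm_le h.core h' hn
  have hT : TSet m n B H f (fun i j => H' i j = H i j) := by
    refine ⟨fun i j i' j' h1 h2 h3 h4 => ?_, fun i j i' j' h1 h2 h3 h4 h5 => ?_, fun i j h1 => ?_,
      fun k i j h1 => ?_⟩
    · have := h'.core.mono h2 h3; have := hle i' j'; omega
    · have := h'.core.strict (h'.core.onz (Or.inl h4)) h2 h3; have := hle i' j'; omega
    · have := h'.core.le_f i j; have := hc i; omega
    · rw [h'.core.perk, h.core.perk, h1]
  have disj := h.core.ne_disj hT h.sw.st h.sw.mem h.sw.num h.sw.conn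
  have hsub : WS A H (fun i j => H' i j = H i j) ⊆ supp A := fun x hx => hx.1
  obtain ⟨e2, s1, s2⟩ := stream_lemma (lev_sub h.core.lev hsub (WS_inv h.core hT)) (by
      obtain ⟨q, q1, q2, q3⟩ := h.core.west_cell (h'.sw.mem 0)
      refine ⟨((c' 0).1, q), q2, (c' 0).1, (c' 0).2, ?_, q3.symm, ⟨le_refl _, q1⟩⟩
      have := h'.sw.num 0
      show H' (c' 0).1 (c' 0).2 = H (c' 0).1 (c' 0).2
      rw [hn, this]) (by
    rintro x ⟨hx, i, j, h1, h2, h3⟩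
    obtain ⟨p, hp, q, hq, e⟩ := h'.core.att (le_refl (H' i j))
    have hpq := h'.core.ic_supp (k := H' i j) (c := (p, q)) ⟨e.1, e.2.1, e.2.2.1, e.2.2.2.1⟩
    have l1 := hle p q
    have l2 := h.core.mono hp hq
    obtain ⟨b, b1, b2, b3, _⟩ := conn_pred h'.sw.st h'.sw.num h'.sw.mem (h'.sw.conn _ hpq)
    have l3 := h.core.levB.str _ b1 _ hpq b2
    have l4 := hle b.1 b.2
    obtain ⟨a, a1, a2, a3, _⟩ := conn_pred h.sw.st h.sw.num h.sw.mem (h.sw.conn _ hx)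
    simp only at b3 l3 a3
    have hbT : H' b.1 b.2 = H b.1 b.2 := by omega
    rcases onz_cmp h.core (a := a) (b := b) (h.core.onz (Or.inl a1)) (h.core.onz (Or.inr b1))
      (by omega) with hh | hh
    · exact ⟨a, ⟨a1, b.1, b.2, hbT, by omega, hh⟩, a2, a3⟩
    · obtain ⟨q', q1, q2, q3⟩ := h.core.west_cell b1
      refine ⟨(b.1, q'), ⟨q2, b.1, b.2, hbT, q3.symm, ⟨le_refl _, q1⟩⟩, ?_, ?_⟩
      · simp only [NW, neLe] at *; omega
      · simp only; omega)
  have hb := h.sw.best e2 s1 (fun i => (s2 i).1.1) (fun i => (s2 i).2) 0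
  obtain ⟨⟨_, i, j, h1, h2, h3⟩, h4⟩ := s2 0
  refine disj 0 ⟨h.sw.mem 0, i, j, h1, ?_, hb.trans h3⟩
  have := h.sw.num 0
  rw [this, h2, h4]

/-- consecutive steps are dominant -/
lemma step_dom (h : Step m n l A B e) (h' : Step m n l' B C e') : l' ≤ l ∧ (l' = l → Dom e e') := by
  obtain ⟨H, f, g, c, h⟩ := h
  obtain ⟨H', f', g', c', h'⟩ := h'
  refine ⟨st_flow_le h.core.levB h'.sw.st h'.sw.mem, ?_⟩
  rintro rfl t ht k
  have lv := st_levels h.core.levB h'.sw.st h'.sw.mem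
  set t0 := H (c' 0).1 (c' 0).2 with ht0
  have h2 := h'.shift (-t0)
  have hn : ∀ i, H (c' (i + -t0)).1 (c' (i + -t0)).2 = i := fun i => by rw [lv]; ring
  obtain ⟨r, hr⟩ := norm_touch h h2 hn
  have hle := norm_le h.core h2 hn
  have hf : f' r + t ≤ f r := by
    have h1 := ((h'.ex (f' r)).le_iff h'.core.f_mono r).1 (le_refl _)
    exact ((h.ex _).le_iff h.core.f_mono r).2 ((ht (f' r)).trans h1)
  have htt : t ≤ t0 := by omega
  refine ((h.ey (k + t)).le_iff h.core.g_mono _).1 ?_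
  have h3 := ((h'.ey k).le_iff h'.core.g_mono _).2 (le_refl _)
  obtain ⟨I, hI⟩ := h'.core.g_att (e' k).2
  have h4 := hI I (le_refl _)
  have h5 := hle I (e' k).2
  have h6 := h.core.le_g I (e' k).2
  omega
end

/-- counting functions -/
structure CF (m l : ℕ) (f : ℤ → ℤ) : Prop where
  mono : Monotone f
  step : ∀ i, f i ≤ f (i - 1) + 1
  per : ∀ k i, f (i + k * m) = f i + k * l

lemma cutf {m l : ℕ} (R : ℤ → ℤ) (hR : ∀ i, R i < R (i + 1)) (hp : ∀ k i : ℤ, R (i + k * l) = R i + k * m) :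
    ∃ f, CF m l f ∧ ∀ k, LX f k (R k) := by
  choose f h1 h2 using step_cut R hR
  have mon := (step_mono R hR)
  have iff : ∀ k v, k ≤ f v ↔ R k ≤ v := by
    intro k v
    constructor
    · intro h; exact (mon.monotone h).trans (h1 v)
    · intro h
      have := mon.lt_iff_lt.1 (h.trans_lt (h2 v))
      omega
  refine ⟨f, ⟨fun a b hab => (iff _ _).2 ((h1 a).trans hab), fun i => ?_, fun k i => ?_⟩, fun k => ⟨?_, ?_⟩⟩
  · have a := h1 i
    by_contra hc
    have b := (iff (f (i - 1) + 1) (i - 1)).2 (by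
      have := mon (show f (i - 1) + 1 < f i by omega)
      omega)
    omega
  · apply le_antisymm
    · have := (iff (f (i + k * m) - k * l) i).2 (by
        have := hp (-k) (f (i + k * m))
        have a := h1 (i + k * m)
        rw [show f (i + k * m) + -k * l = f (i + k * m) - k * l by ring] at this
        rw [this]; linarith)
      omega
    · rw [iff, hp]
      have := h1 i
      linarith
  · exact (iff _ _).2 (le_refl _)
  · by_contra hc
    have := (iff k (R k - 1)).1 (by omega)
    omega

structure BMf (B : Mat) (f g : ℤ → ℤ) (G : ℤ → ℤ → ℤ) : Prop where
  r : ∀ i j, G (i - 1) j ≤ G i j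
  c : ∀ i j, G i (j - 1) ≤ G i j
  b : ∀ i j, B i j ≠ 0 → G (i - 1) (j - 1) + 1 ≤ G i j
  f : ∀ i j, G i j ≤ f i
  g : ∀ i j, G i j ≤ g j

lemma BMf.tr {B : Mat} {f g : ℤ → ℤ} {G : ℤ → ℤ → ℤ} (h : BMf B f g G) :
    BMf (transM B) g f (trH G) :=
  ⟨fun i j => h.c j i, fun i j => h.r j i, fun i j => h.b j i, fun i j => h.g j i, fun i j => h.f j i⟩

lemma BMf.mono {B : Mat} {f g : ℤ → ℤ} {G : ℤ → ℤ → ℤ} (h : BMf B f g G) {i i' j j' : ℤ}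
    (hi : i ≤ i') (hj : j ≤ j') : G i j ≤ G i' j' := by
  have h1 : Monotone fun i => G i j :=
    monotone_int_of_le_succ fun i => by have := h.r (i + 1) j; simpa using this
  have h2 : Monotone fun j => G i' j :=
    monotone_int_of_le_succ fun j => by have := h.c i' (j + 1); simpa using this
  exact (h1 hi).trans (h2 hj)

structure MaxF (m n l : ℕ) (B : Mat) (f g : ℤ → ℤ) (H : ℤ → ℤ → ℤ) : Prop where
  mpos : 0 < m
  npos : 0 < n
  lpos : 0 < l
  gap : IsGAP m n B
  cf : CF m l f
  cg : CF n l g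
  bm : BMf B f g H
  mx : ∀ G, BMf B f g G → ∀ i j, G i j ≤ H i j
  per : ∀ k i j : ℤ, H (i + k * m) (j + k * n) = H i j + k * l

lemma MaxF.tr {m n l : ℕ} {B : Mat} {f g : ℤ → ℤ} {H : ℤ → ℤ → ℤ} (h : MaxF m n l B f g H) :
    MaxF n m l (transM B) g f (trH H) :=
  ⟨h.npos, h.mpos, h.lpos, gap_tr h.mpos h.npos h.gap, h.cg, h.cf, h.bm.tr,
    fun G hG i j => h.mx (trH G) hG.tr j i, fun k i j => h.per k j i⟩

section
variable {m n l : ℕ} {B : Mat} {f g : ℤ → ℤ} {H : ℤ → ℤ → ℤ}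

lemma maxF_exists (hm : 0 < m) (hn : 0 < n) (hl : 0 < l) (hB : IsGAP m n B) (cf : CF m l f)
    (cg : CF n l g) (hs : ∃ G, BMf B f g G) : ∃ H, MaxF m n l B f g H := by
  obtain ⟨G0, hG0⟩ := hs
  have hex : ∀ i j, ∃ v, (∃ G, BMf B f g G ∧ G i j = v) ∧ ∀ G, BMf B f g G → G i j ≤ v := by
    intro i j
    obtain ⟨v, h1, h2⟩ := int_max (fun v => ∃ G, BMf B f g G ∧ G i j = v) (f i)
      (by rintro z ⟨G, hG, rfl⟩; exact hG.f i j) ⟨_, G0, hG0, rfl⟩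
    exact ⟨v, h1, fun G hG => h2 _ ⟨G, hG, rfl⟩⟩
  choose H h1 h2 using hex
  have hle : ∀ k i j : ℤ, H i j + k * l ≤ H (i + k * m) (j + k * n) := by
    intro k i j
    obtain ⟨G, hG, e⟩ := h1 i j
    have := h2 (i + k * m) (j + k * n) (fun a b => G (a - k * m) (b - k * n) + k * l) (by
      refine ⟨fun a b => ?_, fun a b => ?_, fun a b hab => ?_, fun a b => ?_, fun a b => ?_⟩
      · have := hG.r (a - k * m) (b - k * n)
        rw [show a - k * m - 1 = a - 1 - k * m by ring] at this; omega
      · have := hG.c (a - k * m) (b - k * n)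
        rw [show b - k * n - 1 = b - 1 - k * n by ring] at this; omega
      · have := hG.b (a - k * m) (b - k * n) (by
          have := gap_shift hB k (a - k * m) (b - k * n)
          rw [sub_add_cancel, sub_add_cancel] at this
          rwa [← this])
        rw [show a - k * m - 1 = a - 1 - k * m by ring,
          show b - k * n - 1 = b - 1 - k * n by ring] at this; omega
      · have := hG.f (a - k * m) (b - k * n)
        have e := cf.per k (a - k * m)
        rw [sub_add_cancel] at e; omega
      · have := hG.g (a - k * m) (b - k * n)
        have e := cg.per k (b - k * n)
        rw [sub_add_cancel] at e; omega)
    simp only [add_sub_cancel_right] at this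
    omega
  refine ⟨H, hm, hn, hl, hB, cf, cg, ⟨fun i j => ?_, fun i j => ?_, fun i j hb => ?_, fun i j => ?_,
    fun i j => ?_⟩, fun G hG i j => h2 i j G hG, fun k i j => ?_⟩
  · obtain ⟨G, hG, e⟩ := h1 (i - 1) j
    have := hG.r i j; have := h2 i j G hG; omega
  · obtain ⟨G, hG, e⟩ := h1 i (j - 1)
    have := hG.c i j; have := h2 i j G hG; omega
  · obtain ⟨G, hG, e⟩ := h1 (i - 1) (j - 1)
    have := hG.b i j hb; have := h2 i j G hG; omega
  · obtain ⟨G, hG, e⟩ := h1 i j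
    have := hG.f i j; omega
  · obtain ⟨G, hG, e⟩ := h1 i j
    have := hG.g i j; omega
  · have a := hle k i j
    have b := hle (-k) (i + k * m) (j + k * n)
    rw [show i + k * m + -k * m = i by ring, show j + k * n + -k * n = j by ring, neg_mul] at b
    omega

lemma MaxF.back (h : MaxF m n l B f g H) (i j : ℤ) : H i j = H (i + 1) j ∨ H i j = H i (j + 1) ∨
    (H i j = H (i + 1) (j + 1) ∨ (B (i + 1) (j + 1) ≠ 0 ∧ H i j + 1 = H (i + 1) (j + 1))) ∨
    H i j = f i ∨ H i j = g j := by
  by_contra hc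
  have r1 := h.bm.r (i + 1) j
  have c1 := h.bm.c i (j + 1)
  have d1 := h.bm.mono (show i ≤ i + 1 by omega) (show j ≤ j + 1 by omega)
  have f1 := h.bm.f i j
  have g1 := h.bm.g i j
  rw [add_sub_cancel_right] at r1 c1
  have hb := h.bm.b (i + 1) (j + 1)
  rw [add_sub_cancel_right, add_sub_cancel_right] at hb
  have := h.mx (fun a b => if a = i ∧ b = j then H i j + 1 else H a b) (by
    refine ⟨fun a b => ?_, fun a b => ?_, fun a b hab => ?_, fun a b => ?_, fun a b => ?_⟩
    · have := h.bm.r a b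
      split_ifs with x y y
      · omega
      · obtain ⟨x1, rfl⟩ := x
        obtain rfl : a = i + 1 := by omega
        omega
      · obtain ⟨rfl, rfl⟩ := y; omega
      · exact this
    · have := h.bm.c a b
      split_ifs with x y y
      · omega
      · obtain ⟨rfl, x1⟩ := x
        obtain rfl : b = j + 1 := by omega
        omega
      · obtain ⟨rfl, rfl⟩ := y; omega
      · exact this
    · have := h.bm.b a b hab
      split_ifs with x y y
      · omega
      · obtain ⟨x1, x2⟩ := x
        obtain rfl : a = i + 1 := by omega
        obtain rfl : b = j + 1 := by omega
        have := hb hab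
        omega
      · obtain ⟨rfl, rfl⟩ := y; omega
      · exact this
    · have := h.bm.f a b
      split_ifs with x
      · obtain ⟨rfl, rfl⟩ := x; omega
      · exact this
    · have := h.bm.g a b
      split_ifs with x
      · obtain ⟨rfl, rfl⟩ := x; omega
      · exact this) i j
  simp at this

lemma MaxF.far (h : MaxF m n l B f g H) (i : ℤ) : ∃ J, ∀ j, J ≤ j → H i j = f i := by
  obtain ⟨K, hK0, hK⟩ := gap_band h.npos h.gap
  have hn' : (1 : ℤ) ≤ n := by exact_mod_cast h.npos
  have hm' : (1 : ℤ) ≤ m := by exact_mod_cast h.mpos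
  have hl' : (1 : ℤ) ≤ l := by exact_mod_cast h.lpos
  obtain ⟨k, hk⟩ : ∃ k : ℤ, f i + 1 ≤ H (k * m) (k * n) := by
    refine ⟨|f i + 1 - H 0 0|, ?_⟩
    have := h.per |f i + 1 - H 0 0| 0 0
    rw [zero_add, zero_add] at this
    have := le_abs_self (f i + 1 - H 0 0)
    have := abs_nonneg (f i + 1 - H 0 0)
    nlinarith
  refine ⟨k * n + K, fun j hj => le_antisymm (h.bm.f i j) ?_⟩
  have hcell : ∀ a b, B a b ≠ 0 → j ≤ b → f i + 1 ≤ H a b := by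
    intro a b hab hb
    have := hK a b hab
    refine hk.trans (h.bm.mono ?_ (by omega))
    by_contra hc
    have x1 : n * a + n ≤ n * (k * m) := by nlinarith
    have x2 : (m : ℤ) * (k * n + K) ≤ m * b := by nlinarith
    nlinarith
  have hg : ∀ b, j ≤ b → f i + 1 ≤ g b := fun b hb =>
    hk.trans ((h.bm.mono (le_refl _) (by omega)).trans (h.bm.g (k * m) b))
  have hmin : ∀ a, f (min a i) ≤ f i := fun a => h.cf.mono (min_le_right _ _)
  have hmin2 : ∀ a, f (min (a - 1) i) ≤ f (min a i) := fun a =>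
    h.cf.mono (min_le_min_right _ (by omega))
  have := h.mx (fun a b => if j ≤ b then max (H a b) (f (min a i)) else H a b) (by
    refine ⟨fun a b => ?_, fun a b => ?_, fun a b hab => ?_, fun a b => ?_, fun a b => ?_⟩
    · have := h.bm.r a b
      split_ifs
      · exact max_le_max this (hmin2 a)
      · exact this
    · have := h.bm.c a b
      split_ifs
      · exact max_le_max this (le_refl _)
      · omega
      · exact le_max_of_le_left this
      · exact this
    · have := h.bm.b a b hab
      split_ifs with x y y
      · have := hcell a b hab y
        refine le_max_of_le_left ?_
        have := hmin (a - 1)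
        rcases max_choice (H (a - 1) (b - 1)) (f (min (a - 1) i)) with z | z <;> rw [z] <;> omega
      · omega
      · exact le_max_of_le_left this
      · exact this
    · have := h.bm.f a b
      split_ifs
      · exact max_le this (h.cf.mono (min_le_left _ _))
      · exact this
    · have := h.bm.g a b
      split_ifs with x
      · exact max_le this (by have := hg b x; have := hmin a; omega)
      · exact this) i j
  simp at this
  exact this

lemma MaxF.bdf (h : MaxF m n l B f g H) :
    ∃ K : ℤ, 0 ≤ K ∧ ∀ i j : ℤ, n * i + K ≤ m * j → H i j = f i := by
  have hm' : (1 : ℤ) ≤ m := by exact_mod_cast h.mpos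
  have hn' : (1 : ℤ) ≤ n := by exact_mod_cast h.npos
  choose J hJ using h.far
  obtain ⟨M, hM⟩ := Finset.exists_le ((Finset.Ico 0 (m : ℤ)).image J)
  refine ⟨m * |M|, by positivity, fun i j hij => ?_⟩
  set k := i / m with hk
  have h1 := Int.emod_nonneg i (show (m : ℤ) ≠ 0 by omega)
  have h2 := Int.emod_lt_of_pos i (show (0 : ℤ) < m by omega)
  have h3 := Int.emod_add_mul_ediv i m
  have e1 : i = i % m + k * m := by rw [hk]; linarith
  have e2 : j = (j - k * n) + k * n := by ring
  have hJM : J (i % m) ≤ M := hM _ (Finset.mem_image_of_mem _ (by simp [h1, h2]))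
  rw [e1, e2, h.per, hJ, h.cf.per]
  have a := le_abs_self M
  have b : (m : ℤ) * (k * n) + m * |M| ≤ m * j := by
    refine le_trans ?_ hij
    have : (n : ℤ) * (m * k) ≤ n * i := by
      apply mul_le_mul_of_nonneg_left _ (by omega)
      rw [hk]; linarith
    nlinarith
  have c : k * n + |M| ≤ j := by
    have : (m : ℤ) * (k * n + |M|) ≤ m * j := by linarith
    exact le_of_mul_le_mul_left this (by omega)
  omega

lemma MaxF.bd (h : MaxF m n l B f g H) : ∃ K : ℤ, 0 ≤ K ∧ ∀ i j : ℤ, (n * i + K ≤ m * j → H i j = f i) ∧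
    (m * j + K ≤ n * i → H i j = g j) := by
  obtain ⟨K1, a1, h1⟩ := h.bdf
  obtain ⟨K2, a2, h2⟩ := h.tr.bdf
  exact ⟨K1 + K2, by omega, fun i j => ⟨fun hh => h1 i j (by omega), fun hh => h2 j i (by omega)⟩⟩

lemma MaxF.stepr (h : MaxF m n l B f g H) (i j : ℤ) : H i j ≤ H (i - 1) j + 1 := by
  by_contra hc
  have fs := h.cf.step i
  obtain ⟨J, hJ⟩ := h.far (i - 1)
  have hf := h.bm.f i j
  obtain ⟨q, h1, h2⟩ := int_max (fun q => j ≤ q ∧ H (i - 1) q = H (i - 1) j) J (fun z hz => by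
    by_contra hc'
    have := hJ z (by omega)
    omega) ⟨j, le_refl _, rfl⟩
  have hb := h.back (i - 1) q
  rw [sub_add_cancel] at hb
  have m1 := h.bm.mono (le_refl i) h1.1
  have m2 := h.bm.mono (le_refl i) (show j ≤ q + 1 by omega)
  have m3 := h.bm.g i q
  have : H (i - 1) (q + 1) ≠ H (i - 1) j := fun hh => by
    have := h2 (q + 1) ⟨by omega, hh⟩
    omega
  omega

lemma MaxF.stepc (h : MaxF m n l B f g H) (i j : ℤ) : H i j ≤ H i (j - 1) + 1 := h.tr.stepr j i

lemma MaxF.core (h : MaxF m n l B f g H) : ∃ A, Core m n l A B H f g := by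
  let A : Mat := fun i j => ((B i j : ℤ) + (H i j - H (i - 1) j - H i (j - 1) + H (i - 1) (j - 1))).toNat
  obtain ⟨K, hK0, hK⟩ := h.bd
  have per1 : ∀ i j : ℤ, H (i + m) (j + n) = H i j + l := fun i j => by
    have := h.per 1 i j; simpa using this
  have loc : ∀ i j, Loc A B H i j := by
    intro i j
    have r1 := h.bm.r i j
    have r2 := h.bm.r i (j - 1)
    have c1 := h.bm.c i j
    have c2 := h.bm.c (i - 1) j
    have hb0 := h.bm.b i j
    have s1 := h.stepr i j
    have s2 := h.stepr i (j - 1)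
    have t1 := h.stepc i j
    have t2 := h.stepc (i - 1) j
    have bk := h.back (i - 1) (j - 1)
    simp only [sub_add_cancel] at bk
    have f1 := h.bm.f (i - 1) j
    have f2 := h.bm.f i j
    have f3 := h.cf.step i
    have g1 := h.bm.g i (j - 1)
    have g2 := h.bm.g i j
    have g3 := h.cg.step j
    have hA : A i j = ((B i j : ℤ) + (H i j - H (i - 1) j - H i (j - 1) + H (i - 1) (j - 1))).toNat := rfl
    clear_value A
    simp only [Loc]
    generalize H i j = a at *
    generalize H (i - 1) j = b at *
    generalize H i (j - 1) = c at *
    generalize H (i - 1) (j - 1) = d at *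
    generalize A i j = x at *
    generalize B i j = y at *
    generalize f i = u at *
    generalize f (i - 1) = u' at *
    generalize g j = v at *
    generalize g (j - 1) = v' at *
    clear h hK per1
    have b' : y = 0 ∨ d + 1 ≤ a := by
      by_cases hy : y = 0
      · exact Or.inl hy
      · right; exact hb0 hy
    rcases (show b = d ∨ b = d + 1 by omega) with e1 | e1 <;>
    rcases (show c = d ∨ c = d + 1 by omega) with e2 | e2
    · rcases (show a = d ∨ a = d + 1 by omega) with e3 | e3
      · left; omega
      · right; left; omega
    · right; right; right; left; omega
    · right; right; left; omega
    · right; right; right; right; omega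
  refine ⟨A, h.mpos, h.npos, h.lpos, ?_, loc, per1, K, hK⟩
  refine gap_of_band h.npos (fun i j => ?_) ?_
  · show Int.toNat _ = Int.toNat _
    rw [h.gap.1, per1, show i + (m : ℤ) - 1 = i - 1 + m by ring,
      show j + (n : ℤ) - 1 = j - 1 + n by ring, per1, per1, per1]
    congr 1; ring
  · obtain ⟨K', hK0', hK'⟩ := gap_band h.npos h.gap
    refine ⟨K + K' + m + n, fun i j hij => ?_⟩
    by_cases hB : B i j = 0
    · have hd : H i j - H (i - 1) j - H i (j - 1) + H (i - 1) (j - 1) ≠ 0 := by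
        intro h0
        apply hij
        show Int.toNat _ = 0
        rw [h0, hB]; rfl
      constructor
      · by_contra hc
        apply hd
        rw [(hK i j).2 (by linarith), (hK i (j - 1)).2 (by nlinarith), (hK (i - 1) j).2 (by nlinarith),
          (hK (i - 1) (j - 1)).2 (by nlinarith)]
        ring
      · by_contra hc
        apply hd
        rw [(hK i j).1 (by linarith), (hK i (j - 1)).1 (by nlinarith), (hK (i - 1) j).1 (by nlinarith),
          (hK (i - 1) (j - 1)).1 (by nlinarith)]
        ring
    · have := hK' i j hB
      constructor <;> linarith
end

lemma Conn.sh {m n l : ℕ} {A : Mat} {d : Cell → ℤ} {e : ℤ → Cell} (hA : IsGAP m n A)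
    (st : IsStreamEnum m n e l) (lev : Lev m n l (supp A) d) (k : ℤ) {c : Cell}
    (h : Conn A d (Set.range e) c) : Conn A d (Set.range e) (sh m n k c) := by
  induction h with
  | base c hc =>
    obtain ⟨i, rfl⟩ := hc
    exact Conn.base _ ⟨i + k * l, st_per st k i⟩
  | step c c' hc hc' hN hd _ ih =>
    refine Conn.step _ (AffineRSK.sh m n k c') ((sh_supp hA).2 hc) ((sh_supp hA).2 hc') ((sh_NW).2 hN) ?_ ih
    rw [lev.per k c hc, lev.per k c' hc', hd]; ring

lemma conn_mem {A : Mat} {d : Cell → ℤ} {e : ℤ → Cell} (mem : ∀ i, e i ∈ supp A) {c : Cell}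
    (h : Conn A d (Set.range e) c) : c ∈ supp A := by
  cases h with
  | base _ hc => obtain ⟨i, rfl⟩ := hc; exact mem i
  | step c' _ hc => exact hc

lemma Core.pred {m n l : ℕ} {A B : Mat} {H : ℤ → ℤ → ℤ} {f g : ℤ → ℤ} (h : Core m n l A B H f g)
    {c : Cell} (hc : c ∈ supp A) : ∃ c' ∈ supp A, NW c' c ∧ H c'.1 c'.2 = H c.1 c.2 - 1 := by
  have h1 := h.onz (i := c.1) (j := c.2) (Or.inl hc)
  obtain ⟨p, hp, q, hq, e, _, _, _, a⟩ := h.att (i := c.1 - 1) (j := c.2 - 1) (k := H c.1 c.2 - 1) (by omega)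
  refine ⟨(p, q), ?_, ⟨by simp only; omega, by simp only; omega⟩, e⟩
  show A p q ≠ 0
  omega

lemma conn_or {m n l : ℕ} {A B : Mat} {H : ℤ → ℤ → ℤ} {f g : ℤ → ℤ} {c : ℤ → Cell}
    (h : Core m n l A B H f g) (st : IsStreamEnum m n c l) (mem : ∀ i, c i ∈ supp A)
    (num : ∀ i, H (c i).1 (c i).2 = i)
    (best : ∀ e', IsStreamEnum m n e' l → (∀ i, e' i ∈ supp A) → (∀ i, H (e' i).1 (e' i).2 = i) →
      ∀ k, neLe (c k) (e' k)) :
    (∀ x ∈ supp A, Conn A (fun x => H x.1 x.2) (Set.range c) x) ∨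
    ∃ (b : ℤ → Cell) (ρ : ℤ → ℤ), IsStreamEnum m n b l ∧ (∀ k, b k ∈ supp B) ∧
      (∀ k, H (b k).1 (b k).2 = k) ∧ (∀ k, ρ (k + 1) ≤ (b k).1) ∧ (∀ k, A (ρ k) (b k).2 ≠ 0) ∧
      (∀ k, H (ρ k) (b k).2 = k) ∧
      ∀ z ∈ supp A, (b (H z.1 z.2)).1 ≤ z.1 ∨ (z.1 ≤ ρ (H z.1 z.2) ∧ (b (H z.1 z.2)).2 ≤ z.2) := by
  have lev := h.lev
  set D : Cell → ℤ := fun x => H x.1 x.2 with hD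
  set Y : Set Cell := {x | Conn A D (Set.range c) x} with hY
  have Ys : Y ⊆ supp A := fun x hx => conn_mem mem hx
  have Ysh : ∀ (k : ℤ) x, x ∈ Y → sh m n k x ∈ Y := fun k x hx => Conn.sh h.gap st lev k hx
  have Yshi : ∀ (k : ℤ) x, sh m n k x ∈ Y → x ∈ Y := fun k x hx => by
    have := Ysh (-k) _ hx
    rw [sh_sh] at this
    simpa [sh_zero] using this
  have Yst : ∀ x ∈ supp A, ∀ y ∈ Y, NW y x → D y = D x - 1 → x ∈ Y := fun x hx y hy hN e =>
    Conn.step x y hx (Ys hy) hN e hy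
  have cY : ∀ k, c k ∈ Y := fun k => Conn.base _ ⟨k, rfl⟩
  set X : Set Cell := supp A \ Y with hX
  have Xsh : ∀ (k : ℤ) x, x ∈ X → sh m n k x ∈ X := fun k x hx =>
    ⟨lev.inv k x hx.1, fun hy => hx.2 (Yshi k x hy)⟩
  have Xp : ∀ x ∈ X, ∃ x' ∈ X, NW x' x ∧ D x' = D x - 1 := by
    intro x hx
    obtain ⟨x', h1, h2, h3⟩ := h.pred hx.1
    exact ⟨x', ⟨h1, fun hy => hx.2 (Yst x hx.1 x' hy h2 h3)⟩, h2, h3⟩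
  have I : ∀ x ∈ X, ¬ neLe x (c (D x)) := by
    intro x0 hx0 hn0
    set S : Set Cell := {x | x ∈ X ∧ neLe x (c (D x))} with hS
    have levS : Lev m n l S D := by
      refine lev_sub lev (fun x hx => hx.1.1) (fun k x hx => ⟨Xsh k x hx.1, ?_⟩)
      rw [lev.per k x hx.1.1, st_per st]
      exact (sh_neLe).2 hx.2
    obtain ⟨e, he, hk⟩ := stream_lemma levS ⟨x0, hx0, hn0⟩ (by
      rintro x ⟨hx, hn⟩
      obtain ⟨x', h1, h2, h3⟩ := Xp x hx
      refine ⟨x', ⟨h1, ?_⟩, h2, h3⟩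
      rcases lev.cmp h1.1 (mem (D x')) (num _).symm with h4 | h4
      · exact h4
      · exfalso
        apply hx.2
        have hs := st.2.1 (D x')
        rw [show D x' + 1 = D x by omega] at hs
        exact Yst x hx.1 _ (cY (D x')) ⟨hs.1.trans_le hn.1, h4.2.trans_lt h2.2⟩ ((num _).trans h3))
    have e1 := best e he (fun i => (hk i).1.1.1) (fun i => (hk i).2) 0
    have e2 := (hk 0).1.2
    rw [(hk 0).2] at e2
    have := neLe_antisymm e1 e2
    exact (hk 0).1.1.2 (this ▸ cY 0)
  have II : ∀ y ∈ Y, ∀ x ∈ supp A, D x = D y → neLe x y → x ∈ Y := by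
    intro y hy
    have hy' : Conn A D (Set.range c) y := hy
    induction hy' with
    | base y hc =>
      obtain ⟨i, rfl⟩ := hc
      intro x hx e hn
      by_contra hxY
      refine I x ⟨hx, hxY⟩ ?_
      rw [e, show D (c i) = i from num i]; exact hn
    | step y y' hyA hy'A hN hd hc ih =>
      intro x hx e hn
      by_contra hxY
      obtain ⟨x', h1, h2, h3⟩ := Xp x ⟨hx, hxY⟩
      have e' : D x' = D y' := by omega
      rcases lev.cmp h1.1 hy'A e' with h4 | h4
      · exact h1.2 (ih hc x' h1.1 e' h4)
      · refine hxY (Yst x hx y' hc ⟨?_, ?_⟩ (by omega))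
        · exact hN.1.trans_le hn.1
        · exact h4.2.trans_lt h2.2
  by_cases hne : X.Nonempty
  swap
  · left
    intro x hx
    by_contra hc
    exact hne ⟨x, hx, hc⟩
  right
  have levX : Lev m n l X D := lev_sub lev (fun x hx => hx.1) Xsh
  have levY : Lev m n l Y D := lev_sub lev Ys Ysh
  obtain ⟨e, he, hk⟩ := stream_lemma levX hne Xp
  have exx : ∀ k, ∃ x ∈ {x : Cell | x ∈ X ∧ D x = k}, ∀ x' ∈ {x : Cell | x ∈ X ∧ D x = k}, neLe x x' :=
    fun k => exists_sw_most (levX.fin k) ⟨e k, hk k⟩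
      fun a ha b hb => levX.cmp ha.1 hb.1 (ha.2.trans hb.2.symm)
  have exy : ∀ k, ∃ x ∈ {x : Cell | x ∈ Y ∧ D x = k}, ∀ x' ∈ {x : Cell | x ∈ Y ∧ D x = k}, neLe x' x :=
    fun k => exists_ne_most (levY.fin k) ⟨c k, cY k, num k⟩
      fun a ha b hb => levY.cmp ha.1 hb.1 (ha.2.trans hb.2.symm)
  choose x hx xm using exx
  choose y hy ym using exy
  have yx : ∀ k, neLe (y k) (x k) := by
    intro k
    have e1 : D (x k) = D (y k) := (hx k).2.trans (hy k).2.symm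
    rcases lev.cmp (hx k).1.1 (Ys (hy k).1) e1 with h1 | h1
    · exact absurd (II _ (hy k).1 _ (hx k).1.1 e1 h1) (hx k).1.2
    · exact h1
  have xc : ∀ k, (x k).2 < (x (k + 1)).2 := by
    intro k
    obtain ⟨x', h1, h2, h3⟩ := Xp _ (hx (k + 1)).1
    rw [(hx (k + 1)).2] at h3
    exact (xm k x' ⟨h1, by omega⟩).2.trans_lt h2.2
  have yr : ∀ k, (y k).1 < (y (k + 1)).1 := by
    intro k
    obtain ⟨y', h1, h2, h3, h4⟩ := conn_pred st num mem (hy (k + 1)).1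
    rw [(hy (k + 1)).2] at h3
    exact (ym k y' ⟨h4, by omega⟩).1.trans_lt h2.1
  have xy : ∀ k, (x (k + 1)).1 ≤ (y k).1 := by
    intro k
    by_contra hc
    apply (hx (k + 1)).1.2
    refine Yst _ (hx (k + 1)).1.1 (y k) (hy k).1 ⟨by omega, (yx k).2.trans_lt (xc k)⟩ ?_
    rw [(hy k).2, (hx (k + 1)).2]; ring
  have dic : ∀ z ∈ supp A, ∀ k, H z.1 z.2 = k → (y k).1 ≤ z.1 ∨ (z.1 ≤ (x k).1 ∧ (x k).2 ≤ z.2) := by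
    intro z hz k hk
    by_cases hzY : z ∈ Y
    · exact Or.inl (ym k z ⟨hzY, hk⟩).1
    · exact Or.inr (xm k z ⟨⟨hz, hzY⟩, hk⟩)
  have hxH : ∀ k, H (x k).1 (x k).2 = k := fun k => (hx k).2
  have hyH : ∀ k, H (y k).1 (y k).2 = k := fun k => (hy k).2
  have b0 : ∀ k, H ((y k).1 - 1) ((x k).2 - 1) ≤ k - 1 := by
    intro k
    by_contra hc
    obtain ⟨p, hp, q, hq, e, _, _, _, a⟩ := h.att (k := k) (show k ≤ H ((y k).1 - 1) ((x k).2 - 1) by omega)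
    rcases dic (p, q) (show A p q ≠ 0 by omega) k e with h1 | h1 <;> simp only at h1 <;> omega
  have b1 : ∀ k, k ≤ H (y k).1 (x k).2 := fun k => (hyH k).symm.le.trans (h.mono (le_refl _) (yx k).2)
  have b2 : ∀ k, H (y k).1 (x k).2 = k ∧ H ((y k).1 - 1) ((x k).2 - 1) = k - 1 ∧ B (y k).1 (x k).2 ≠ 0 := by
    intro k
    have a0 := b0 k
    have a1 := b1 k
    have c1 : k ≤ H ((y k).1 - 1) (x k).2 ∨ (x k).1 = (y k).1 := by
      rcases (yx k).1.lt_or_eq with h1 | h1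
      · left; exact (hxH k).symm.le.trans (h.mono (by omega) le_rfl)
      · exact Or.inr h1
    have c2 : k ≤ H (y k).1 ((x k).2 - 1) ∨ (x k).2 = (y k).2 := by
      rcases (yx k).2.lt_or_eq with h1 | h1
      · left; exact (hyH k).symm.le.trans (h.mono le_rfl (by omega))
      · exact Or.inr h1.symm
    have hA : ((x k).1 = (y k).1 ∨ (x k).2 = (y k).2) → A (y k).1 (x k).2 ≠ 0 := by
      rintro (h1 | h1)
      · rw [← h1]; exact (hx k).1.1
      · rw [h1]; exact Ys (hy k).1
    have ne : ¬ ((x k).1 = (y k).1 ∧ (x k).2 = (y k).2) := by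
      rintro ⟨h1, h2⟩
      exact (hx k).1.2 ((Prod.ext h1 h2 : x k = y k) ▸ (hy k).1)
    have L := h.loc (y k).1 (x k).2
    simp only [Loc] at L
    by_cases q1 : (x k).1 = (y k).1
    · have q3 := hA (Or.inl q1)
      have q4 : ¬ ((x k).2 = (y k).2) := fun q => ne ⟨q1, q⟩
      have q5 : k ≤ H (y k).1 ((x k).2 - 1) := c2.resolve_right q4
      clear hA ne c1 c2
      refine ⟨?_, ?_, ?_⟩ <;> omega
    · have q5 := c1.resolve_right q1
      by_cases q2 : (x k).2 = (y k).2
      · have q3 := hA (Or.inr q2)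
        clear hA ne c1 c2
        refine ⟨?_, ?_, ?_⟩ <;> omega
      · have q6 := c2.resolve_right q2
        clear hA ne c1 c2
        refine ⟨?_, ?_, ?_⟩ <;> omega
  have yper : ∀ k, y (k + l) = sh m n 1 (y k) := by
    intro k
    apply neLe_antisymm
    · have := ym k (sh m n (-1) (y (k + l))) ⟨Ysh _ _ (hy _).1, by
        rw [levY.per _ _ (hy _).1, (hy _).2]; ring⟩
      have := (sh_neLe (m := m) (n := n) (k := 1)).2 this
      rw [sh_sh] at this
      simpa [sh_zero] using this
    · exact ym (k + l) _ ⟨Ysh _ _ (hy _).1, by rw [levY.per _ _ (hy _).1, (hy _).2]; ring⟩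
  have xper : ∀ k, x (k + l) = sh m n 1 (x k) := by
    intro k
    apply neLe_antisymm
    · exact xm (k + l) _ ⟨Xsh _ _ (hx _).1, by rw [levX.per _ _ (hx _).1, (hx _).2]; ring⟩
    · have := xm k (sh m n (-1) (x (k + l))) ⟨Xsh _ _ (hx _).1, by
        rw [levX.per _ _ (hx _).1, (hx _).2]; ring⟩
      have := (sh_neLe (m := m) (n := n) (k := 1)).2 this
      rw [sh_sh] at this
      simpa [sh_zero] using this
  refine ⟨fun k => ((y k).1, (x k).2), fun k => (x k).1, ⟨st.1, fun i => ⟨yr i, xc i⟩, fun i => ?_⟩,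
    fun k => (b2 k).2.2, fun k => (b2 k).1, xy, fun k => (hx k).1.1, hxH, fun z hz => dic z hz _ rfl⟩
  simp [yper, xper, tauC, sh]

lemma Dom.shift {e e' : ℤ → Cell} (h : Dom e e') (s : ℤ) : Dom e (fun i => e' (i + s)) := by
  intro t ht k
  have := h (t - s) (fun k => by
    have := ht (k - s)
    simpa [show k - s + t = k + (t - s) by ring] using this) (k + s)
  simpa [show k + s + (t - s) = k + t by ring] using this

lemma no_bad {m n l l' : ℕ} {A B C : Mat} {H H0 : ℤ → ℤ → ℤ} {f g f0 g0 : ℤ → ℤ} {e c0 e0 b : ℤ → Cell}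
    {ρ : ℤ → ℤ} (hM : MaxF m n l B f g H) (h : Core m n l A B H f g)
    (ex : ∀ k, LX f k (e k).1) (ey : ∀ k, LX g k (e k).2)
    (h0 : Stp m n l' B C H0 f0 g0 c0 e0) (hl : l' ≤ l) (hd0 : l' = l → Dom e e0)
    (hb : IsStreamEnum m n b l) (bB : ∀ k, b k ∈ supp B) (bH : ∀ k, H (b k).1 (b k).2 = k)
    (bρ : ∀ k, ρ (k + 1) ≤ (b k).1) (ρA : ∀ k, A (ρ k) (b k).2 ≠ 0) (ρH : ∀ k, H (ρ k) (b k).2 = k)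
    (dic : ∀ z ∈ supp A, (b (H z.1 z.2)).1 ≤ z.1 ∨ (z.1 ≤ ρ (H z.1 z.2) ∧ (b (H z.1 z.2)).2 ≤ z.2)) :
    False := by
  have hll : l' = l := le_antisymm hl (st_flow_le h0.core.lev hb bB)
  have hd1 := hd0 hll
  subst hll
  have lv := st_levels h.levB h0.sw.st h0.sw.mem
  set t0 := H (c0 0).1 (c0 0).2 with ht0
  have h1 := h0.shift (-t0)
  have hd := hd1.shift (-t0)
  have cH : ∀ i, H ((fun i => c0 (i + -t0)) i).1 ((fun i => c0 (i + -t0)) i).2 = i := by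
    intro i
    have := lv (i + -t0)
    simp only [this]; ring
  clear_value t0
  generalize (fun i => c0 (i + -t0)) = c' at *
  generalize (fun i => e0 (i + -t0)) = e' at *
  generalize (fun i j => H0 i j - -t0) = H' at *
  generalize (fun i => f0 i - -t0) = f' at *
  generalize (fun i => g0 i - -t0) = g' at *
  clear h0 hd0 hd1 lv
  have le := norm_le h h1 cH
  have h1c := h1.core
  have nB : ∀ z ∈ supp B, H z.1 z.2 = H (z.1 - 1) (z.2 - 1) + 1 := fun z hz => h.onz (Or.inr hz)
  have hr : ∃ r, f r ≤ f' r := by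
    by_contra hc
    push Not at hc
    have k1 : ∀ k, (e (k + 1)).1 ≤ (e' k).1 := by
      intro k
      rw [← (ex (k + 1)).le_iff hM.cf.mono]
      have a := hc (e' k).1
      have b := (h1.ex k).1
      omega
    have k2 := hd 1 k1
    have k3 : ∀ j, g' j + 1 ≤ g j := by
      intro j
      rw [(ey (g' j + 1)).le_iff hM.cg.mono]
      exact (k2 (g' j)).trans (((h1.ey (g' j)).le_iff h1c.g_mono j).1 le_rfl)
    have := hM.mx (fun i j => H' i j + 1) ⟨fun i j => by
        have := h1c.mono (show i - 1 ≤ i by omega) (le_refl j); omega, fun i j => by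
        have := h1c.mono (le_refl i) (show j - 1 ≤ j by omega); omega, fun i j hB => by
        have := h1c.onz (Or.inl hB); omega, fun i j => by
        have := h1c.le_f i j; have := hc i; omega, fun i j => by
        have := h1c.le_g i j; have := k3 j; omega⟩ (c' 0).1 (c' 0).2
    have a := cH 0
    have b := h1.sw.num 0
    omega
  obtain ⟨r, hr⟩ := hr
  obtain ⟨J, hJ⟩ := h1c.f_att r
  have hJ := hJ J le_rfl
  have a1 := le r J
  have a2 := h.le_f r J
  have hk : f' r = f r := by omega
  obtain ⟨p, hp, q, hq, hpq, _, _, _, hB⟩ := h1c.att (k := f r) (i := r) (j := J) (by omega)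
  have hHpq : H p q = f r := by
    have := le p q
    have := h.le_f p q
    have := hM.cf.mono hp
    omega
  have bn : ∀ z ∈ supp B, neLe z (b (H z.1 z.2)) ∨ neLe (b (H z.1 z.2)) z := fun z hz =>
    onz_cmp h (nB z hz) (nB _ (bB _)) (bH _).symm
  have claim : ∀ z, Conn B (fun x => H' x.1 x.2) (Set.range c') z → H z.1 z.2 = H' z.1 z.2 →
      neLe z (b (H z.1 z.2)) := by
    intro z hz
    induction hz with
    | base z hz =>
      obtain ⟨i, rfl⟩ := hz
      intro _
      have sl := st_levels h1c.lev hb bB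
      have := h1.sw.best (fun i => b (i + -(H' (b 0).1 (b 0).2))) (st_shift hb _) (fun i => bB _)
        (fun i => by have := sl (i + -(H' (b 0).1 (b 0).2)); linarith) i
      exact st_cmp hb (bn _ (h1.sw.mem i)) ⟨_, this⟩
    | step z z' hz hz' hN hdz _ ih =>
      intro hH
      have s1 := h.strict (nB z hz) hN.1 hN.2
      have s2 := le z'.1 z'.2
      have hH' : H z'.1 z'.2 = H' z'.1 z'.2 := by omega
      have Q := ih hH'
      by_contra hnQ
      have hw := (bn z hz).resolve_left hnQ
      have hon := nB z hz
      set κ := H z.1 z.2 with hκ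
      rw [show H z'.1 z'.2 = κ - 1 by omega] at Q
      have r1 := bρ (κ - 1)
      rw [sub_add_cancel] at r1
      have r2 := Q.1
      have r3 := hN.1
      have r4 : z.2 = (b κ).2 := by
        by_contra hne
        have := h.mono (show ρ κ ≤ z.1 - 1 by omega) (show (b κ).2 ≤ z.2 - 1 by have := hw.2; omega)
        rw [ρH] at this
        omega
      have r5 : z.1 < (b κ).1 := by
        by_contra hc
        exact hnQ ⟨by omega, by omega⟩
      have r6 : H z.1 (z.2 - 1) ≤ κ - 1 := by
        by_contra hc
        obtain ⟨p, hp, q, hq, e, _, _, _, a⟩ := h.att (k := κ) (show κ ≤ H z.1 (z.2 - 1) by omega)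
        have := dic (p, q) (show A p q ≠ 0 by omega)
        simp only [e] at this
        omega
      have r7 := h.mono (show z.1 - 1 ≤ z.1 by omega) (le_refl (z.2 - 1))
      have r8 := h.mono (show ρ κ ≤ z.1 - 1 by omega) (le_refl (b κ).2)
      rw [ρH, ← r4] at r8
      have L := h.loc z.1 z.2
      simp only [Loc] at L
      have hzB : B z.1 z.2 ≠ 0 := hz
      have hzA : A z.1 z.2 ≠ 0 := by omega
      have := dic z hzA
      rw [← hκ] at this
      omega
  have fin := claim (p, q) (h1.sw.conn _ (show B p q ≠ 0 from fun h0 => by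
    have : B p q = 0 := h0
    omega)) (by simp only; omega)
  simp only [hHpq] at fin
  have fa := fin.1
  simp only at fa
  have fb := bρ (f r)
  have fc := h.le_f (ρ (f r + 1)) (b (f r + 1)).2
  rw [ρH] at fc
  have := hM.cf.mono (show ρ (f r + 1) ≤ r by omega)
  omega

lemma seed {m n l l' : ℕ} {B : Mat} {f g f' g' : ℤ → ℤ} {H' : ℤ → ℤ → ℤ} (hm : 0 < m) (hn : 0 < n)
    (hl : l' ≤ l) (cf : CF m l f) (cg : CF n l g)
    (hi : ∀ i j, H' (i - 1) j ≤ H' i j) (hj : ∀ i j, H' i (j - 1) ≤ H' i j)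
    (hB : ∀ i j, B i j ≠ 0 → H' (i - 1) (j - 1) + 1 ≤ H' i j)
    (lf : ∀ i j, H' i j ≤ f' i) (lg : ∀ i j, H' i j ≤ g' j)
    (pf : ∀ k i : ℤ, f' (i + k * m) = f' i + k * l') (pg : ∀ k i : ℤ, g' (i + k * n) = g' i + k * l') :
    ∃ G, BMf B f g G := by
  have key : ∀ {p : ℕ} (_ : 0 < p) {u v : ℤ → ℤ} (_ : CF p l v) (_ : ∀ k i : ℤ, u (i + k * p) = u i + k * l'),
      ∃ M : ℤ, ∀ i, u i + (l - l') * (i / p) - M ≤ v i := by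
    intro p hp u v cv pu
    obtain ⟨M, hM⟩ := ((Finset.Ico (0 : ℤ) p).image (fun i => u i - v i)).bddAbove
    refine ⟨M, fun i => ?_⟩
    have hp' : (0 : ℤ) < p := by exact_mod_cast hp
    have e := Int.emod_add_mul_ediv i p
    have := hM (Finset.mem_coe.2 (Finset.mem_image_of_mem (fun i => u i - v i)
      (Finset.mem_Ico.2 ⟨Int.emod_nonneg i hp'.ne', Int.emod_lt_of_pos i hp'⟩)))
    have e1 := pu (i / p) (i % p)
    have e2 := cv.per (i / p) (i % p)
    rw [show i % p + i / p * p = i by linarith] at e1 e2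
    rw [e1, e2]
    linarith
  obtain ⟨M1, h1⟩ := key hm cf pf
  obtain ⟨M2, h2⟩ := key hn cg pg
  have hl' : (0 : ℤ) ≤ l - l' := by have : (l' : ℤ) ≤ l := by exact_mod_cast hl
                                    linarith
  have md : ∀ {p : ℕ} {a b : ℤ}, a ≤ b → a / (p : ℤ) ≤ b / p := fun {p a b} h => by
    rcases Nat.eq_zero_or_pos p with rfl | hp
    · simp
    · exact Int.ediv_le_ediv (by exact_mod_cast hp) h
  refine ⟨fun i j => H' i j + (l - l') * min (i / m) (j / n) - max M1 M2, ?_, ?_, ?_, ?_, ?_⟩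
  · intro i j
    have a := hi i j
    have b := mul_le_mul_of_nonneg_left (min_le_min (md (p := m) (show i - 1 ≤ i by omega)) (le_refl (j / (n : ℤ)))) hl'
    linarith
  · intro i j
    have a := hj i j
    have b := mul_le_mul_of_nonneg_left (min_le_min (le_refl (i / (m : ℤ))) (md (p := n) (show j - 1 ≤ j by omega))) hl'
    linarith
  · intro i j h
    have a := hB i j h
    have b := mul_le_mul_of_nonneg_left (min_le_min (md (p := m) (show i - 1 ≤ i by omega)) (md (p := n) (show j - 1 ≤ j by omega))) hl'
    linarith
  · intro i j
    have a := lf i j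
    have b := mul_le_mul_of_nonneg_left (min_le_left (i / (m : ℤ)) (j / n)) hl'
    have c := h1 i
    have d := le_max_left M1 M2
    linarith
  · intro i j
    have a := lg i j
    have b := mul_le_mul_of_nonneg_left (min_le_right (i / (m : ℤ)) (j / n)) hl'
    have c := h2 j
    have d := le_max_right M1 M2
    linarith

theorem step_surj {m n l : ℕ} {B : Mat} {e : ℤ → Cell} (hm : 0 < m) (hn : 0 < n) (hB : IsGAP m n B)
    (he : IsStreamEnum m n e l)
    (hd : B = 0 ∨ ∃ l' C e', Step m n l' B C e' ∧ l' ≤ l ∧ (l' = l → Dom e e')) :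
    ∃ A, IsGAP m n A ∧ Step m n l A B e := by
  have sp := st_per he
  obtain ⟨f, cf, ex⟩ := cutf (m := m) (l := l) (fun i => (e i).1) (fun i => (he.2.1 i).1)
    (fun k i => by simp [sp, sh])
  obtain ⟨g, cg, ey⟩ := cutf (m := n) (l := l) (fun i => (e i).2) (fun i => (he.2.1 i).2)
    (fun k i => by simp [sp, sh])
  have hs : ∃ G, BMf B f g G := by
    rcases hd with rfl | ⟨l', C, e', ⟨H', f', g', c', h'⟩, hl, _⟩
    · exact seed (l' := 0) (f' := fun _ => 0) (g' := fun _ => 0) (H' := fun _ _ => 0) hm hn (Nat.zero_le _) cf cg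
        (by simp) (by simp) (by simp) (by simp) (by simp) (by simp) (by simp)
    · have hc := h'.core
      exact seed hm hn hl cf cg (fun i j => hc.mono (by omega) le_rfl) (fun i j => hc.mono le_rfl (by omega))
        (fun i j h => (hc.onz (Or.inl h)).ge) hc.le_f hc.le_g hc.f_per hc.g_per
  obtain ⟨H, hM⟩ := maxF_exists hm hn he.1 hB cf cg hs
  obtain ⟨A, h⟩ := hM.core
  refine ⟨A, h.gap, H, f, g, ?_⟩
  have hne : (supp A).Nonempty := by
    obtain ⟨p, _, q, _, _, _, _, _, a⟩ := h.att (le_refl (H 0 0))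
    exact ⟨(p, q), show A p q ≠ 0 by omega⟩
  obtain ⟨c0, s0, k0⟩ := stream_lemma h.lev hne (fun c hc => h.pred hc)
  obtain ⟨c, st, mem, num, best⟩ := sw_chan_exists h.lev s0 (fun i => (k0 i).1)
  refine ⟨c, h, ⟨h.lev, st, mem, num, ?_, best⟩, ex, ey⟩
  rcases conn_or h st mem num best with hc | ⟨b, ρ, hb, bB, bH, bρ, ρA, ρH, dic⟩
  · exact hc
  · exfalso
    rcases hd with rfl | ⟨l', C, e', ⟨H', f', g', c', h'⟩, hl, hd⟩
    · exact bB 0 rfl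
    · exact no_bad hM h ex ey h' hl hd hb bB bH bρ ρA ρH dic

structure CI (N l : ℕ) (a : ℕ → ℤ) : Prop where
  lpos : 0 < l
  inc : ∀ x, x + 1 < l → a x < a (x + 1)
  rg : ∀ x, x < l → 1 ≤ a x ∧ a x ≤ N

lemma colExt_per {N l : ℕ} (hl : 0 < l) (a : ℕ → ℤ) (k z : ℤ) :
    colExt N l a (z + k * l) = colExt N l a z + k * N := by
  have h : (l : ℤ) ≠ 0 := by exact_mod_cast hl.ne'
  show a (Int.toNat ((z + k * l) % (l : ℤ))) + (N : ℤ) * ((z + k * l) / (l : ℤ)) =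
    a (Int.toNat (z % (l : ℤ))) + (N : ℤ) * (z / (l : ℤ)) + k * N
  rw [Int.add_mul_emod_self_right, Int.add_mul_ediv_right _ _ h]
  ring

lemma colExt_nat {N l : ℕ} (a : ℕ → ℤ) {x : ℕ} (hx : x < l) : colExt N l a x = a x := by
  show a (Int.toNat ((x : ℤ) % (l : ℤ))) + (N : ℤ) * ((x : ℤ) / (l : ℤ)) = _
  rw [Int.emod_eq_of_lt (by positivity) (by exact_mod_cast hx),
    Int.ediv_eq_zero_of_lt (by positivity) (by exact_mod_cast hx)]
  simp

lemma red {l : ℕ} (hl : 0 < l) (z : ℤ) : ∃ (x : ℕ) (k : ℤ), x < l ∧ z = x + k * l := by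
  have h : (0 : ℤ) < l := by exact_mod_cast hl
  refine ⟨(z % l).toNat, z / l, ?_, ?_⟩
  · have := Int.emod_lt_of_pos z h
    have := Int.emod_nonneg z h.ne'
    omega
  · rw [Int.toNat_of_nonneg (Int.emod_nonneg z h.ne')]
    have := Int.emod_add_mul_ediv z l
    linarith

lemma CI.step {N l : ℕ} {a : ℕ → ℤ} (h : CI N l a) (z : ℤ) : colExt N l a z < colExt N l a (z + 1) := by
  obtain ⟨x, k, hx, rfl⟩ := red h.lpos z
  rw [colExt_per h.lpos, colExt_nat a hx]
  by_cases hx' : x + 1 < l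
  · rw [show (x : ℤ) + k * l + 1 = ((x + 1 : ℕ) : ℤ) + k * l by push_cast; ring, colExt_per h.lpos,
      colExt_nat a hx']
    have := h.inc x hx'
    linarith
  · rw [show (x : ℤ) + k * l + 1 = ((0 : ℕ) : ℤ) + (k + 1) * l by
      have : (x : ℤ) + 1 = l := by omega
      push_cast; linarith, colExt_per h.lpos, colExt_nat a h.lpos]
    have := (h.rg x hx).2
    have := (h.rg 0 h.lpos).1
    linarith

lemma CI.low {N l : ℕ} {a : ℕ → ℤ} (h : CI N l a) : colExt N l a (-1) ≤ 0 ∧ 1 ≤ colExt N l a 0 := by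
  constructor
  · have hl := h.lpos
    rw [show (-1 : ℤ) = ((l - 1 : ℕ) : ℤ) + (-1) * l by omega, colExt_per hl, colExt_nat a (by omega)]
    have := (h.rg (l - 1) (by omega)).2
    linarith
  · have := colExt_nat (N := N) a h.lpos
    push_cast at this
    rw [this]
    exact (h.rg 0 h.lpos).1

/-- one dimensional stream data -/
structure SD (N l : ℕ) (R : ℤ → ℤ) (a : ℕ → ℤ) (r : ℤ) : Prop where
  ci : CI N l a
  ext : ∀ z, R z = colExt N l a (z - r - 1)

lemma SD.cut {N l : ℕ} {R : ℤ → ℤ} {a : ℕ → ℤ} {r : ℤ} (h : SD N l R a r) : R r ≤ 0 ∧ 1 ≤ R (r + 1) := by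
  rw [h.ext, h.ext, show r - r - 1 = -1 by ring, show r + 1 - r - 1 = 0 by ring]
  exact h.ci.low

lemma SD.step {N l : ℕ} {R : ℤ → ℤ} {a : ℕ → ℤ} {r : ℤ} (h : SD N l R a r) (i : ℤ) : R i < R (i + 1) := by
  rw [h.ext, h.ext, show i + 1 - r - 1 = i - r - 1 + 1 by ring]
  exact h.ci.step _

lemma SD.val {N l : ℕ} {R : ℤ → ℤ} {a : ℕ → ℤ} {r : ℤ} (h : SD N l R a r) {p : ℕ} (hp : p < l) :
    a p = R (r + 1 + p) := by
  rw [h.ext, show r + 1 + p - r - 1 = (p : ℤ) by ring, colExt_nat a hp]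

lemma SD.unique {N l : ℕ} {R : ℤ → ℤ} {a a' : ℕ → ℤ} {r r' t : ℤ} (h : SD N l R a r)
    (h' : SD N l (fun i => R (i + t)) a' r') : r' + t = r ∧ ∀ p < l, a' p = a p := by
  have m := step_mono R h.step
  have c := h.cut
  have c' := h'.cut
  have e : r' + t = r := by
    have h1 := m.lt_iff_lt.1 (show R (r' + t) < R (r + 1) by omega)
    have h2 := m.lt_iff_lt.1 (show R r < R (r' + 1 + t) by omega)
    omega
  refine ⟨e, fun p hp => ?_⟩
  rw [h.val hp, h'.val hp, ← e]
  congr 1; ring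

lemma SD.mk' {N l : ℕ} {R : ℤ → ℤ} {a : ℕ → ℤ} {r : ℤ} (hl : 0 < l) (hR : ∀ i, R i < R (i + 1))
    (hp : ∀ k i : ℤ, R (i + k * l) = R i + k * N)
    (h : ∀ p : ℕ, p < l → a p = R (r + 1 + p) ∧ 1 ≤ a p ∧ a p ≤ (N : ℤ)) : SD N l R a r := by
  refine ⟨⟨hl, fun x hx => ?_, fun x hx => (h x hx).2⟩, fun z => ?_⟩
  · rw [(h x (by omega)).1, (h _ hx).1]
    have := hR (r + 1 + x)
    push_cast
    rwa [add_assoc (r + 1)] at this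
  · obtain ⟨x, k, hx, e⟩ := red hl (z - r - 1)
    rw [e, colExt_per hl, colExt_nat a hx, (h x hx).1, ← hp]
    congr 1; linarith

lemma SD.exists {N l : ℕ} {R : ℤ → ℤ} (hl : 0 < l) (hR : ∀ i, R i < R (i + 1))
    (hp : ∀ k i : ℤ, R (i + k * l) = R i + k * N) : ∃ a r, SD N l R a r := by
  obtain ⟨r, h1, h2⟩ := step_cut R hR 0
  refine ⟨fun p => R (r + 1 + p), r, SD.mk' hl hR hp fun p hp' => ⟨rfl, ?_, ?_⟩⟩
  · have := (step_mono R hR).monotone (show r + 1 ≤ r + 1 + p by omega)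
    omega
  · have := (step_mono R hR).monotone (show r + 1 + p ≤ r + 1 * l by omega)
    rw [hp] at this
    linarith

lemma sd_of {m n l : ℕ} {e : ℤ → Cell} {a b : ℕ → ℤ} {r : ℤ} (he : IsStreamEnum m n e l)
    (h : StreamData m n e l a b r) :
    ∃ r₁ r₂, SD m l (fun i => (e i).1) a r₁ ∧ SD n l (fun i => (e i).2) b r₂ ∧ r = r₁ - r₂ := by
  obtain ⟨r₁, r₂, h1, h2, h3⟩ := h
  have sp := st_per he
  exact ⟨r₁, r₂, SD.mk' he.1 (fun i => (he.2.1 i).1) (fun k i => by simp [sp, sh]) h1,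
    SD.mk' he.1 (fun i => (he.2.1 i).2) (fun k i => by simp [sp, sh]) h2, h3⟩

lemma sd_to {m n l : ℕ} {e : ℤ → Cell} {a b : ℕ → ℤ} {r₁ r₂ : ℤ}
    (h1 : SD m l (fun i => (e i).1) a r₁) (h2 : SD n l (fun i => (e i).2) b r₂) :
    StreamData m n e l a b (r₁ - r₂) :=
  ⟨r₁, r₂, fun _ hp => ⟨h1.val hp, h1.ci.rg _ hp⟩, fun _ hp => ⟨h2.val hp, h2.ci.rg _ hp⟩, rfl⟩

lemma CI.congr {N l : ℕ} {a a' : ℕ → ℤ} (h : CI N l a) (e : ∀ p < l, a' p = a p) : CI N l a' :=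
  ⟨h.lpos, fun x hx => by rw [e _ hx, e x (by omega)]; exact h.inc x hx,
    fun x hx => by rw [e x hx]; exact h.rg x hx⟩

lemma colExt_congr {N l : ℕ} (hl : 0 < l) {a a' : ℕ → ℤ} (e : ∀ p < l, a' p = a p) (z : ℤ) :
    colExt N l a' z = colExt N l a z := by
  obtain ⟨x, k, hx, rfl⟩ := red hl z
  rw [colExt_per hl, colExt_per hl, colExt_nat _ hx, colExt_nat _ hx, e x hx]

lemma SD.congr {N l : ℕ} {R : ℤ → ℤ} {a a' : ℕ → ℤ} {r : ℤ} (h : SD N l R a r) (e : ∀ p < l, a' p = a p) :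
    SD N l R a' r := ⟨h.ci.congr e, fun z => by rw [h.ext, colExt_congr h.ci.lpos e]⟩

/-- the stream built from data -/
lemma sd_stream {m n l : ℕ} {a b : ℕ → ℤ} (ha : CI m l a) (hb : CI n l b) (r : ℤ) :
    ∃ e, IsStreamEnum m n e l ∧ SD m l (fun i => (e i).1) a r ∧ SD n l (fun i => (e i).2) b 0 := by
  refine ⟨fun k => (colExt m l a (k - r - 1), colExt n l b (k - 0 - 1)), ⟨ha.lpos, fun i => ⟨?_, ?_⟩, fun i => ?_⟩,
    ⟨ha, fun _ => rfl⟩, ⟨hb, fun _ => rfl⟩⟩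
  · have := ha.step (i - r - 1)
    rwa [show i - r - 1 + 1 = i + 1 - r - 1 by ring] at this
  · have := hb.step (i - 0 - 1)
    rwa [show i - 0 - 1 + 1 = i + 1 - 0 - 1 by ring] at this
  · have h1 := colExt_per (N := m) ha.lpos a 1 (i - r - 1)
    have h2 := colExt_per (N := n) hb.lpos b 1 (i - 0 - 1)
    simp only [tauC]
    rw [show i - r - 1 + 1 * l = i + l - r - 1 by ring] at h1
    rw [show i - 0 - 1 + 1 * l = i + l - 0 - 1 by ring] at h2
    rw [h1, h2, one_mul, one_mul]

lemma sd_same {m n l : ℕ} {e e' : ℤ → Cell} {a b a' b' : ℕ → ℤ} {r : ℤ} (he : IsStreamEnum m n e l)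
    (he' : IsStreamEnum m n e' l)
    (h : StreamData m n e l a b r) (h' : StreamData m n e' l a' b' r) (ea : ∀ p < l, a' p = a p)
    (eb : ∀ p < l, b' p = b p) : ∃ t, ∀ i, e' i = e (i + t) := by
  obtain ⟨r₁, r₂, h1, h2, h3⟩ := sd_of he h
  obtain ⟨r₁', r₂', h1', h2', h3'⟩ := sd_of he' h'
  refine ⟨r₁ - r₁', fun i => Prod.ext ?_ ?_⟩
  · have x := h1.ext (i + (r₁ - r₁'))
    have y := h1'.ext i
    rw [x, y, colExt_congr he.1 ea]
    congr 1; ring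
  · have x := h2.ext (i + (r₁ - r₁'))
    have y := h2'.ext i
    rw [x, y, colExt_congr he.1 eb]
    congr 1; linarith

lemma rOff_iff {N : ℕ} {μ : ℕ → ℕ} {T : ℕ → ℕ → ℤ} {t : ℕ} (ha : CI N (μ t) (fun x => T x t))
    (ha' : CI N (μ t) (fun x => T x (t + 1))) (u : ℤ) :
    (∀ z, colExt N (μ t) (fun x => T x t) z ≤ colExt N (μ t) (fun x => T x (t + 1)) (z + u)) ↔
      (rOff N μ T t : ℤ) ≤ u := by
  set a := fun x => T x t
  set a' := fun x => T x (t + 1)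
  set l := μ t with hl
  have pc : ∀ r : ℕ, pairCond N μ T t r ↔ ∀ z, colExt N l a z ≤ colExt N l a' (z + r) := by
    intro r
    constructor
    · rintro ⟨_, _, h⟩ z
      obtain ⟨x, k, hx, rfl⟩ := red ha.lpos z
      rw [show (x : ℤ) + k * l + r = x + r + k * l by ring, colExt_per ha.lpos, colExt_per ha.lpos, colExt_nat a hx]
      have : a x ≤ colExt N l a' (x + r) := h x hx
      linarith
    · intro h
      refine ⟨ha.inc, fun x hx => ?_, fun x hx => ?_⟩
      · have := ha'.step (x + r)
        show colExt N l a' (x + r) < colExt N l a' (((x + 1 : ℕ) : ℤ) + r)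
        rwa [show ((x + 1 : ℕ) : ℤ) + r = x + r + 1 by push_cast; ring]
      · have := h x
        rwa [colExt_nat a hx] at this
  have m' := (step_mono _ ha'.step).monotone
  have ne : pairCond N μ T t l := by
    rw [pc]
    intro z
    obtain ⟨x, k, hx, rfl⟩ := red ha.lpos z
    rw [show (x : ℤ) + k * l + l = x + (k + 1) * l by ring, colExt_per ha.lpos, colExt_per ha.lpos,
      colExt_nat a hx, colExt_nat a' hx]
    have := (ha.rg x hx).2
    have := (ha'.rg x hx).1
    linarith
  constructor
  · intro h
    have h0 : 0 ≤ u := by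
      by_contra hc
      have h1 := h 0
      have h2 := m' (show 0 + u ≤ -1 by omega)
      have := ha.low.2
      have := ha'.low.1
      omega
    have : rOff N μ T t ≤ u.toNat := Nat.sInf_le ((pc _).2 (by rwa [Int.toNat_of_nonneg h0]))
    omega
  · intro h z
    have := (pc _).1 (Nat.sInf_mem (s := {r | pairCond N μ T t r}) ⟨l, ne⟩) z
    exact this.trans (m' (by
      have : (rOff N μ T t : ℤ) ≤ u := h
      simp only [rOff] at this
      omega))

lemma eta_succ {N : ℕ} {μ : ℕ → ℕ} {T : ℕ → ℕ → ℤ} {t : ℕ} (h : μ t = μ (t + 1)) :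
    etaCol N μ T (t + 1) = etaCol N μ T t + rOff N μ T t := by
  simp only [etaCol]
  rw [show blockStart μ (t + 1) = blockStart μ t by simp [blockStart, h]]
  refine Finset.sum_Ico_succ_top (show blockStart μ t ≤ t from Nat.sInf_le rfl) (fun u => rOff N μ T u)

lemma dom_iff {m n : ℕ} {μ : ℕ → ℕ} {P Q : ℕ → ℕ → ℤ} {ρ : ℕ → ℤ} {t : ℕ} {e e' : ℤ → Cell} {r₁ r₂ r₁' r₂' : ℤ}
    (hμ : μ t = μ (t + 1))
    (h1 : SD m (μ t) (fun i => (e i).1) (fun x => P x t) r₁)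
    (h2 : SD n (μ t) (fun i => (e i).2) (fun x => Q x t) r₂)
    (h1' : SD m (μ t) (fun i => (e' i).1) (fun x => P x (t + 1)) r₁')
    (h2' : SD n (μ t) (fun i => (e' i).2) (fun x => Q x (t + 1)) r₂')
    (e1 : ρ t = r₁ - r₂) (e2 : ρ (t + 1) = r₁' - r₂') :
    Dom e e' ↔ ρ t - ((etaCol n μ Q t : ℤ) - (etaCol m μ P t : ℤ)) ≤
      ρ (t + 1) - ((etaCol n μ Q (t + 1) : ℤ) - (etaCol m μ P (t + 1) : ℤ)) := by
  have x1 := rOff_iff h1.ci h1'.ci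
  have x2 := rOff_iff h2.ci h2'.ci
  have k1 : ∀ s, (∀ k, (e (k + s)).1 ≤ (e' k).1) ↔ (rOff m μ P t : ℤ) ≤ r₁ - r₁' - s := by
    intro s
    rw [← x1]
    constructor
    · intro h z
      have a := h1.ext (z + r₁ + 1)
      have b := h1'.ext (z + r₁ + 1 - s)
      have c := h (z + r₁ + 1 - s)
      rw [sub_add_cancel, a, b] at c
      convert c using 2 <;> ring
    · intro h k
      have a := h1.ext (k + s)
      have b := h1'.ext k
      have c := h (k + s - r₁ - 1)
      rw [a, b]
      convert c using 2; ring
  have k2 : ∀ s, (∀ k, (e (k + s)).2 ≤ (e' k).2) ↔ (rOff n μ Q t : ℤ) ≤ r₂ - r₂' - s := by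
    intro s
    rw [← x2]
    constructor
    · intro h z
      have a := h2.ext (z + r₂ + 1)
      have b := h2'.ext (z + r₂ + 1 - s)
      have c := h (z + r₂ + 1 - s)
      rw [sub_add_cancel, a, b] at c
      convert c using 2 <;> ring
    · intro h k
      have a := h2.ext (k + s)
      have b := h2'.ext k
      have c := h (k + s - r₂ - 1)
      rw [a, b]
      convert c using 2; ring
  rw [eta_succ hμ, eta_succ hμ]
  push_cast
  constructor
  · intro h
    have := (k2 _).1 (h (r₁ - r₁' - rOff m μ P t) ((k1 _).2 (by omega)))
    omega
  · intro h s hs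
    have := (k1 s).1 hs
    exact (k2 s).2 (by omega)

lemma CI.le {N l : ℕ} {a : ℕ → ℤ} (h : CI N l a) : l ≤ N := by
  have : ∀ x, x < l → (x : ℤ) + 1 ≤ a x := by
    intro x
    induction x with
    | zero => intro hx; have := (h.rg 0 hx).1; push_cast; omega
    | succ x ih => intro hx; have := ih (by omega); have := h.inc x hx; push_cast; omega
  have hl := h.lpos
  have a1 := this (l - 1) (by omega)
  have := (h.rg (l - 1) (by omega)).2
  omega

/-- the matrix ball iteration in terms of steps -/
structure KS (m n s : ℕ) (μ : ℕ → ℕ) (P Q : ℕ → ℕ → ℤ) (ρ : ℕ → ℤ) (Aseq : ℕ → Mat) : Prop where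
  last : Aseq s = 0
  st : ∀ t < s, ∃ e, Step m n (μ t) (Aseq t) (Aseq (t + 1)) e ∧
    StreamData m n e (μ t) (fun x => P x t) (fun x => Q x t) (ρ t)

lemma Step.stream {m n l : ℕ} {A B : Mat} {e : ℤ → Cell} (h : Step m n l A B e) : IsStreamEnum m n e l := by
  obtain ⟨H, f, g, c, h⟩ := h
  exact h.stream

lemma Step.ne {m n l : ℕ} {A B : Mat} {e : ℤ → Cell} (h : Step m n l A B e) : A ≠ 0 := by
  obtain ⟨H, f, g, c, h⟩ := h
  rintro rfl
  exact h.sw.mem 0 rfl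

lemma sd_congr {m n l : ℕ} {e : ℤ → Cell} {a b a' b' : ℕ → ℤ} {r : ℤ} (h : StreamData m n e l a b r)
    (ea : ∀ p < l, a' p = a p) (eb : ∀ p < l, b' p = b p) : StreamData m n e l a' b' r := by
  obtain ⟨r₁, r₂, h1, h2, h3⟩ := h
  exact ⟨r₁, r₂, fun p hp => by rw [ea p hp]; exact h1 p hp, fun p hp => by rw [eb p hp]; exact h2 p hp, h3⟩

lemma ks_of {m n s : ℕ} {A : Mat} {μ : ℕ → ℕ} {P Q : ℕ → ℕ → ℤ} {ρ : ℕ → ℤ} (hm : 0 < m) (hn : 0 < n)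
    (hA : IsGAP m n A) (h : Kappa0RelPad m n A s μ P Q ρ) : ∃ Aseq, Aseq 0 = A ∧ KS m n s μ P Q ρ Aseq := by
  obtain ⟨P', Q', ⟨Aseq, ⟨h0, h1, h2, h3⟩, h4⟩, h5, _⟩ := h
  have key : ∀ t < s, IsGAP m n (Aseq t) → ∃ e, Step m n (μ t) (Aseq t) (Aseq (t + 1)) e ∧
      StreamData m n e (μ t) (fun x => P x t) (fun x => Q x t) (ρ t) := by
    intro t ht hg
    obtain ⟨d, e, a, b, c, d'⟩ := h4 t ht
    exact ⟨e, step_of hm hn hg (h3 t ht) a b c, sd_congr d' (fun p hp => (h5 t ht p hp).1)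
      (fun p hp => (h5 t ht p hp).2)⟩
  have gp : ∀ t ≤ s, IsGAP m n (Aseq t) := by
    intro t
    induction t with
    | zero => intro _; rw [h0]; exact hA
    | succ t ih =>
      intro ht
      obtain ⟨e, ⟨H, f, g, c, h⟩, _⟩ := key t ht (ih (by omega))
      exact h.core.gapB
  exact ⟨Aseq, h0, h2, fun t ht => key t ht (gp t ht.le)⟩

lemma ks_to {m n s : ℕ} {μ : ℕ → ℕ} {P Q : ℕ → ℕ → ℤ} {ρ : ℕ → ℤ} {Aseq : ℕ → Mat}
    (h : KS m n s μ P Q ρ Aseq) (hP : PadZeroT s μ P) (hQ : PadZeroT s μ Q) (hμ : ∀ t : ℕ, s ≤ t → μ t = 0)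
    (hρ : ∀ t : ℕ, s ≤ t → ρ t = 0) : Kappa0RelPad m n (Aseq 0) s μ P Q ρ := by
  refine ⟨P, Q, ⟨Aseq, ⟨rfl, fun t ht => ?_, h.last, fun t ht => ?_⟩, fun t ht => ?_⟩,
    fun t _ x _ => ⟨rfl, rfl⟩, hP, hQ, hμ, hρ⟩
  all_goals obtain ⟨e, hs, hd⟩ := h.st t ht
  · exact hs.ne
  · obtain ⟨H, f, g, c, h⟩ := hs
    exact h.to.1
  · obtain ⟨H, f, g, c, h⟩ := hs
    obtain ⟨d, a1, a2, a3⟩ := h.to.2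
    exact ⟨d, e, a1, a2, a3, hd⟩

lemma ks_omega {m n s : ℕ} {μ : ℕ → ℕ} {P Q : ℕ → ℕ → ℤ} {ρ : ℕ → ℤ} {Aseq : ℕ → Mat}
    (h : KS m n s μ P Q ρ Aseq) (hP : PadZeroT s μ P) (hQ : PadZeroT s μ Q) (hμ : ∀ t : ℕ, s ≤ t → μ t = 0)
    (hρ : ∀ t : ℕ, s ≤ t → ρ t = 0) : InOmegaDom m n s μ P Q ρ := by
  have ci : ∀ t < s, CI m (μ t) (fun x => P x t) ∧ CI n (μ t) (fun x => Q x t) := by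
    intro t ht
    obtain ⟨e, hs, hd⟩ := h.st t ht
    obtain ⟨r₁, r₂, h1, h2, _⟩ := sd_of hs.stream hd
    exact ⟨h1.ci, h2.ci⟩
  refine ⟨⟨fun t ht => ?_, fun t ht => ⟨(ci t ht).1.lpos, (ci t ht).1.le, (ci t ht).2.le⟩, hμ⟩, hP, hQ, hρ,
    fun t ht => (ci t ht).1.inc, fun t ht => (ci t ht).1.rg, fun t ht => (ci t ht).2.inc,
    fun t ht => (ci t ht).2.rg, fun t ht he => ?_⟩
  all_goals
    obtain ⟨e, hs, hd⟩ := h.st t (by omega)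
    obtain ⟨e', hs', hd'⟩ := h.st (t + 1) ht
    have dm := step_dom hs hs'
  · exact dm.1
  · obtain ⟨r₁, r₂, h1, h2, h3⟩ := sd_of hs.stream hd
    obtain ⟨r₁', r₂', h1', h2', h3'⟩ := sd_of hs'.stream hd'
    rw [← he] at h1' h2'
    exact (dom_iff he h1 h2 h1' h2' h3 h3').1 (dm.2 he.symm)

lemma iter_exists {m n : ℕ} (hm : 0 < m) (hn : 0 < n) : ∀ (N : ℕ) (A : Mat), IsGAP m n A → sz n A = N →
    ∃ (s : ℕ) (Aseq : ℕ → Mat), Aseq 0 = A ∧ Aseq s = 0 ∧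
      ∀ t < s, ∃ l e, Step m n l (Aseq t) (Aseq (t + 1)) e := by
  intro N
  induction N using Nat.strong_induction_on with
  | _ N ih =>
    intro A hA hN
    by_cases h0 : A = 0
    · exact ⟨0, fun _ => A, rfl, h0, fun t ht => absurd ht (Nat.not_lt_zero t)⟩
    · obtain ⟨l, B, e, hs⟩ := step_exists hm hn hA h0
      obtain ⟨H, f, g, c, hst⟩ := id hs
      obtain ⟨s, Bs, b0, bs, bt⟩ := ih (sz n B) (hN ▸ hst.core.size_lt) B hst.core.gapB rfl
      refine ⟨s + 1, fun t => Nat.casesOn t A Bs, rfl, bs, fun t ht => ?_⟩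
      cases t with
      | zero => exact ⟨l, e, by simp only [b0]; exact hs⟩
      | succ t => exact bt t (by omega)

lemma ks_exists {m n : ℕ} (hm : 0 < m) (hn : 0 < n) {A : Mat} (hA : IsGAP m n A) :
    ∃ s μ P Q ρ Aseq, Aseq 0 = A ∧ KS m n s μ P Q ρ Aseq ∧ PadZeroT s μ P ∧ PadZeroT s μ Q ∧
      (∀ t : ℕ, s ≤ t → μ t = 0) ∧ ∀ t : ℕ, s ≤ t → ρ t = 0 := by
  obtain ⟨s, Aseq, h0, h1, h2⟩ := iter_exists hm hn _ A hA rfl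
  have : ∀ t, ∃ (l : ℕ) (a b : ℕ → ℤ) (r : ℤ), (t < s → ∃ e, Step m n l (Aseq t) (Aseq (t + 1)) e ∧
      StreamData m n e l a b r) ∧ (s ≤ t → l = 0 ∧ r = 0) ∧ ∀ x, s ≤ t ∨ l ≤ x → a x = 0 ∧ b x = 0 := by
    intro t
    by_cases ht : t < s
    · obtain ⟨l, e, hs⟩ := h2 t ht
      have he := hs.stream
      have sp := st_per he
      obtain ⟨a, r₁, ha⟩ := SD.exists (N := m) (R := fun i => (e i).1) he.1 (fun i => (he.2.1 i).1)
        (fun k i => by simp [sp, sh])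
      obtain ⟨b, r₂, hb⟩ := SD.exists (N := n) (R := fun i => (e i).2) he.1 (fun i => (he.2.1 i).2)
        (fun k i => by simp [sp, sh])
      refine ⟨l, fun x => if x < l then a x else 0, fun x => if x < l then b x else 0, r₁ - r₂,
        fun _ => ⟨e, hs, sd_congr (sd_to ha hb) (fun p hp => if_pos hp) (fun p hp => if_pos hp)⟩,
        fun h => absurd ht (by omega), fun x hx => ?_⟩
      have : ¬ x < l := by omega
      exact ⟨if_neg this, if_neg this⟩
    · exact ⟨0, fun _ => 0, fun _ => 0, 0, fun h => absurd h ht, fun _ => ⟨rfl, rfl⟩, fun _ _ => ⟨rfl, rfl⟩⟩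
  choose μ a b r k1 k2 k3 using this
  exact ⟨s, μ, fun x t => a t x, fun x t => b t x, r, Aseq, h0, ⟨h1, k1⟩, fun x t h => (k3 t x h).1,
    fun x t h => (k3 t x h).2, fun t h => (k2 t h).1, fun t h => (k2 t h).2⟩

lemma ks_unique {m n s s' : ℕ} {μ μ' : ℕ → ℕ} {P Q P' Q' : ℕ → ℕ → ℤ} {ρ ρ' : ℕ → ℤ} {Aseq Aseq' : ℕ → Mat}
    (h : KS m n s μ P Q ρ Aseq) (h' : KS m n s' μ' P' Q' ρ' Aseq') (h0 : Aseq' 0 = Aseq 0)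
    (hO : InOmegaDom m n s μ P Q ρ) (hO' : InOmegaDom m n s' μ' P' Q' ρ') :
    s' = s ∧ μ' = μ ∧ P' = P ∧ Q' = Q ∧ ρ' = ρ := by
  have eqA : ∀ t, t ≤ s → t ≤ s' → Aseq' t = Aseq t := by
    intro t
    induction t with
    | zero => intro _ _; exact h0
    | succ t ih =>
      intro h1 h2
      obtain ⟨e, ⟨H, f, g, c, hs⟩, _⟩ := h.st t h1
      obtain ⟨e', ⟨H', f', g', c', hs'⟩, _⟩ := h'.st t h2
      rw [ih (by omega) (by omega)] at hs'
      exact (hs.unique hs').2.1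
  have es : s' = s := by
    rcases lt_trichotomy s s' with hlt | heq | hlt
    · obtain ⟨e', hs', _⟩ := h'.st s hlt
      exact absurd ((eqA s le_rfl hlt.le).trans h.last) hs'.ne
    · exact heq.symm
    · obtain ⟨e', hs', _⟩ := h.st s' hlt
      exact absurd ((eqA s' hlt.le le_rfl).symm.trans h'.last) hs'.ne
  subst es
  have key : ∀ t < s', μ' t = μ t ∧ ρ' t = ρ t ∧ ∀ x < μ t, P' x t = P x t ∧ Q' x t = Q x t := by
    intro t ht
    obtain ⟨e, ⟨H, f, g, c, hs⟩, hd⟩ := h.st t ht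
    obtain ⟨e', ⟨H', f', g', c', hs'⟩, hd'⟩ := h'.st t ht
    rw [eqA t ht.le ht.le] at hs'
    obtain ⟨hl, _, t0, he⟩ := hs.unique hs'
    obtain ⟨r₁, r₂, h1, h2, h3⟩ := sd_of hs.stream hd
    obtain ⟨r₁', r₂', h1', h2', h3'⟩ := sd_of hs'.stream hd'
    rw [← hl] at h1' h2'
    simp only [he] at h1' h2'
    have u1 := h1.unique h1'
    have u2 := h2.unique h2'
    exact ⟨hl.symm, by omega, fun x hx => ⟨u1.2 x hx, u2.2 x hx⟩⟩
  have eμ : μ' = μ := by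
    funext t
    by_cases ht : t < s'
    · exact (key t ht).1
    · rw [hO.1.2.2 t (by omega), hO'.1.2.2 t (by omega)]
  subst eμ
  refine ⟨rfl, rfl, ?_, ?_, ?_⟩
  · funext x t
    by_cases ht : t < s' ∧ x < μ' t
    · exact ((key t ht.1).2.2 x ht.2).1
    · rw [hO.2.1 x t (by omega), hO'.2.1 x t (by omega)]
  · funext x t
    by_cases ht : t < s' ∧ x < μ' t
    · exact ((key t ht.1).2.2 x ht.2).2
    · rw [hO.2.2.1 x t (by omega), hO'.2.2.1 x t (by omega)]
  · funext t
    by_cases ht : t < s'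
    · exact (key t ht).2.1
    · rw [hO.2.2.2.1 t (by omega), hO'.2.2.2.1 t (by omega)]

lemma ks_inj {m n s : ℕ} {μ : ℕ → ℕ} {P Q : ℕ → ℕ → ℤ} {ρ : ℕ → ℤ} {Aseq Aseq' : ℕ → Mat}
    (h : KS m n s μ P Q ρ Aseq) (h' : KS m n s μ P Q ρ Aseq') : Aseq' 0 = Aseq 0 := by
  have : ∀ u t, t + u = s → Aseq' t = Aseq t := by
    intro u
    induction u with
    | zero => intro t ht; rw [show t = s by omega, h.last, h'.last]
    | succ u ih =>
      intro t ht
      obtain ⟨e, hs, hd⟩ := h.st t (by omega)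
      obtain ⟨e', hs', hd'⟩ := h'.st t (by omega)
      rw [ih (t + 1) (by omega)] at hs'
      obtain ⟨t0, he⟩ := sd_same hs.stream hs'.stream hd hd' (fun _ _ => rfl) (fun _ _ => rfl)
      rw [funext he] at hs'
      exact step_inj hs' (hs.shift t0)
  exact this s 0 (by omega)

lemma ks_surj {m n s : ℕ} {μ : ℕ → ℕ} {P Q : ℕ → ℕ → ℤ} {ρ : ℕ → ℤ} (hm : 0 < m) (hn : 0 < n)
    (hO : InOmegaDom m n s μ P Q ρ) : ∃ Aseq, IsGAP m n (Aseq 0) ∧ KS m n s μ P Q ρ Aseq := by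
  obtain ⟨⟨o1, o2, _⟩, _, _, _, p1, p2, q1, q2, dm⟩ := hO
  have : ∀ u t, t + u = s → ∃ Aseq : ℕ → Mat, IsGAP m n (Aseq t) ∧ Aseq s = 0 ∧ ∀ t', t ≤ t' → t' < s →
      ∃ e, Step m n (μ t') (Aseq t') (Aseq (t' + 1)) e ∧
        StreamData m n e (μ t') (fun x => P x t') (fun x => Q x t') (ρ t') := by
    intro u
    induction u with
    | zero =>
      intro t ht
      refine ⟨fun _ => 0, ⟨fun _ _ => rfl, fun j => ?_⟩, rfl, fun t' h1 h2 => absurd h1 (by omega)⟩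
      convert Set.finite_empty
      ext i
      simp
    | succ u ih =>
      intro t ht
      obtain ⟨Bs, hg, hl, hst⟩ := ih (t + 1) (by omega)
      have ht' : t < s := by omega
      have ca : CI m (μ t) (fun x => P x t) := ⟨(o2 t ht').1, p1 t ht', p2 t ht'⟩
      have cb : CI n (μ t) (fun x => Q x t) := ⟨(o2 t ht').1, q1 t ht', q2 t ht'⟩
      obtain ⟨e, he, h1, h2⟩ := sd_stream ca cb (ρ t)
      obtain ⟨A, gA, hA⟩ := step_surj hm hn hg he (by
        by_cases hts : t + 1 = s
        · left; rw [hts]; exact hl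
        · right
          obtain ⟨e', hs', hd'⟩ := hst (t + 1) le_rfl (by omega)
          refine ⟨_, _, e', hs', o1 t (by omega), fun heq => ?_⟩
          obtain ⟨r₁', r₂', h1', h2', h3'⟩ := sd_of hs'.stream hd'
          rw [heq] at h1' h2'
          exact (dom_iff heq.symm h1 h2 h1' h2' (by ring) h3').2 (dm t (by omega) heq.symm))
      refine ⟨fun k => if k = t then A else Bs k, by simpa using gA, ?_, fun t' h3 h4 => ?_⟩
      · simp only [if_neg (show s ≠ t by omega)]; exact hl
      · by_cases htt : t' = t
        · subst htt
          refine ⟨e, ?_, ?_⟩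
          · simpa using hA
          · have := sd_to h1 h2
            rwa [sub_zero] at this
        · simp only [if_neg htt, if_neg (show t' + 1 ≠ t by omega)]
          exact hst t' (by omega) h4
  obtain ⟨Aseq, h1, h2, h3⟩ := this s 0 (by omega)
  exact ⟨Aseq, h1, h2, fun t ht => h3 t (Nat.zero_le t) ht⟩

theorem kappa0_main (m n : ℕ) (hm : 0 < m) (hn : 0 < n) :
    (∀ A : Mat, IsGAP m n A →
      ∃! out : ℕ × (ℕ → ℕ) × (ℕ → ℕ → ℤ) × (ℕ → ℕ → ℤ) × (ℕ → ℤ),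
        Kappa0RelPad m n A out.1 out.2.1 out.2.2.1 out.2.2.2.1 out.2.2.2.2 ∧
          InOmegaDom m n out.1 out.2.1 out.2.2.1 out.2.2.2.1 out.2.2.2.2) ∧
    ∀ (s : ℕ) (μ : ℕ → ℕ) (P Q : ℕ → ℕ → ℤ) (ρ : ℕ → ℤ),
      InOmegaDom m n s μ P Q ρ →
        ∃! A : Mat, IsGAP m n A ∧ Kappa0RelPad m n A s μ P Q ρ := by
  constructor
  · intro A hA
    obtain ⟨s, μ, P, Q, ρ, Aseq, h0, hK, hP, hQ, hμ, hρ⟩ := ks_exists hm hn hA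
    have hO := ks_omega hK hP hQ hμ hρ
    refine ⟨(s, μ, P, Q, ρ), ⟨h0 ▸ ks_to hK hP hQ hμ hρ, hO⟩, ?_⟩
    rintro ⟨s', μ', P', Q', ρ'⟩ ⟨h1, h2⟩
    obtain ⟨Aseq', h0', hK'⟩ := ks_of hm hn hA h1
    obtain ⟨e1, e2, e3, e4, e5⟩ := ks_unique hK hK' (h0'.trans h0.symm) hO h2
    simp only at e1 e2 e3 e4 e5
    rw [e1, e2, e3, e4, e5]
  · intro s μ P Q ρ hO
    obtain ⟨Aseq, hg, hK⟩ := ks_surj hm hn hO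
    refine ⟨Aseq 0, ⟨hg, ks_to hK hO.2.1 hO.2.2.1 hO.1.2.2 hO.2.2.2.1⟩, ?_⟩
    rintro A ⟨hA, h1⟩
    obtain ⟨Aseq', h0', hK'⟩ := ks_of hm hn hA h1
    exact h0' ▸ ks_inj hK hK'

/-- The affine matrix-ball construction `κ₀` is a bijection
from `M̂_{m×n}` onto `Ω_dom`, the set of dominant triples `(P₀, Q₀, ρ)` with
`P₀ ∈ CSST_[m](λ)`, `Q₀ ∈ CSST_[n](λ)` for some `λ ∈ 𝒫_m ∩ 𝒫_n` and
`ρ ∈ ℤ^{λ₁}`. -/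
theorem kappa0_bijection_onto_dominant (m n : ℕ) (hm : 0 < m) (hn : 0 < n) :
    (∀ A : Mat, IsGAP m n A →
      ∃! out : ℕ × (ℕ → ℕ) × (ℕ → ℕ → ℤ) × (ℕ → ℕ → ℤ) × (ℕ → ℤ),
        Kappa0RelPad m n A out.1 out.2.1 out.2.2.1 out.2.2.2.1 out.2.2.2.2 ∧
          InOmegaDom m n out.1 out.2.1 out.2.2.1 out.2.2.2.1 out.2.2.2.2) ∧
    ∀ (s : ℕ) (μ : ℕ → ℕ) (P Q : ℕ → ℕ → ℤ) (ρ : ℕ → ℤ),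
      InOmegaDom m n s μ P Q ρ →
        ∃! A : Mat, IsGAP m n A ∧ Kappa0RelPad m n A s μ P Q ρ := by
  exact kappa0_main m n hm hn

end AffineRSK
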